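/- arXiv:0712.1903 — 4 statements merged into one kernel-verified Lean document; each statement's English description precedes it below -/
import Mathlib

section
/- Let N be an infinite set of positive integers, A a set of positive integers, and for each n ∈ N let σ_n be a random permutation of {1,…,n} whose distribution is invariant under conjugation. Suppose that for every p ≥ 1 and every σ ∈ S_p^{(A)}, P(σ_n(m) = σ(m) for all m = 1,…,p) · n^p → 1 as n → ∞ in N. Then for every finite subset K of A, the law of (N_l(σ_n))_{l∈K} converges weakly to ⊗_{l∈K} Poisson(1/l). -/
open Filter
open scoped Classical

noncomputable def cycleCount {n : ℕ} (σ : Equiv.Perm (Fin n)) (k : ℕ) : ℕ :=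
  Nat.card {x : Fin n // Function.minimalPeriod ⇑σ x = k} / k


lemma alt_aux (y M : ℕ) : ∑ i ∈ Finset.range (M+1), (-1:ℝ)^i * ((y+1).choose i : ℝ) = (-1)^M * (y.choose M : ℝ) := by
  induction M with
  | zero => simp
  | succ M ih =>
    rw [Finset.sum_range_succ, ih, Nat.choose_succ_succ]
    push_cast
    ring

lemma bonf0 (Y M : ℕ) : |(if Y = 0 then (1:ℝ) else 0) - ∑ i ∈ Finset.range (M+1), (-1:ℝ)^i * (Y.choose i : ℝ)|
    ≤ (Y.choose (M+1) : ℝ) := by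
  rcases Y with _ | y
  · rw [Finset.sum_range_succ']
    simp
  · rw [alt_aux]
    simp only [Nat.add_eq_zero_iff, one_ne_zero, and_false, if_false, zero_sub, abs_neg, abs_mul, abs_pow, abs_one, one_pow, one_mul]
    rw [Nat.choose_succ_succ, Nat.abs_cast]
    push_cast
    have : (0:ℝ) ≤ (y.choose (M+1) : ℝ) := by positivity
    linarith

lemma bonf (X r M : ℕ) : |(if X = r then (1:ℝ) else 0) -
      ∑ i ∈ Finset.range (M+1), (-1:ℝ)^i * ((r+i).choose r : ℝ) * (X.choose (r+i) : ℝ)|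
    ≤ ((r+(M+1)).choose r : ℝ) * (X.choose (r+(M+1)) : ℝ) := by
  by_cases h : r ≤ X
  · obtain ⟨Y, rfl⟩ := Nat.exists_eq_add_of_le h
    have key : ∀ i, ((r+i).choose r : ℝ) * ((r+Y).choose (r+i) : ℝ) = ((r+Y).choose r : ℝ) * (Y.choose i : ℝ) := by
      intro i
      by_cases hi : i ≤ Y
      · have := Nat.choose_mul (n := r+Y) (k := r+i) (s := r) (by omega)
        simp at this
        rw [mul_comm]
        exact_mod_cast this
      · rw [Nat.choose_eq_zero_of_lt (show Y < i by omega), Nat.choose_eq_zero_of_lt (show r+Y < r+i by omega)]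
        simp
    simp_rw [mul_assoc, key]
    have e : (if r + Y = r then (1:ℝ) else 0) = ((r+Y).choose r : ℝ) * (if Y = 0 then (1:ℝ) else 0) := by
      rcases Y with _ | y <;> simp
    have e2 : ∑ i ∈ Finset.range (M+1), (-1:ℝ)^i * (((r+Y).choose r : ℝ) * (Y.choose i : ℝ))
      = ((r+Y).choose r : ℝ) * ∑ i ∈ Finset.range (M+1), (-1:ℝ)^i * (Y.choose i : ℝ) := by
      rw [Finset.mul_sum]
      exact Finset.sum_congr rfl fun i _ => by ring
    rw [e, e2, ← mul_sub, abs_mul, Nat.abs_cast]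
    exact mul_le_mul_of_nonneg_left (bonf0 Y M) (by positivity)
  · rw [if_neg (by omega), Finset.sum_eq_zero]
    · simp; positivity
    · intro i _
      rw [Nat.choose_eq_zero_of_lt (show X < r+i by omega)]; simp

lemma key_one (l : Filter ℕ) {Ω : ℕ → Type} [∀ n, Fintype (Ω n)] (P : ∀ n, Ω n → ℝ)
    (hpos : ∀ᶠ n in l, ∀ ω, 0 ≤ P n ω) (X : ∀ n, Ω n → ℕ) (c t : ℝ)
    (h : ∀ j : ℕ, Tendsto (fun n => ∑ ω, P n ω * ((X n ω).choose j : ℝ)) l (nhds (c * (t^j / j.factorial))))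
    (r : ℕ) :
    Tendsto (fun n => ∑ ω, P n ω * (if X n ω = r then (1:ℝ) else 0)) l
      (nhds (c * (Real.exp (-t) * t^r / r.factorial))) := by
  have hch : ∀ i : ℕ, ((r+i).choose r : ℝ) * (t^(r+i) / (r+i).factorial) = t^r / r.factorial * (t^i / i.factorial) := by
    intro i
    have := Nat.add_choose_mul_factorial_mul_factorial r i
    rw [← Nat.choose_symm_add] at this
    have h' : ((r+i).choose r : ℝ) * r.factorial * i.factorial = (r+i).factorial := by exact_mod_cast this
    rw [← h', pow_add]
    have : ((r+i).choose r : ℝ) ≠ 0 := by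
      exact_mod_cast (Nat.choose_pos (by omega)).ne'
    field_simp
  -- partial sums
  have hS : ∀ M, Tendsto (fun n => ∑ ω, P n ω * ∑ i ∈ Finset.range (M+1), (-1:ℝ)^i * ((r+i).choose r : ℝ) * ((X n ω).choose (r+i) : ℝ)) l
      (nhds (c * (t^r / r.factorial) * ∑ i ∈ Finset.range (M+1), (-t)^i / i.factorial)) := by
    intro M
    have : Tendsto (fun n => ∑ i ∈ Finset.range (M+1), (-1:ℝ)^i * ((r+i).choose r : ℝ) * ∑ ω, P n ω * ((X n ω).choose (r+i) : ℝ)) l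
      (nhds (∑ i ∈ Finset.range (M+1), (-1:ℝ)^i * ((r+i).choose r : ℝ) * (c * (t^(r+i) / (r+i).factorial)))) :=
      tendsto_finsetSum _ fun i _ => (h (r+i)).const_mul _
    convert this using 2
    · simp_rw [Finset.mul_sum]
      rw [Finset.sum_comm]
      refine Finset.sum_congr rfl fun i _ => Finset.sum_congr rfl fun ω _ => by ring
    · rw [Finset.mul_sum]
      refine Finset.sum_congr rfl fun i _ => ?_
      rw [show (-1:ℝ)^i * ((r+i).choose r : ℝ) * (c * (t^(r+i) / (r+i).factorial))
        = (-1:ℝ)^i * c * (((r+i).choose r : ℝ) * (t^(r+i) / (r+i).factorial)) by ring, hch, neg_pow]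
      ring
  have hE : ∀ M, Tendsto (fun n => ((r+(M+1)).choose r : ℝ) * ∑ ω, P n ω * ((X n ω).choose (r+(M+1)) : ℝ)) l
      (nhds (c * (t^r / r.factorial) * (t^(M+1) / (M+1).factorial))) := by
    intro M
    have := (h (r+(M+1))).const_mul ((r+(M+1)).choose r : ℝ)
    rwa [mul_left_comm, hch, ← mul_assoc] at this
  have hb : ∀ M, ∀ᶠ n in l, |∑ ω, P n ω * (if X n ω = r then (1:ℝ) else 0) -
      ∑ ω, P n ω * ∑ i ∈ Finset.range (M+1), (-1:ℝ)^i * ((r+i).choose r : ℝ) * ((X n ω).choose (r+i) : ℝ)|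
      ≤ ((r+(M+1)).choose r : ℝ) * ∑ ω, P n ω * ((X n ω).choose (r+(M+1)) : ℝ) := by
    intro M
    filter_upwards [hpos] with n hn
    rw [← Finset.sum_sub_distrib, Finset.mul_sum]
    refine (Finset.abs_sum_le_sum_abs _ _).trans (Finset.sum_le_sum fun ω _ => ?_)
    rw [← mul_sub, abs_mul, abs_of_nonneg (hn ω), mul_left_comm]
    exact mul_le_mul_of_nonneg_left (bonf _ _ _) (hn ω)
  have hfac : Tendsto (fun M => c * (t^r / r.factorial) * (t^(M+1) / (M+1).factorial)) atTop (nhds 0) := by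
    have := ((FloorSemiring.tendsto_pow_div_factorial_atTop t).comp (tendsto_add_atTop_nat 1)).const_mul (c * (t^r / r.factorial))
    simpa using this
  have hexp : Tendsto (fun M => c * (t^r / r.factorial) * ∑ i ∈ Finset.range (M+1), (-t)^i / i.factorial) atTop
      (nhds (c * (Real.exp (-t) * t^r / r.factorial))) := by
    have h1 : HasSum (fun i : ℕ => (-t)^i / (i.factorial:ℝ)) (Real.exp (-t)) := by
      rw [Real.exp_eq_exp_ℝ]
      exact NormedSpace.expSeries_div_hasSum_exp (-t)
    have := ((h1.tendsto_sum_nat).comp (tendsto_add_atTop_nat 1)).const_mul (c * (t^r / r.factorial))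
    have e : c * (Real.exp (-t) * t^r / r.factorial) = c * (t^r / r.factorial) * Real.exp (-t) := by ring
    rw [e]
    exact this
  rw [Metric.tendsto_nhds]
  intro ε hε
  obtain ⟨M, hM1, hM2⟩ := ((Metric.tendsto_nhds.1 hfac (ε/4) (by positivity)).and
    (Metric.tendsto_nhds.1 hexp (ε/4) (by positivity))).exists
  filter_upwards [hb M, Metric.tendsto_nhds.1 (hS M) (ε/4) (by positivity),
    Metric.tendsto_nhds.1 (hE M) (ε/4) (by positivity)] with n h1 h2 h3
  rw [Real.dist_eq] at *
  rw [abs_lt] at *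
  rw [abs_le] at h1
  constructor <;> linarith [h1.1, h1.2, h2.1, h2.2, h3.1, h3.2]

lemma key_multi (l : Filter ℕ) {Ω : ℕ → Type} [∀ n, Fintype (Ω n)] (P : ∀ n, Ω n → ℝ)
    (hpos : ∀ᶠ n in l, ∀ ω, 0 ≤ P n ω) (X : ℕ → ∀ n, Ω n → ℕ) (t : ℕ → ℝ) (r : ℕ → ℕ)
    (K₁ : Finset ℕ) : ∀ K₂ : Finset ℕ, Disjoint K₁ K₂ →
    (∀ j : ℕ → ℕ, Tendsto (fun n => ∑ ω, P n ω * ∏ k ∈ K₁ ∪ K₂, ((X k n ω).choose (j k) : ℝ)) l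
      (nhds (∏ k ∈ K₁ ∪ K₂, (t k ^ j k / (j k).factorial)))) →
    ∀ j : ℕ → ℕ, Tendsto (fun n => ∑ ω, P n ω * (∏ k ∈ K₁, (if X k n ω = r k then (1:ℝ) else 0)) *
        ∏ k ∈ K₂, ((X k n ω).choose (j k) : ℝ)) l
      (nhds ((∏ k ∈ K₁, (Real.exp (-t k) * t k ^ r k / (r k).factorial)) *
        ∏ k ∈ K₂, (t k ^ j k / (j k).factorial))) := by
  induction K₁ using Finset.induction_on with
  | empty =>
    intro K₂ _ h j
    simpa using h j
  | insert a s ha ih =>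
    intro K₂ hd h j
    rw [Finset.disjoint_insert_left] at hd
    have hu : s ∪ insert a K₂ = insert a s ∪ K₂ := by ext x; simp
    have ih' := ih (insert a K₂) (by rw [Finset.disjoint_insert_right]; exact ⟨ha, hd.2⟩) (by rw [hu]; exact h)
    have := key_one l (fun n ω => P n ω * (∏ k ∈ s, (if X k n ω = r k then (1:ℝ) else 0)) *
        ∏ k ∈ K₂, ((X k n ω).choose (j k) : ℝ)) ?_ (X a)
        ((∏ k ∈ s, (Real.exp (-t k) * t k ^ r k / (r k).factorial)) *
        ∏ k ∈ K₂, (t k ^ j k / (j k).factorial)) (t a) ?_ (r a)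
    · convert this using 2
      · refine Finset.sum_congr rfl fun ω _ => ?_
        rw [Finset.prod_insert ha]; ring
      · rw [Finset.prod_insert ha]
        ring
    · filter_upwards [hpos] with n hn ω
      refine mul_nonneg (mul_nonneg (hn ω) (Finset.prod_nonneg fun k _ => ?_)) (by positivity)
      split_ifs <;> norm_num
    · intro i
      have e := ih' (Function.update j a i)
      have hc : ∀ k ∈ K₂, Function.update j a i k = j k := by
        intro k hk
        refine Function.update_of_ne ?_ _ _
        rintro rfl
        exact hd.1 hk
      have hq : ∀ F : ℕ → ℕ → ℝ, ∏ k ∈ K₂, F k (Function.update j a i k) = ∏ k ∈ K₂, F k (j k) :=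
        fun F => Finset.prod_congr rfl (fun k hk => by rw [hc k hk])
      convert e using 2
      · refine Finset.sum_congr rfl fun ω _ => ?_
        rw [Finset.prod_insert hd.1, Function.update_self, hq (fun k i => ((X k _ ω).choose i : ℝ))]
        ring
      · rw [Finset.prod_insert hd.1, Function.update_self, hq (fun k i => t k ^ i / (i.factorial : ℝ))]
        ring

lemma minPer_map {T S : Type} {σ : T → T} {s : S → S} {f : T → S} (hf : Function.Injective f)
    (h : ∀ x, f (σ x) = s (f x)) (x : T) :
    Function.minimalPeriod s (f x) = Function.minimalPeriod σ x := by
  rw [Function.minimalPeriod_eq_minimalPeriod_iff]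
  intro n
  have hs : Function.Semiconj f σ s := h
  have e := (hs.iterate_right n) x
  unfold Function.IsPeriodicPt Function.IsFixedPt
  rw [← e]
  exact hf.eq_iff

lemma minPer_zmod (k : ℕ) (i : ZMod k) : Function.minimalPeriod (Equiv.addRight (1 : ZMod k)) i = k := by
  have h : ∀ n : ℕ, (Equiv.addRight (1 : ZMod k))^[n] i = i + n := by
    intro n
    induction n with
    | zero => simp
    | succ n ih => rw [Function.iterate_succ_apply', ih]; simp [add_assoc]
  refine Nat.dvd_right_iff_eq.1 fun n => ?_
  rw [← Function.isPeriodicPt_iff_minimalPeriod_dvd]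
  unfold Function.IsPeriodicPt Function.IsFixedPt
  rw [h, ← ZMod.natCast_eq_zero_iff]
  simp

/-- equivariant injections -/
abbrev EqInj {T S : Type} (σ : Equiv.Perm T) (s : Equiv.Perm S) : Type :=
  {f : T → S // Function.Injective f ∧ ∀ x, f (σ x) = s (f x)}

lemma iter_inv {T S : Type} (σ : Equiv.Perm T) (s : Equiv.Perm S) (f : EqInj σ s) (x : S) (n : ℕ)
    (h : s^[n] x ∈ Set.range f.1) : x ∈ Set.range f.1 := by
  induction n with
  | zero => simpa using h
  | succ n ih =>
    apply ih
    rw [Function.iterate_succ_apply'] at h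
    obtain ⟨y, hy⟩ := h
    refine ⟨σ.symm y, ?_⟩
    apply s.injective
    rw [← f.2.2, Equiv.apply_symm_apply, hy]

lemma zmod_equiv {S : Type} {k : ℕ} (s : Equiv.Perm S) (g : ZMod k → S)
    (hg : ∀ i, g (Equiv.addRight (1 : ZMod k) i) = s (g i)) (n : ℕ) : g n = s^[n] (g 0) := by
  induction n with
  | zero => simp
  | succ n ih =>
    rw [Function.iterate_succ_apply', ← ih, ← hg]
    simp

noncomputable def stepEquiv {T S : Type} (σ : Equiv.Perm T) (s : Equiv.Perm S) (k : ℕ) [NeZero k] :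
    EqInj (Equiv.sumCongr σ (Equiv.addRight (1 : ZMod k))) s ≃
      Σ f : EqInj σ s, {x : S // Function.minimalPeriod s x = k ∧ x ∉ Set.range f.1} where
  toFun F := ⟨⟨F.1 ∘ Sum.inl, F.2.1.comp Sum.inl_injective, fun x => F.2.2 (Sum.inl x)⟩,
    ⟨F.1 (Sum.inr 0), by
      exact (minPer_map (F.2.1.comp Sum.inr_injective) (fun x => F.2.2 (Sum.inr x)) 0).trans (minPer_zmod k 0), by
      rintro ⟨y, hy⟩
      have := F.2.1 hy
      simp at this⟩⟩
  invFun q := ⟨Sum.elim q.1.1 (fun i => s^[i.val] q.2.1), by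
      refine q.1.2.1.sumElim ?_ ?_
      · intro i j hij
        have hi := ZMod.val_lt i
        have hj := ZMod.val_lt j
        exact ZMod.val_injective k
          ((Function.iterate_eq_iterate_iff_of_lt_minimalPeriod (f := ⇑s) (x := q.2.1)
            (hi.trans_eq q.2.2.1.symm) (hj.trans_eq q.2.2.1.symm)).1 hij)
      · intro x i h
        exact q.2.2.2 (iter_inv σ s q.1 _ _ ⟨x, h⟩), by
      rintro (x | i)
      · exact q.1.2.2 x
      · simp only [Equiv.sumCongr_apply, Sum.map_inr, Sum.elim_inr, Equiv.coe_addRight]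
        rw [← Function.iterate_succ_apply' s, ZMod.val_add]
        conv_rhs => rw [← Function.iterate_mod_minimalPeriod_eq, q.2.2.1]
        rw [ZMod.val_one_eq_one_mod]
        simp⟩
  left_inv F := by
    apply Subtype.ext
    funext x
    rcases x with x | i
    · rfl
    · have := zmod_equiv s (fun i => F.1 (Sum.inr i)) (fun x => F.2.2 (Sum.inr x)) i.val
      simp only [Sum.elim_inr]
      rw [← this]
      simp
  right_inv q := by
    rcases q with ⟨⟨f, hf⟩, ⟨x, hx⟩⟩
    simp only [ZMod.val_zero, Sum.elim_inr, Function.iterate_zero, id]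
    rfl

lemma card_compl {T S : Type} [Finite T] [Finite S] (σ : Equiv.Perm T) (s : Equiv.Perm S) (k : ℕ) (f : EqInj σ s) :
    Nat.card {x : S // Function.minimalPeriod s x = k ∧ x ∉ Set.range f.1} =
      Nat.card {x : S // Function.minimalPeriod s x = k} - Nat.card {x : T // Function.minimalPeriod σ x = k} := by
  have h1 : Nat.card {x : T // Function.minimalPeriod σ x = k} =
      Set.ncard (f.1 '' {x : T | Function.minimalPeriod σ x = k}) := by
    rw [Set.ncard_image_of_injective _ f.2.1]
    exact (Nat.card_coe_set_eq _)
  have h2 : Nat.card {x : S // Function.minimalPeriod s x = k} = Set.ncard {x : S | Function.minimalPeriod s x = k} :=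
    Nat.card_coe_set_eq _
  rw [h1, h2, ← Set.ncard_sdiff _ (Set.toFinite _)]
  · change Nat.card ({x : S | Function.minimalPeriod s x = k ∧ x ∉ Set.range f.1} : Set S) = _
    rw [Nat.card_coe_set_eq]
    congr 1
    ext x
    simp only [Set.mem_ofPred_eq, Set.mem_sdiff, Set.mem_image, Set.mem_range, not_exists]
    constructor
    · rintro ⟨h, h'⟩
      exact ⟨h, fun y hy => h' y hy.2⟩
    · rintro ⟨h, h'⟩
      refine ⟨h, fun y hy => h' y ⟨?_, hy⟩⟩
      rw [← minPer_map f.2.1 f.2.2, hy, h]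
  · rintro _ ⟨y, hy, rfl⟩
    have := minPer_map f.2.1 f.2.2 y
    rw [Set.mem_ofPred_eq] at *
    rw [this, hy]

lemma card_step {T S : Type} [Finite T] [Finite S] (σ : Equiv.Perm T) (s : Equiv.Perm S) (k : ℕ) [NeZero k] :
    Nat.card (EqInj (Equiv.sumCongr σ (Equiv.addRight (1 : ZMod k))) s) =
      Nat.card (EqInj σ s) * (Nat.card {x : S // Function.minimalPeriod s x = k} -
        Nat.card {x : T // Function.minimalPeriod σ x = k}) := by
  have : Fintype (EqInj σ s) := Fintype.ofFinite _
  rw [Nat.card_congr (stepEquiv σ s k), Nat.card_sigma]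
  simp_rw [card_compl]
  simp

lemma dvd_card {n : ℕ} (s : Equiv.Perm (Fin n)) (k : ℕ) :
    k ∣ Nat.card {x : Fin n // Function.minimalPeriod s x = k} := by
  let q : {x : Fin n // Function.minimalPeriod s x = k} → MulAction.orbitRel.Quotient (Subgroup.zpowers s) (Fin n) :=
    fun x => Quotient.mk'' x.1
  have hperm : ∀ x y : Fin n, x ∈ MulAction.orbit (Subgroup.zpowers s) y →
      Function.minimalPeriod s x = Function.minimalPeriod s y := by
    rintro x y ⟨⟨g, hg⟩, rfl⟩
    obtain ⟨i, rfl⟩ := hg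
    have hc : ∀ z, (s ^ i) (s z) = s ((s ^ i) z) := fun z => by
      rw [← Equiv.Perm.mul_apply, ← Equiv.Perm.mul_apply, ← zpow_add_one, ← zpow_one_add, add_comm]
    exact minPer_map (s ^ i).injective hc y
  rw [Nat.card_congr (Equiv.sigmaFiberEquiv q).symm]
  have : Fintype (MulAction.orbitRel.Quotient (Subgroup.zpowers s) (Fin n)) := Fintype.ofFinite _
  rw [Nat.card_sigma]
  refine Finset.dvd_sum fun c _ => ?_
  induction c using Quotient.inductionOn' with
  | h y =>
  by_cases hy : Function.minimalPeriod s y = k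
  · have e : {x // q x = Quotient.mk'' y} ≃ MulAction.orbit (Subgroup.zpowers s) y :=
      { toFun := fun x => ⟨x.1.1, by
          have := x.2
          exact (MulAction.orbitRel_apply.1 (Quotient.eq''.1 this))⟩
        invFun := fun x => ⟨⟨x.1, (hperm _ _ x.2).trans hy⟩, Quotient.eq''.2 (MulAction.orbitRel_apply.2 x.2)⟩
        left_inv := fun x => rfl
        right_inv := fun x => rfl }
    rw [Nat.card_congr e, Nat.card_congr (MulAction.orbitZPowersEquiv s y)]
    rw [show (fun x => s • x) = ⇑s from rfl, hy, Nat.card_zmod]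
  · have : IsEmpty {x // q x = Quotient.mk'' y} := ⟨fun x => hy (by
      rw [← x.1.2]
      exact (hperm _ _ (MulAction.orbitRel_apply.1 (Quotient.eq''.1 x.2))).symm)⟩
    simp

lemma card_eq_mul {n : ℕ} (s : Equiv.Perm (Fin n)) (k : ℕ) :
    Nat.card {x : Fin n // Function.minimalPeriod s x = k} = k * cycleCount s k :=
  (Nat.mul_div_cancel' (dvd_card s k)).symm

lemma card_sum_zmod {T : Type} [Finite T] (σ : Equiv.Perm T) (a : ℕ) [NeZero a] (k : ℕ) :
    Nat.card {x // Function.minimalPeriod (Equiv.sumCongr σ (Equiv.addRight (1 : ZMod a))) x = k} =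
      Nat.card {x // Function.minimalPeriod σ x = k} + if k = a then a else 0 := by
  rw [Nat.card_congr Equiv.subtypeSum, Nat.card_sum]
  have h1 : ∀ x, Function.minimalPeriod (Equiv.sumCongr σ (Equiv.addRight (1 : ZMod a))) (Sum.inl x) =
    Function.minimalPeriod σ x := minPer_map Sum.inl_injective (fun x => rfl)
  have h2 : ∀ x, Function.minimalPeriod (Equiv.sumCongr σ (Equiv.addRight (1 : ZMod a))) (Sum.inr x) = a := fun x =>
    (minPer_map Sum.inr_injective (fun x => rfl) x).trans (minPer_zmod a x)
  simp_rw [h1, h2]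
  congr 1
  split_ifs with h
  · subst h
    simp
  · have : ¬ a = k := fun h' => h h'.symm
    simp [this]

lemma exists_model (K : Finset ℕ) (hK : 0 ∉ K) (L : Multiset ℕ) (hL : ∀ a ∈ L, a ∈ K) :
    ∃ (T : Type) (_ : Fintype T) (σ : Equiv.Perm T), (∀ x, Function.minimalPeriod σ x ∈ K) ∧
      (∀ k, Nat.card {x // Function.minimalPeriod σ x = k} = k * L.count k) ∧
      ∀ (n : ℕ) (s : Equiv.Perm (Fin n)), Nat.card (EqInj σ s) =
        ∏ k ∈ K, k ^ (L.count k) * (cycleCount s k).descFactorial (L.count k) := by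
  induction L using Multiset.induction_on with
  | empty =>
    refine ⟨Empty, inferInstance, 1, fun x => x.elim, fun k => by simp, fun n s => ?_⟩
    simp only [Multiset.count_zero, pow_zero, Nat.descFactorial_zero, mul_one, Finset.prod_const_one]
    have : Unique (EqInj (1 : Equiv.Perm Empty) s) :=
      { default := ⟨fun x => x.elim, fun x => x.elim, fun x => x.elim⟩
        uniq := fun f => Subtype.ext (funext fun x => x.elim) }
    exact Nat.card_unique
  | cons a L ih =>
    obtain ⟨T, hT, σ, h1, h2, h3⟩ := ih (fun b hb => hL b (Multiset.mem_cons_of_mem hb))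
    have haK : a ∈ K := hL a (Multiset.mem_cons_self a L)
    have ha0 : NeZero a := ⟨fun h => hK (h ▸ haK)⟩
    refine ⟨T ⊕ ZMod a, Fintype.ofFinite _, Equiv.sumCongr σ (Equiv.addRight (1 : ZMod a)), ?_, ?_, ?_⟩
    · rintro (x | x)
      · have := minPer_map (s := Equiv.sumCongr σ (Equiv.addRight (1 : ZMod a))) (σ := σ) Sum.inl_injective (fun x => rfl) x
        rw [this]; exact h1 x
      · have := minPer_map (s := Equiv.sumCongr σ (Equiv.addRight (1 : ZMod a))) (σ := Equiv.addRight (1 : ZMod a)) Sum.inr_injective (fun x => rfl) x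
        rw [this, minPer_zmod]; exact haK
    · intro k
      rw [card_sum_zmod, h2, Multiset.count_cons]
      split_ifs with h
      · subst h; ring
      · simp
    · intro n s
      rw [card_step, h3, h2, card_eq_mul, ← Nat.mul_sub, ← Finset.mul_prod_erase _ _ haK, ← Finset.mul_prod_erase _ _ haK]
      rw [Finset.prod_congr (s₁ := K.erase a) (f := fun k => k ^ ((a ::ₘ L).count k) * (cycleCount s k).descFactorial ((a ::ₘ L).count k)) (g := fun k => k ^ (L.count k) * (cycleCount s k).descFactorial (L.count k)) rfl
        (fun k hk => by rw [Multiset.count_cons_of_ne (Finset.ne_of_mem_erase hk)]), Multiset.count_cons_self,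
        Nat.descFactorial_succ, pow_succ]
      ring

lemma expect_eq {n p : ℕ} (hpn : p ≤ n) (P : Equiv.Perm (Fin n) → ℝ)
    (hinv : ∀ σ τ : Equiv.Perm (Fin n), P (σ * τ * σ⁻¹) = P τ) (σ : Equiv.Perm (Fin p)) :
    ∑ s, P s * (Nat.card (EqInj σ s) : ℝ) = (n.descFactorial p : ℝ) *
      ∑ s ∈ Finset.univ.filter (fun s : Equiv.Perm (Fin n) =>
              ∀ (m : Fin n) (hm : (m : ℕ) < p), (s m : ℕ) = (σ ⟨(m : ℕ), hm⟩ : ℕ)), P s := by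
  have hc : ∀ s, (Nat.card (EqInj σ s) : ℝ) =
      ∑ f : Fin p ↪ Fin n, if (∀ x, f (σ x) = s (f x)) then (1:ℝ) else 0 := by
    intro s
    rw [Finset.sum_boole]
    congr 1
    rw [← Fintype.card_subtype, ← Nat.card_eq_fintype_card]
    exact Nat.card_congr
      { toFun := fun f => ⟨⟨f.1, f.2.1⟩, f.2.2⟩
        invFun := fun f => ⟨f.1, f.1.injective, f.2⟩
        left_inv := fun f => rfl
        right_inv := fun f => rfl }
  simp_rw [hc]
  rw [Finset.sum_congr rfl (fun s _ => Finset.mul_sum _ _ _), Finset.sum_comm]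
  have key : ∀ f : Fin p ↪ Fin n, ∑ s, P s * (if (∀ x, f (σ x) = s (f x)) then (1:ℝ) else 0) =
      ∑ s ∈ Finset.univ.filter (fun s : Equiv.Perm (Fin n) =>
              ∀ (m : Fin n) (hm : (m : ℕ) < p), (s m : ℕ) = (σ ⟨(m : ℕ), hm⟩ : ℕ)), P s := by
    intro f
    obtain ⟨τ, hτ⟩ := Equiv.Perm.exists_extending_pair (Fin.castLE hpn) f (Fin.castLE_injective hpn) f.injective
    rw [Finset.sum_filter, ← Equiv.sum_comp (MulAut.conj τ).toEquiv]
    refine Finset.sum_congr rfl fun s _ => ?_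
    have hiff : (∀ x, f (σ x) = (τ * s * τ⁻¹) (f x)) ↔
        ∀ (m : Fin n) (hm : (m : ℕ) < p), (s m : ℕ) = (σ ⟨(m : ℕ), hm⟩ : ℕ) := ?_
    · change P (τ * s * τ⁻¹) * (if (∀ x, f (σ x) = (τ * s * τ⁻¹) (f x)) then (1:ℝ) else 0) = _
      rw [hinv, mul_ite, mul_one, mul_zero]
      simp only [hiff]
    have hinv' : ∀ z, τ⁻¹ (τ z) = z := fun z => τ.symm_apply_apply z
    simp only [← hτ, Equiv.Perm.mul_apply, hinv', τ.injective.eq_iff]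
    constructor
    · intro h m hm
      have := congrArg Fin.val (h ⟨m, hm⟩)
      simpa using this.symm
    · intro h x
      apply Fin.ext
      have := h (Fin.castLE hpn x) (by simp)
      rw [this]
      simp
  simp_rw [key]
  rw [Finset.sum_const, Finset.card_univ, Fintype.card_embedding_eq]
  simp

lemma eqInj_congr {T T' S : Type} (e : T ≃ T') (σ : Equiv.Perm T) (s : Equiv.Perm S) :
    Nat.card (EqInj (e.permCongr σ) s) = Nat.card (EqInj σ s) := by
  refine Nat.card_congr
      { toFun := fun f => ⟨f.1 ∘ e, f.2.1.comp e.injective, fun x => ?_⟩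
        invFun := fun f => ⟨f.1 ∘ e.symm, f.2.1.comp e.symm.injective, fun x => ?_⟩
        left_inv := fun f => ?_
        right_inv := fun f => ?_ }
  · have := f.2.2 (e x)
    simpa using this
  · have := f.2.2 (e.symm x)
    simpa using this
  · apply Subtype.ext; funext x; simp
  · apply Subtype.ext; funext x; simp

lemma moments (Nset : Set ℕ) (A : Set ℕ)
    (P : (n : ℕ) → Equiv.Perm (Fin n) → ℝ)
    (hsum : ∀ n ∈ Nset, ∑ τ, P n τ = 1)
    (hinv : ∀ n ∈ Nset, ∀ σ τ : Equiv.Perm (Fin n), P n (σ * τ * σ⁻¹) = P n τ)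
    (hasym : ∀ p : ℕ, 1 ≤ p → ∀ σ : Equiv.Perm (Fin p),
      (∀ x, Function.minimalPeriod ⇑σ x ∈ A) →
      Tendsto (fun n : ℕ =>
          (∑ s ∈ Finset.univ.filter (fun s : Equiv.Perm (Fin n) =>
              ∀ (m : Fin n) (hm : (m : ℕ) < p), (s m : ℕ) = (σ ⟨(m : ℕ), hm⟩ : ℕ)), P n s)
            * (n : ℝ) ^ p)
        (atTop ⊓ Filter.principal Nset) (nhds 1))
    (K : Finset ℕ) (hK : ↑K ⊆ A) (hK0 : 0 ∉ K) (j : ℕ → ℕ) :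
    Tendsto (fun n : ℕ => ∑ s, P n s * ∏ k ∈ K, ((cycleCount s k).choose (j k) : ℝ))
      (atTop ⊓ Filter.principal Nset)
      (nhds (∏ k ∈ K, ((1 / (k : ℝ)) ^ (j k) / (j k).factorial))) := by
  obtain ⟨T, hT, σ', h1, -, h3⟩ := exists_model K hK0 (∑ k ∈ K, Multiset.replicate (j k) k) (by
    intro a ha
    rw [Multiset.mem_sum] at ha
    obtain ⟨k, hk, ha⟩ := ha
    rwa [Multiset.eq_of_mem_replicate ha])
  have hcount : ∀ k ∈ K, Multiset.count k (∑ k ∈ K, Multiset.replicate (j k) k) = j k := by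
    intro k hk
    rw [Multiset.count_sum']
    simp [Multiset.count_replicate, hk]
  set e := Fintype.equivFin T
  set p := Fintype.card T
  set σ := e.permCongr σ' with hσ
  have hper : ∀ x, Function.minimalPeriod σ x ∈ A := by
    intro x
    have := minPer_map (σ := σ') (s := σ) e.injective (fun x => by simp [hσ]) (e.symm x)
    rw [Equiv.apply_symm_apply] at this
    rw [this]
    exact hK (h1 _)
  have hmem : ∀ᶠ n in (atTop ⊓ Filter.principal Nset), n ∈ Nset :=
    Filter.mem_inf_of_right (Filter.mem_principal_self _)
  -- main limit
  have hmain : Tendsto (fun n : ℕ => ∑ s, P n s * (Nat.card (EqInj σ s) : ℝ)) (atTop ⊓ Filter.principal Nset) (nhds 1) := by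
    have hd : Tendsto (fun n : ℕ => (n.descFactorial p : ℝ) / (n:ℝ)^p) (atTop ⊓ Filter.principal Nset) (nhds 1) := by
      refine Tendsto.mono_left ?_ inf_le_left
      refine (Asymptotics.isEquivalent_iff_tendsto_one ?_).1 (isEquivalent_descFactorial p)
      filter_upwards [eventually_gt_atTop 0] with n hn
      positivity
    have hq : Tendsto (fun n : ℕ =>
          (∑ s ∈ Finset.univ.filter (fun s : Equiv.Perm (Fin n) =>
              ∀ (m : Fin n) (hm : (m : ℕ) < p), (s m : ℕ) = (σ ⟨(m : ℕ), hm⟩ : ℕ)), P n s)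
            * (n : ℝ) ^ p)
        (atTop ⊓ Filter.principal Nset) (nhds 1) := by
      rcases Nat.eq_zero_or_pos p with hp | hp
      · refine (tendsto_const_nhds).congr' ?_
        filter_upwards [hmem] with n hn
        rw [Finset.filter_true_of_mem, hsum n hn, hp]
        · simp
        · intro s _ m hm
          omega
      · exact hasym p hp σ hper
    have := hd.mul hq
    rw [mul_one] at this
    refine this.congr' ?_
    filter_upwards [hmem, Filter.mem_inf_of_left (eventually_ge_atTop p), Filter.mem_inf_of_left (eventually_gt_atTop 0)] with n hn hp hn0
    rw [expect_eq hp (P n) (hinv n hn) σ]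
    have : (n:ℝ)^p ≠ 0 := by positivity
    field_simp
  have hfin := hmain.mul_const (∏ k ∈ K, ((1 / (k : ℝ)) ^ (j k) / (j k).factorial))
  rw [one_mul] at hfin
  refine hfin.congr fun n => ?_
  rw [Finset.sum_mul]
  refine Finset.sum_congr rfl fun s _ => ?_
  rw [hσ, eqInj_congr, h3, mul_assoc]
  congr 1
  push_cast
  rw [← Finset.prod_mul_distrib]
  refine Finset.prod_congr rfl fun k hk => ?_
  rw [hcount k hk, Nat.descFactorial_eq_factorial_mul_choose]
  have hk0 : (k:ℝ) ≠ 0 := by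
    intro h
    exact hK0 ((Nat.cast_eq_zero.1 h) ▸ hk)
  push_cast
  rw [one_div, inv_pow]
  field_simp

theorem stmt_15 (Nset : Set ℕ) (hNset : Nset.Infinite) (A : Set ℕ)
    (P : (n : ℕ) → Equiv.Perm (Fin n) → ℝ)
    (hpos : ∀ n ∈ Nset, ∀ τ, 0 ≤ P n τ)
    (hsum : ∀ n ∈ Nset, ∑ τ, P n τ = 1)
    (hinv : ∀ n ∈ Nset, ∀ σ τ : Equiv.Perm (Fin n), P n (σ * τ * σ⁻¹) = P n τ)
    (hasym : ∀ p : ℕ, 1 ≤ p → ∀ σ : Equiv.Perm (Fin p),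
      (∀ x, Function.minimalPeriod ⇑σ x ∈ A) →
      Tendsto (fun n : ℕ =>
          (∑ s ∈ Finset.univ.filter (fun s : Equiv.Perm (Fin n) =>
              ∀ (m : Fin n) (hm : (m : ℕ) < p), (s m : ℕ) = (σ ⟨(m : ℕ), hm⟩ : ℕ)), P n s)
            * (n : ℝ) ^ p)
        (atTop ⊓ Filter.principal Nset) (nhds 1))
    (K : Finset ℕ) (hK : ↑K ⊆ A) (r : ℕ → ℕ) :
    Tendsto (fun n : ℕ =>
        ∑ s ∈ Finset.univ.filter (fun s : Equiv.Perm (Fin n) =>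
            ∀ k ∈ K, cycleCount s k = r k), P n s)
      (atTop ⊓ Filter.principal Nset)
      (nhds (∏ k ∈ K, Real.exp (-(1 / (k : ℝ))) * (1 / (k : ℝ)) ^ (r k) / (r k).factorial)) := by
  have hpos' : ∀ᶠ n in (atTop ⊓ Filter.principal Nset), ∀ τ, 0 ≤ P n τ :=
    Filter.mem_of_superset (Filter.mem_inf_of_right (Filter.mem_principal_self _)) hpos
  have hmom : ∀ j : ℕ → ℕ, Tendsto (fun n : ℕ => ∑ s, P n s * ∏ k ∈ K, ((cycleCount s k).choose (j k) : ℝ))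
      (atTop ⊓ Filter.principal Nset)
      (nhds (∏ k ∈ K, ((1 / (k : ℝ)) ^ (j k) / (j k).factorial))) := by
    intro j
    by_cases h0 : 0 ∈ K
    · have hm := moments Nset A P hsum hinv hasym (K.erase 0)
        (fun x hx => hK (Finset.mem_of_mem_erase hx)) (Finset.notMem_erase 0 K) j
      have hc0 : ∀ (n : ℕ) (s : Equiv.Perm (Fin n)), cycleCount s 0 = 0 := fun n s => Nat.div_zero _
      have := hm.const_mul (((0:ℕ).choose (j 0) : ℕ) : ℝ)
      convert this using 2
      · rw [Finset.mul_sum]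
        refine Finset.sum_congr rfl fun s _ => ?_
        rw [← Finset.mul_prod_erase _ _ h0, hc0]
        ring
      · rw [← Finset.mul_prod_erase _ _ h0]
        congr 1
        rcases j 0 with _ | i <;> simp
    · exact moments Nset A P hsum hinv hasym K hK h0 j
  have := key_multi (atTop ⊓ Filter.principal Nset) (Ω := fun n => Equiv.Perm (Fin n)) P hpos'
    (fun k n s => cycleCount s k) (fun k => 1 / (k:ℝ)) r K ∅ (Finset.disjoint_empty_right _)
    (by simpa only [Finset.union_empty] using hmom) (fun _ => 0)
  simp only [Finset.prod_empty, mul_one] at this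
  refine this.congr fun n => ?_
  rw [Finset.sum_filter]
  refine Finset.sum_congr rfl fun s _ => ?_
  rw [Finset.prod_ite_zero]
  simp
end

section
/- Let P_n be a conjugation-invariant probability measure on S_n, fix positive integers l_1 < ⋯ < l_q and nonnegative integers k_1,…,k_q not all zero, set p = k_1 l_1 + ⋯ + k_q l_q ≤ n, and fix σ ∈ S_p having exactly k_i cycles of length l_i for each i (and no other cycles). Let S_k(n) = ∑ P_n(⋂_{i=1}^q ⋂_{c∈J_i} E_c(n)), where the sum runs over families (J_i) with J_i a set of k_i cycles of length l_i on {1,…,n}, and E_c(n) is the event that the cycle c appears in the cycle decomposition. Then S_k(n) = [n!/((n-p)! l_1^{k_1}⋯l_q^{k_q} k_1!⋯k_q!)] · P_n({τ ∈ S_n : τ(i) = σ(i) for all i = 1,…,p}). -/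
open Finset
open scoped Classical

/-- A cycle of length `l` on `{1,…,n}`: a permutation together with its support,
acting transitively on the support (for `l = 1`, the identity with a singleton support). -/
def CycleOn (n l : ℕ) : Type :=
  {cp : Finset (Fin n) × Equiv.Perm (Fin n) //
    cp.1.card = l ∧ (∀ x ∉ cp.1, cp.2 x = x) ∧
    ∀ x ∈ cp.1, ∀ y ∈ cp.1, ∃ m : ℕ, (cp.2 ^ m) x = y}

noncomputable instance (n l : ℕ) : Fintype (CycleOn n l) := by
  unfold CycleOn; infer_instance

namespace CycAux

open Equiv Equiv.Perm

variable {n : ℕ}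

lemma mp_pos (τ : Perm (Fin n)) (x : Fin n) : 0 < Function.minimalPeriod τ x :=
  Function.minimalPeriod_pos_of_mem_periodicPts
    (Function.Injective.mem_periodicPts τ.injective x)

lemma pow_eq_pow_iff (τ : Perm (Fin n)) (x : Fin n) (a b : ℕ) :
    (τ ^ a) x = (τ ^ b) x ↔ a % Function.minimalPeriod τ x = b % Function.minimalPeriod τ x := by
  rw [← Perm.iterate_eq_pow, ← Perm.iterate_eq_pow,
    ← Function.iterate_mod_minimalPeriod_eq (n := a), ← Function.iterate_mod_minimalPeriod_eq (n := b)]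
  exact Function.iterate_eq_iterate_iff_of_lt_minimalPeriod (Nat.mod_lt _ (mp_pos τ x))
    (Nat.mod_lt _ (mp_pos τ x))

lemma sameCycle_iff (τ : Perm (Fin n)) (x y : Fin n) :
    SameCycle τ x y ↔ ∃ t : ℕ, (τ ^ t) x = y := by
  constructor
  · intro h
    exact h.exists_nat_pow_eq
  · rintro ⟨t, rfl⟩
    exact ⟨t, by simp⟩

lemma mp_pow (τ : Perm (Fin n)) (x : Fin n) (t : ℕ) :
    Function.minimalPeriod τ ((τ ^ t) x) = Function.minimalPeriod τ x := by
  rw [← Perm.iterate_eq_pow]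
  exact Function.minimalPeriod_apply_iterate (Function.Injective.mem_periodicPts τ.injective x) t

lemma mp_sameCycle (τ : Perm (Fin n)) {x y : Fin n} (h : SameCycle τ x y) :
    Function.minimalPeriod τ x = Function.minimalPeriod τ y := by
  obtain ⟨t, rfl⟩ := (sameCycle_iff τ x y).1 h
  exact (mp_pow τ x t).symm

lemma card_orbit (τ : Perm (Fin n)) (x : Fin n) :
    (univ.filter (fun y => SameCycle τ x y)).card = Function.minimalPeriod τ x := by
  have : univ.filter (fun y => SameCycle τ x y) =
      (range (Function.minimalPeriod τ x)).image (fun t => (τ ^ t) x) := by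
    ext y
    simp only [mem_filter, mem_univ, true_and, mem_image, mem_range, sameCycle_iff]
    constructor
    · rintro ⟨t, rfl⟩
      exact ⟨t % Function.minimalPeriod τ x, Nat.mod_lt _ (mp_pos τ x), by
        rw [pow_eq_pow_iff, Nat.mod_mod]⟩
    · rintro ⟨t, _, rfl⟩
      exact ⟨t, rfl⟩
  rw [this, card_image_of_injOn, card_range]
  intro a ha b hb hab
  have h := (pow_eq_pow_iff τ x a b).1 hab
  simp only [coe_range, Set.mem_Iio] at ha hb
  rwa [Nat.mod_eq_of_lt ha, Nat.mod_eq_of_lt hb] at h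

/-- cycles of `τ` of length `l`. -/
abbrev Cyc (τ : Perm (Fin n)) (l : ℕ) : Type :=
  {c : CycleOn n l // ∀ x ∈ c.1.1, τ x = c.1.2 x}

/-- points of period `l`. -/
abbrev Pts (τ : Perm (Fin n)) (l : ℕ) : Type :=
  {x : Fin n // Function.minimalPeriod τ x = l}

lemma perm_mem {l : ℕ} (c : CycleOn n l) {x : Fin n} (hx : x ∈ c.1.1) : c.1.2 x ∈ c.1.1 := by
  by_contra h
  have := c.2.2.1 _ h
  exact h ((c.1.2.injective this).symm ▸ hx)

lemma perm_pow {τ : Perm (Fin n)} {l : ℕ} (c : Cyc τ l) {x : Fin n} (hx : x ∈ c.1.1.1) (t : ℕ) :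
    (c.1.1.2 ^ t) x = (τ ^ t) x ∧ (τ ^ t) x ∈ c.1.1.1 := by
  induction t with
  | zero => simpa using hx
  | succ t ih =>
    rw [pow_succ', pow_succ', Perm.mul_apply, Perm.mul_apply, ih.1, c.2 _ ih.2]
    exact ⟨rfl, perm_mem c.1 ih.2⟩

lemma mem_iff {τ : Perm (Fin n)} {l : ℕ} (c : Cyc τ l) {x : Fin n} (hx : x ∈ c.1.1.1) (y : Fin n) :
    y ∈ c.1.1.1 ↔ SameCycle τ x y := by
  rw [sameCycle_iff]
  constructor
  · intro hy
    obtain ⟨m, hm⟩ := c.1.2.2.2 x hx y hy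
    exact ⟨m, by rw [← (perm_pow c hx m).1, hm]⟩
  · rintro ⟨t, rfl⟩
    exact (perm_pow c hx t).2

lemma mp_of_mem {τ : Perm (Fin n)} {l : ℕ} (c : Cyc τ l) {x : Fin n} (hx : x ∈ c.1.1.1) :
    Function.minimalPeriod τ x = l := by
  rw [← card_orbit, ← c.1.2.1]
  congr 1
  ext y
  simp [mem_iff c hx]

lemma cyc_ext {τ : Perm (Fin n)} {l : ℕ} (c d : Cyc τ l) {x : Fin n} (hx : x ∈ c.1.1.1)
    (hx' : x ∈ d.1.1.1) : c = d := by
  have h1 : c.1.1.1 = d.1.1.1 := by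
    ext y; rw [mem_iff c hx, mem_iff d hx']
  apply Subtype.ext
  apply Subtype.ext
  apply Prod.ext h1
  ext1 y
  by_cases hy : y ∈ c.1.1.1
  · rw [← c.2 y hy, ← d.2 y (h1 ▸ hy)]
  · rw [c.1.2.2.1 y hy, d.1.2.2.1 y (h1 ▸ hy)]

lemma exists_cyc (τ : Perm (Fin n)) (l : ℕ) (x : Pts τ l) : ∃ c : Cyc τ l, x.1 ∈ c.1.1.1 := by
  refine ⟨⟨⟨(univ.filter (fun y => SameCycle τ x y), τ.cycleOf x), ?_, ?_, ?_⟩, ?_⟩, ?_⟩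
  · simp only [card_orbit, x.2]
  · intro y hy
    simp only [mem_filter, mem_univ, true_and] at hy
    exact cycleOf_apply_of_not_sameCycle hy
  · intro y hy z hz
    simp only [mem_filter, mem_univ, true_and] at hy hz
    obtain ⟨m, hm⟩ := (sameCycle_iff τ y z).1 (hy.symm.trans hz)
    refine ⟨m, ?_⟩
    simp only
    rw [hy.cycleOf_eq, cycleOf_pow_apply_self, hm]
  · intro y hy
    simp only [mem_filter, mem_univ, true_and] at hy
    exact hy.cycleOf_apply.symm
  · simp [SameCycle.refl]

/-- the cycle through a point -/
noncomputable def cyc (τ : Perm (Fin n)) (l : ℕ) (x : Pts τ l) : Cyc τ l :=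
  (exists_cyc τ l x).choose

lemma mem_cyc (τ : Perm (Fin n)) (l : ℕ) (x : Pts τ l) : x.1 ∈ (cyc τ l x).1.1.1 :=
  (exists_cyc τ l x).choose_spec

lemma cyc_eq_iff (τ : Perm (Fin n)) (l : ℕ) (x : Pts τ l) (c : Cyc τ l) :
    cyc τ l x = c ↔ x.1 ∈ c.1.1.1 := by
  constructor
  · rintro rfl; exact mem_cyc τ l x
  · intro h; exact cyc_ext _ _ (mem_cyc τ l x) h

lemma cyc_eq_cyc_iff (τ : Perm (Fin n)) (l : ℕ) (x y : Pts τ l) :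
    cyc τ l x = cyc τ l y ↔ SameCycle τ x.1 y.1 := by
  rw [eq_comm, cyc_eq_iff, mem_iff _ (mem_cyc τ l x)]

lemma card_fibre (τ : Perm (Fin n)) (l : ℕ) (c : Cyc τ l) :
    Fintype.card {x : Pts τ l // cyc τ l x = c} = l := by
  refine Eq.trans ?_ c.1.2.1
  rw [← Fintype.card_coe]
  apply Fintype.card_congr
  exact
    { toFun := fun x => ⟨x.1.1, (cyc_eq_iff τ l x.1 c).1 x.2⟩
      invFun := fun x => ⟨⟨x.1, mp_of_mem c x.2⟩, (cyc_eq_iff τ l _ c).2 x.2⟩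
      left_inv := fun x => rfl
      right_inv := fun x => rfl }

lemma card_pts (τ : Perm (Fin n)) (l : ℕ) :
    Fintype.card (Pts τ l) = Fintype.card (Cyc τ l) * l := by
  rw [← Fintype.card_congr (Equiv.sigmaFiberEquiv (cyc τ l)), Fintype.card_sigma]
  simp [card_fibre]

lemma cycleCount_eq (τ : Perm (Fin n)) (l : ℕ) (hl : 0 < l) :
    cycleCount τ l = Fintype.card (Cyc τ l) := by
  unfold cycleCount
  have := card_pts τ l
  rw [Nat.card_eq_fintype_card, this, Nat.mul_div_cancel _ hl]

/-- choices of representatives in distinct cycles -/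
abbrev Rep (τ : Perm (Fin n)) (l k : ℕ) : Type :=
  {x : Fin k → Pts τ l // Function.Injective (fun j => cyc τ l (x j))}

noncomputable def repEquiv (τ : Perm (Fin n)) (l k : ℕ) :
    Rep τ l k ≃ Σ e : Fin k ↪ Cyc τ l, ∀ j, {x : Pts τ l // cyc τ l x = e j} where
  toFun x := ⟨⟨fun j => cyc τ l (x.1 j), x.2⟩, fun j => ⟨x.1 j, rfl⟩⟩
  invFun y := ⟨fun j => (y.2 j).1, by
    intro a b h
    have : y.1 a = y.1 b := by rw [← (y.2 a).2, ← (y.2 b).2]; exact h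
    exact y.1.injective this⟩
  left_inv x := rfl
  right_inv y := by
    obtain ⟨e, y⟩ := y
    have h : (⟨fun j => cyc τ l (y j).1, by
      intro a b h
      have : e a = e b := by rw [← (y a).2, ← (y b).2]; exact h
      exact e.injective this⟩ : Fin k ↪ Cyc τ l) = e := by
      ext1 j; exact (y j).2
    refine Sigma.ext h ?_
    apply Function.hfunext rfl
    intro a b hab
    cases hab
    refine (Subtype.heq_iff_coe_eq ?_).2 rfl
    intro z
    simp only [Function.Embedding.coeFn_mk, (y a).2]

lemma card_rep (τ : Perm (Fin n)) (l k : ℕ) :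
    Fintype.card (Rep τ l k) = (Fintype.card (Cyc τ l)).descFactorial k * l ^ k := by
  rw [Fintype.card_congr (repEquiv τ l k), Fintype.card_sigma]
  simp only [Fintype.card_pi, card_fibre, prod_const, card_univ, Fintype.card_fin, sum_const,
    smul_eq_mul]
  rw [Fintype.card_embedding_eq, Fintype.card_fin]

section emb

variable {p : ℕ}

/-- equivariant injections -/
abbrev EqEmb (σ : Perm (Fin p)) (τ : Perm (Fin n)) : Type :=
  {f : Fin p → Fin n // Function.Injective f ∧ ∀ x, τ (f x) = f (σ x)}

lemma eqv_pow {σ : Perm (Fin p)} {τ : Perm (Fin n)} {f : Fin p → Fin n}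
    (h : ∀ x, τ (f x) = f (σ x)) (t : ℕ) (x : Fin p) : (τ ^ t) (f x) = f ((σ ^ t) x) := by
  induction t with
  | zero => simp
  | succ t ih => rw [pow_succ', pow_succ', Perm.mul_apply, Perm.mul_apply, ih, h]

lemma eqv_mp {σ : Perm (Fin p)} {τ : Perm (Fin n)} (f : EqEmb σ τ) (x : Fin p) :
    Function.minimalPeriod τ (f.1 x) = Function.minimalPeriod σ x := by
  rw [Function.minimalPeriod_eq_minimalPeriod_iff]
  intro t
  simp only [Function.IsPeriodicPt, Function.IsFixedPt, Perm.iterate_eq_pow]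
  rw [eqv_pow f.2.2, f.2.1.eq_iff]

lemma eqv_same {σ : Perm (Fin p)} {τ : Perm (Fin n)} (f : EqEmb σ τ) {x y : Fin p}
    (h : SameCycle τ (f.1 x) (f.1 y)) : SameCycle σ x y := by
  rw [sameCycle_iff] at h ⊢
  obtain ⟨t, ht⟩ := h
  rw [eqv_pow f.2.2, f.2.1.eq_iff] at ht
  exact ⟨t, ht⟩

/-- restriction of an equivariant injection to representatives -/
noncomputable def restr {q : ℕ} {l k : Fin q → ℕ} {σ : Perm (Fin p)} (τ : Perm (Fin n))
    (y : ∀ i, Rep σ (l i) (k i)) (f : EqEmb σ τ) (i : Fin q) : Rep τ (l i) (k i) :=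
  ⟨fun j => ⟨f.1 ((y i).1 j).1, by rw [eqv_mp, ((y i).1 j).2]⟩, by
    intro a b h
    apply (y i).2
    simp only [cyc_eq_cyc_iff] at h ⊢
    exact eqv_same f h⟩

lemma card_eqEmb {q : ℕ} {l k : Fin q → ℕ} (hmono : StrictMono l)
    (σ : Perm (Fin p)) (τ : Perm (Fin n))
    (hσ1 : ∀ i, Fintype.card (Cyc σ (l i)) = k i)
    (hl : ∀ i, 0 < l i)
    (hσ2 : ∀ x : Fin p, ∃ i, Function.minimalPeriod ⇑σ x = l i) :
    Fintype.card (EqEmb σ τ) = ∏ i, Fintype.card (Rep τ (l i) (k i)) := by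
  have hy : ∀ i, Nonempty (Rep σ (l i) (k i)) := by
    intro i
    rw [← Fintype.card_pos_iff, card_rep, hσ1, Nat.descFactorial_self]
    have := hl i
    positivity
  have y : ∀ i, Rep σ (l i) (k i) := fun i => (hy i).some
  have hcov : ∀ z : Fin p, ∃ (i : Fin q) (j : Fin (k i)) (t : ℕ), (σ ^ t) ((y i).1 j).1 = z := by
    intro z
    obtain ⟨i, hi⟩ := hσ2 z
    have hb : Function.Bijective (fun j => cyc σ (l i) ((y i).1 j)) := by
      rw [Fintype.bijective_iff_injective_and_card]
      exact ⟨(y i).2, by rw [hσ1, Fintype.card_fin]⟩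
    obtain ⟨j, hj⟩ := hb.2 (cyc σ (l i) ⟨z, hi⟩)
    simp only [cyc_eq_cyc_iff, sameCycle_iff] at hj
    obtain ⟨t, ht⟩ := hj
    exact ⟨i, j, t, ht⟩
  rw [← Fintype.card_pi]
  apply Fintype.card_of_bijective (f := restr τ y)
  constructor
  · intro f g h
    apply Subtype.ext
    funext z
    obtain ⟨i, j, t, rfl⟩ := hcov z
    rw [← eqv_pow f.2.2, ← eqv_pow g.2.2]
    have h2 := congrArg (fun r => (r.1 j).1) (congrFun h i)
    simp only [restr] at h2
    rw [h2]
  · intro x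
    choose I J T hT using hcov
    -- key equivalence
    have key : ∀ (i i' : Fin q) (j : Fin (k i)) (j' : Fin (k i')) (t t' : ℕ),
        (σ ^ t) ((y i).1 j).1 = (σ ^ t') ((y i').1 j').1 ↔
        (τ ^ t) ((x i).1 j).1 = (τ ^ t') ((x i').1 j').1 := by
      have gen : ∀ {m m' : ℕ} (ρ : Perm (Fin m)) (ρ' : Perm (Fin m'))
        (y : ∀ i, Rep ρ (l i) (k i)) (x : ∀ i, Rep ρ' (l i) (k i))
        (i i' : Fin q) (j : Fin (k i)) (j' : Fin (k i')) (t t' : ℕ),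
        (ρ ^ t) ((y i).1 j).1 = (ρ ^ t') ((y i').1 j').1 →
        (ρ' ^ t) ((x i).1 j).1 = (ρ' ^ t') ((x i').1 j').1 := by
        intro m m' ρ ρ' y x i i' j j' t t' h
        have hii : i = i' := by
          apply hmono.injective
          rw [← ((y i).1 j).2, ← ((y i').1 j').2, ← mp_pow _ _ t, h, mp_pow]
        subst hii
        have hjj : j = j' := by
          apply (y i).2
          simp only [cyc_eq_cyc_iff]
          have h1 := (sameCycle_iff ρ _ _).2 ⟨t, h⟩
          exact h1.trans ((sameCycle_iff ρ _ _).2 ⟨t', rfl⟩).symm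
        subst hjj
        rw [pow_eq_pow_iff] at h ⊢
        rwa [((x i).1 j).2, ← ((y i).1 j).2]
      intro i i' j j' t t'
      exact ⟨gen σ τ y x i i' j j' t t', gen τ σ x y i i' j j' t t'⟩
    refine ⟨⟨fun z => (τ ^ T z) ((x (I z)).1 (J z)).1, ?_, ?_⟩, ?_⟩
    · intro a b h
      rw [← hT a, ← hT b, key]
      exact h
    · intro z
      rw [← Perm.mul_apply, ← pow_succ', ← key, pow_succ', Perm.mul_apply, hT, hT]
    · funext i
      apply Subtype.ext
      funext j
      apply Subtype.ext
      simp only [restr]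
      have := (key (I ((y i).1 j).1) i (J ((y i).1 j).1) j (T ((y i).1 j).1) 0).1 (by rw [hT]; simp)
      simpa using this

lemma card_extend (hpn : p ≤ n) (f : Fin p → Fin n) (hf : Function.Injective f) :
    Fintype.card {s : Perm (Fin n) // ∀ x, s (Fin.castLE hpn x) = f x} = (n - p).factorial := by
  obtain ⟨g, hg⟩ := Perm.exists_extending_pair (Fin.castLE hpn) f (Fin.castLE_injective hpn) hf
  have e1 : {s : Perm (Fin n) // ∀ x, s (Fin.castLE hpn x) = f x} ≃
      {s : Perm (Fin n) // ∀ a : Fin n, ¬ (p ≤ (a : ℕ)) → s a = a} := by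
    refine (Equiv.mulLeft g⁻¹).subtypeEquiv ?_
    intro s
    simp only [Equiv.coe_mulLeft, Perm.mul_apply, Perm.inv_eq_iff_eq]
    constructor
    · intro h a ha
      have h1 : a = Fin.castLE hpn ⟨a, not_le.1 ha⟩ := rfl
      rw [h1, h, ← hg]
    · intro h x
      rw [h _ (by simp), hg]
  rw [Fintype.card_congr (e1.trans (Perm.subtypeEquivSubtypePerm (fun a : Fin n => p ≤ (a : ℕ))).symm),
    Fintype.card_perm]
  congr 1
  rw [Fintype.card_subtype]
  have := Finset.card_filter_add_card_filter_not (s := (univ : Finset (Fin n))) (fun a : Fin n => p ≤ (a : ℕ))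
  have h2 : (univ.filter (fun a : Fin n => ¬ p ≤ (a : ℕ))).card = p := by
    have : univ.filter (fun a : Fin n => ¬ p ≤ (a : ℕ)) = univ.map (Fin.castLEEmb hpn) := by
      ext a
      simp only [mem_filter, mem_univ, true_and, mem_map, Fin.castLEEmb_apply]
      constructor
      · intro ha
        exact ⟨⟨a, not_le.1 ha⟩, rfl⟩
      · rintro ⟨b, rfl⟩
        simp
    rw [this, card_map, card_univ, Fintype.card_fin]
  rw [h2, card_univ, Fintype.card_fin] at this
  omega

/-- `τ` extends `σ` -/
def Ext (σ : Perm (Fin p)) (τ : Perm (Fin n)) : Prop :=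
  ∀ (m : Fin n) (hm : (m : ℕ) < p), (τ m : ℕ) = (σ ⟨(m : ℕ), hm⟩ : ℕ)

lemma ext_iff' (hpn : p ≤ n) (σ : Perm (Fin p)) (τ s : Perm (Fin n)) :
    Ext σ (s⁻¹ * τ * s) ↔ ∀ x, τ (s (Fin.castLE hpn x)) = s (Fin.castLE hpn (σ x)) := by
  constructor
  · intro h x
    have := h (Fin.castLE hpn x) x.2
    have h2 : (s⁻¹ * τ * s) (Fin.castLE hpn x) = Fin.castLE hpn (σ x) := Fin.ext this
    rw [← h2]
    simp
  · intro h m hm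
    have := h ⟨m, hm⟩
    have h1 : Fin.castLE hpn ⟨m, hm⟩ = m := rfl
    rw [h1] at this
    simp [this]

lemma card_conj (hpn : p ≤ n) (σ : Perm (Fin p)) (τ : Perm (Fin n)) :
    Fintype.card {s : Perm (Fin n) // Ext σ (s⁻¹ * τ * s)} =
      Fintype.card (EqEmb σ τ) * (n - p).factorial := by
  let r : {s : Perm (Fin n) // Ext σ (s⁻¹ * τ * s)} → EqEmb σ τ := fun s =>
    ⟨fun x => s.1 (Fin.castLE hpn x), s.1.injective.comp (Fin.castLE_injective hpn),
      (ext_iff' hpn σ τ s.1).1 s.2⟩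
  rw [← Fintype.card_congr (Equiv.sigmaFiberEquiv r), Fintype.card_sigma]
  rw [Finset.sum_congr rfl (g := fun _ => (n - p).factorial), sum_const, card_univ, smul_eq_mul]
  intro f _
  rw [← card_extend hpn f.1 f.2.1]
  apply Fintype.card_congr
  exact
    { toFun := fun s => ⟨s.1.1, fun x => congrFun (congrArg Subtype.val s.2) x⟩
      invFun := fun s => ⟨⟨s.1, (ext_iff' hpn σ τ s.1).2 (by
        intro x; rw [s.2, s.2]; exact f.2.2 x)⟩, Subtype.ext (funext s.2)⟩
      left_inv := fun s => rfl
      right_inv := fun s => rfl }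

end emb

end CycAux

theorem stmt_16 (n q : ℕ) (hq : 1 ≤ q) (Pn : Equiv.Perm (Fin n) → ℝ)
    (hpos : ∀ τ, 0 ≤ Pn τ) (hsum : ∑ τ, Pn τ = 1)
    (hinv : ∀ s τ : Equiv.Perm (Fin n), Pn (s * τ * s⁻¹) = Pn τ)
    (l : Fin q → ℕ) (hl : ∀ i, 0 < l i) (hmono : StrictMono l)
    (k : Fin q → ℕ) (hk : k ≠ 0) (p : ℕ) (hp : p = ∑ i, k i * l i) (hpn : p ≤ n)
    (σ : Equiv.Perm (Fin p))
    (hσ1 : ∀ i, cycleCount σ (l i) = k i)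
    (hσ2 : ∀ x : Fin p, ∃ i, Function.minimalPeriod ⇑σ x = l i) :
    (∑ J ∈ Fintype.piFinset (fun i : Fin q =>
        (Finset.univ : Finset (CycleOn n (l i))).powersetCard (k i)),
      ∑ τ ∈ Finset.univ.filter (fun τ : Equiv.Perm (Fin n) =>
          ∀ i, ∀ c ∈ J i, ∀ x ∈ c.1.1, τ x = c.1.2 x), Pn τ)
      * (((n - p).factorial * (∏ i, (l i) ^ (k i)) * ∏ i, (k i).factorial : ℕ) : ℝ)
      = (n.factorial : ℝ) *
        ∑ τ ∈ Finset.univ.filter (fun τ : Equiv.Perm (Fin n) =>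
          ∀ (m : Fin n) (hm : (m : ℕ) < p), (τ m : ℕ) = (σ ⟨(m : ℕ), hm⟩ : ℕ)), Pn τ := by
  have hσ1' : ∀ i, Fintype.card (CycAux.Cyc σ (l i)) = k i := fun i => by
    rw [← CycAux.cycleCount_eq σ (l i) (hl i), hσ1]
  -- left-hand side
  have hL : (∑ J ∈ Fintype.piFinset (fun i : Fin q =>
        (Finset.univ : Finset (CycleOn n (l i))).powersetCard (k i)),
      ∑ τ ∈ Finset.univ.filter (fun τ : Equiv.Perm (Fin n) =>
          ∀ i, ∀ c ∈ J i, ∀ x ∈ c.1.1, τ x = c.1.2 x), Pn τ) =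
      ∑ τ, Pn τ * ((∏ i, (Fintype.card (CycAux.Cyc τ (l i))).choose (k i) : ℕ) : ℝ) := by
    simp_rw [Finset.sum_filter]
    rw [Finset.sum_comm]
    refine Finset.sum_congr rfl fun τ _ => ?_
    rw [← Finset.sum_filter, Finset.sum_const, nsmul_eq_mul, mul_comm]
    congr 2
    have : (Fintype.piFinset (fun i : Fin q =>
        (Finset.univ : Finset (CycleOn n (l i))).powersetCard (k i))).filter
        (fun J => ∀ i, ∀ c ∈ J i, ∀ x ∈ c.1.1, τ x = c.1.2 x) =
        Fintype.piFinset (fun i : Fin q =>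
        ((Finset.univ : Finset (CycleOn n (l i))).filter
          (fun c => ∀ x ∈ c.1.1, τ x = c.1.2 x)).powersetCard (k i)) := by
      ext J
      simp only [Finset.mem_filter, Fintype.mem_piFinset, Finset.mem_powersetCard,
        Finset.subset_iff, Finset.mem_univ, true_and, implies_true]
      exact ⟨fun h i => ⟨fun c hc => h.2 i c hc, h.1 i⟩,
        fun h => ⟨fun i => (h i).2, fun i c hc => (h i).1 hc⟩⟩
    rw [this, Fintype.card_piFinset]
    refine Finset.prod_congr rfl fun i _ => ?_
    rw [Finset.card_powersetCard, Fintype.card_subtype]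
  -- right-hand side
  have hR : (n.factorial : ℝ) *
        ∑ τ ∈ Finset.univ.filter (fun τ : Equiv.Perm (Fin n) =>
          ∀ (m : Fin n) (hm : (m : ℕ) < p), (τ m : ℕ) = (σ ⟨(m : ℕ), hm⟩ : ℕ)), Pn τ =
      ∑ τ, Pn τ * ((Fintype.card {s : Equiv.Perm (Fin n) //
        CycAux.Ext σ (s⁻¹ * τ * s)} : ℕ) : ℝ) := by
    have h1 : ∀ s : Equiv.Perm (Fin n), ∑ τ, (if CycAux.Ext σ (s⁻¹ * τ * s) then Pn τ else 0) =
        ∑ τ, (if CycAux.Ext σ τ then Pn τ else 0) := by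
      intro s
      refine Fintype.sum_equiv (MulAut.conj s⁻¹).toEquiv _ _ fun τ => ?_
      have h2 : (MulAut.conj s⁻¹).toEquiv τ = s⁻¹ * τ * s := by simp [MulAut.conj_apply]
      have h3 : Pn (s⁻¹ * τ * s) = Pn τ := by simpa using hinv s⁻¹ τ
      rw [h2, h3]
    have h4 : (n.factorial : ℝ) * ∑ τ, (if CycAux.Ext σ τ then Pn τ else 0) =
        ∑ s : Equiv.Perm (Fin n), ∑ τ, (if CycAux.Ext σ (s⁻¹ * τ * s) then Pn τ else 0) := by
      rw [Finset.sum_congr rfl fun s _ => h1 s, Finset.sum_const, Finset.card_univ,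
        Fintype.card_perm, Fintype.card_fin, nsmul_eq_mul]
    rw [Finset.sum_filter]
    refine Eq.trans (Eq.trans ?_ h4) ?_
    · congr 1
      refine Finset.sum_congr rfl fun τ _ => ?_
      by_cases h : CycAux.Ext σ τ
      · rw [if_pos h, if_pos (show ∀ (m : Fin n) (hm : (m : ℕ) < p), _ from h)]
      · rw [if_neg h, if_neg (show ¬ ∀ (m : Fin n) (hm : (m : ℕ) < p), _ from h)]
    rw [Finset.sum_comm]
    refine Finset.sum_congr rfl fun τ _ => ?_
    rw [← Finset.sum_filter, Finset.sum_const, nsmul_eq_mul, mul_comm, Fintype.card_subtype]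
  rw [hL, hR, Finset.sum_mul]
  refine Finset.sum_congr rfl fun τ _ => ?_
  rw [mul_assoc, ← Nat.cast_mul, CycAux.card_conj hpn,
    CycAux.card_eqEmb hmono σ τ hσ1' hl hσ2]
  congr 2
  simp_rw [CycAux.card_rep, Nat.descFactorial_eq_factorial_mul_choose, Finset.prod_mul_distrib]
  ring
end

section
/- Let A be a finite set of positive integers with maximum d, and for n with S_n^{(A)} ≠ ∅ let σ_n be uniform on S_n^{(A)}. Then for every l ∈ A and every j ≥ 1, the probability that each of the points 1,…,j belongs to a cycle of σ_n of length l is asymptotically equivalent to n^{(l/d - 1)j} as n → ∞ along n with S_n^{(A)} ≠ ∅. -/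
open Filter

noncomputable def permCount (A : Set ℕ) (n : ℕ) : ℕ :=
  Nat.card {σ : Equiv.Perm (Fin n) // ∀ x, Function.minimalPeriod ⇑σ x ∈ A}



structure HData (B : Finset ℕ) (D : ℕ) (C : ℝ) (p : ℕ → ℕ → ℝ) (h : ℕ → ℝ) (m1 K : ℕ) : Prop where
  pos : ∀ i ∈ B, 0 < i
  le : ∀ i ∈ B, i ≤ D
  C0 : 0 ≤ C
  p0 : ∀ m i, 0 ≤ p m i
  m1pos : 0 < m1
  hpos : ∀ m, m1 ≤ m → 0 < h m
  recur : ∀ m, m1 + D ≤ m → h m = ∑ i ∈ B, p m i * h (m - i)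
  row1 : ∀ m, m1 ≤ m → ∑ i ∈ B, p m i ≤ 1
  row2 : ∀ m, m1 ≤ m → 1 - C / m ≤ ∑ i ∈ B, p m i
  col : ∀ m, m1 ≤ m → ∑ i ∈ B, p (m + i) i ≤ 1 + C / m
  large : ∀ R : ℝ, ∃ N, ∀ m, N ≤ m → ∀ i ∈ B, R ≤ p m i * m
  K0 : K ∈ AddSubmonoid.closure (B : Set ℕ)
  K1 : K + 1 ∈ AddSubmonoid.closure (B : Set ℕ)

namespace HData
variable {B : Finset ℕ} {D : ℕ} {C : ℝ} {p : ℕ → ℕ → ℝ} {h : ℕ → ℝ} {m1 K : ℕ}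

lemma upper (H : HData B D C p h m1 K) {m : ℕ} (hm : m1 ≤ m) {M : ℝ}
    (hM : ∀ s, m ≤ s → s < m + (D + 1) → h s ≤ M) : ∀ s, m ≤ s → h s ≤ M := by
  have hM0 : 0 ≤ M := (H.hpos m hm).le.trans (hM m le_rfl (by omega))
  intro s
  induction s using Nat.strong_induction_on with
  | _ s ih =>
    intro hs
    by_cases hlt : s < m + (D + 1)
    · exact hM s hs hlt
    · rw [H.recur s (by omega)]
      calc ∑ i ∈ B, p s i * h (s - i) ≤ ∑ i ∈ B, p s i * M := by
            apply Finset.sum_le_sum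
            intro i hi
            have h1 := H.pos i hi
            have h2 := H.le i hi
            exact mul_le_mul_of_nonneg_left (ih (s - i) (by omega) (by omega)) (H.p0 _ _)
        _ = (∑ i ∈ B, p s i) * M := by rw [Finset.sum_mul]
        _ ≤ 1 * M := mul_le_mul_of_nonneg_right (H.row1 s (by omega)) hM0
        _ = M := one_mul M

lemma lower (H : HData B D C p h m1 K) {m : ℕ} (hm : m1 ≤ m) {lo : ℝ} (hlo : 0 ≤ lo)
    (hC : C / m ≤ 1)
    (hM : ∀ s, m ≤ s → s < m + (D + 1) → lo ≤ h s) :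
    ∀ s, m ≤ s → lo * (1 - C / m) ^ (s - m) ≤ h s := by
  have hm0 : (0:ℝ) < m := by exact_mod_cast lt_of_lt_of_le H.m1pos hm
  have hr0 : 0 ≤ 1 - C / m := by linarith
  have hr1 : 1 - C / m ≤ 1 := by
    have : 0 ≤ C / m := div_nonneg H.C0 hm0.le
    linarith
  intro s
  induction s using Nat.strong_induction_on with
  | _ s ih =>
    intro hs
    by_cases hlt : s < m + (D + 1)
    · calc lo * (1 - C / m) ^ (s - m) ≤ lo * 1 :=
            mul_le_mul_of_nonneg_left (pow_le_one₀ hr0 hr1) hlo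
        _ ≤ h s := by rw [mul_one]; exact hM s hs hlt
    · rw [H.recur s (by omega)]
      have hrow : 1 - C / m ≤ ∑ i ∈ B, p s i := by
        refine le_trans ?_ (H.row2 s (by omega))
        have : C / s ≤ C / m := div_le_div_of_nonneg_left H.C0 hm0 (by exact_mod_cast hs)
        linarith
      calc lo * (1 - C / m) ^ (s - m) = (1 - C / m) * (lo * (1 - C / m) ^ (s - 1 - m)) := by
            have : s - m = (s - 1 - m) + 1 := by omega
            rw [this, pow_succ]; ring
        _ ≤ (∑ i ∈ B, p s i) * (lo * (1 - C / m) ^ (s - 1 - m)) :=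
            mul_le_mul_of_nonneg_right hrow (mul_nonneg hlo (pow_nonneg hr0 _))
        _ = ∑ i ∈ B, p s i * (lo * (1 - C / m) ^ (s - 1 - m)) := by rw [Finset.sum_mul]
        _ ≤ ∑ i ∈ B, p s i * h (s - i) := by
            apply Finset.sum_le_sum
            intro i hi
            have h1 := H.pos i hi
            have h2 := H.le i hi
            refine mul_le_mul_of_nonneg_left (le_trans ?_ (ih (s - i) (by omega) (by omega))) (H.p0 _ _)
            exact mul_le_mul_of_nonneg_left (pow_le_pow_of_le_one hr0 hr1 (by omega)) hlo

/-- linear form of the lower bound -/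
lemma lower' (H : HData B D C p h m1 K) {m : ℕ} (hm : m1 ≤ m) {lo : ℝ} (hlo : 0 ≤ lo)
    (hC : C / m ≤ 1)
    (hM : ∀ s, m ≤ s → s < m + (D + 1) → lo ≤ h s) {x : ℝ} (s : ℕ) (hs : m ≤ s)
    (hx : ((s:ℝ) - m) * (C / m) ≤ x) : lo * (1 - x) ≤ h s := by
  refine le_trans (mul_le_mul_of_nonneg_left ?_ hlo) (H.lower hm hlo hC hM s hs)
  have := one_add_mul_le_pow (a := -(C / m)) (by linarith) (s - m)
  rw [Nat.cast_sub hs] at this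
  have e : 1 - C / m = 1 + -(C / m) := by ring
  rw [e]
  linarith

/-- energy bound -/
lemma energy (H : HData B D C p h m1 K) {m m' : ℕ} (hm : m1 ≤ m) {M : ℝ}
    (hM : ∀ s, m ≤ s → h s ≤ M) (hmm : m ≤ m') (hm2 : m' ≤ 2 * m) :
    ∑ n ∈ Finset.Ico (m + D) m', ∑ i ∈ B, p n i * (h (n - i) - h n) ^ 2 ≤ (D + C) * M ^ 2 := by
  have hm0 : (0:ℝ) < m := by exact_mod_cast lt_of_lt_of_le H.m1pos hm
  have hpos : ∀ s, m ≤ s → 0 < h s := fun s hs => H.hpos s (hm.trans hs)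
  have hsq : ∀ s, m ≤ s → (h s) ^ 2 ≤ M ^ 2 := fun s hs =>
    pow_le_pow_left₀ (hpos s hs).le (hM s hs) 2
  have step1 : ∑ n ∈ Finset.Ico (m + D) m', ∑ i ∈ B, p n i * (h (n - i) - h n) ^ 2
      ≤ ∑ n ∈ Finset.Ico (m + D) m', ((∑ i ∈ B, p n i * h (n - i) ^ 2) - h n ^ 2) := by
    apply Finset.sum_le_sum
    intro n hn
    rw [Finset.mem_Ico] at hn
    have e : ∑ i ∈ B, p n i * (h (n - i) - h n) ^ 2 =
        (∑ i ∈ B, p n i * h (n - i) ^ 2) - 2 * h n * (∑ i ∈ B, p n i * h (n - i))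
          + h n ^ 2 * ∑ i ∈ B, p n i := by
      rw [Finset.mul_sum, Finset.mul_sum, ← Finset.sum_sub_distrib, ← Finset.sum_add_distrib]
      apply Finset.sum_congr rfl
      intros; ring
    rw [e, ← H.recur n (by omega)]
    have := mul_le_mul_of_nonneg_left (H.row1 n (by omega)) (sq_nonneg (h n))
    nlinarith
  have step2 : ∑ n ∈ Finset.Ico (m + D) m', ∑ i ∈ B, p n i * h (n - i) ^ 2
      ≤ ∑ k ∈ Finset.Ico m m', h k ^ 2 * (1 + C / m) := by
    rw [Finset.sum_comm]
    calc ∑ i ∈ B, ∑ n ∈ Finset.Ico (m + D) m', p n i * h (n - i) ^ 2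
        ≤ ∑ i ∈ B, ∑ k ∈ Finset.Ico m m', p (k + i) i * h k ^ 2 := by
          apply Finset.sum_le_sum
          intro i hi
          have h1 := H.pos i hi
          have h2 := H.le i hi
          have : ∑ k ∈ Finset.Ico m m', p (k + i) i * h k ^ 2 =
              ∑ n ∈ Finset.Ico (m + i) (m' + i), p n i * h (n - i) ^ 2 := by
            rw [← Finset.sum_Ico_add' (fun n => p n i * h (n - i) ^ 2)]
            apply Finset.sum_congr rfl
            intro x hx; simp
          rw [this]
          apply Finset.sum_le_sum_of_subset_of_nonneg
          · intro x; simp only [Finset.mem_Ico]; omega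
          · intro x _ _; exact mul_nonneg (H.p0 _ _) (sq_nonneg _)
      _ = ∑ k ∈ Finset.Ico m m', h k ^ 2 * ∑ i ∈ B, p (k + i) i := by
          rw [Finset.sum_comm]
          apply Finset.sum_congr rfl
          intro k _
          rw [Finset.mul_sum]
          apply Finset.sum_congr rfl
          intros; ring
      _ ≤ _ := by
          apply Finset.sum_le_sum
          intro k hk
          rw [Finset.mem_Ico] at hk
          apply mul_le_mul_of_nonneg_left _ (sq_nonneg _)
          refine (H.col k (by omega)).trans ?_
          have : C / k ≤ C / m := div_le_div_of_nonneg_left H.C0 hm0 (by exact_mod_cast hk.1)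
          linarith
  have step3 : ∑ k ∈ Finset.Ico m m', h k ^ 2 - ∑ k ∈ Finset.Ico (m + D) m', h k ^ 2
      ≤ D * M ^ 2 := by
    have : ∑ k ∈ Finset.Ico m m', h k ^ 2 ≤ ∑ k ∈ Finset.Ico m (m + D) ∪ Finset.Ico (m + D) m', h k ^ 2 := by
      apply Finset.sum_le_sum_of_subset_of_nonneg
      · intro x; simp only [Finset.mem_union, Finset.mem_Ico]; omega
      · intro x _ _; exact sq_nonneg _
    rw [Finset.sum_union (Finset.Ico_disjoint_Ico_consecutive _ _ _)] at this
    have h2 : ∑ k ∈ Finset.Ico m (m + D), h k ^ 2 ≤ D * M ^ 2 := by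
      have := Finset.sum_le_card_nsmul (Finset.Ico m (m + D)) (fun k => h k ^ 2) (M ^ 2)
        (fun k hk => hsq k (Finset.mem_Ico.1 hk).1)
      simpa using this
    linarith
  have step4 : ∑ k ∈ Finset.Ico m m', h k ^ 2 ≤ m * M ^ 2 := by
    have := Finset.sum_le_card_nsmul (Finset.Ico m m') (fun k => h k ^ 2) (M ^ 2)
        (fun k hk => hsq k (Finset.mem_Ico.1 hk).1)
    simp only [Nat.card_Ico, nsmul_eq_mul] at this
    refine this.trans (mul_le_mul_of_nonneg_right ?_ (sq_nonneg _))
    exact_mod_cast (by omega : m' - m ≤ m)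
  rw [Finset.sum_sub_distrib] at step1
  rw [← Finset.sum_mul] at step2
  have step5 : (∑ k ∈ Finset.Ico m m', h k ^ 2) * (C / m) ≤ C * M ^ 2 := by
    have := mul_le_mul_of_nonneg_right step4 (div_nonneg H.C0 hm0.le)
    have e : (m * M ^ 2) * (C / m) = C * M ^ 2 := by field_simp
    linarith
  nlinarith

/-- pigeonhole over blocks -/
lemma _root_.exists_block (E : ℕ → ℝ) (a L Q : ℕ) (S θ : ℝ)
    (hS : ∑ n ∈ Finset.range (Q * L), E (a + n) ≤ S) (hQ : S < Q * θ) :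
    ∃ q < Q, ∑ u ∈ Finset.range L, E (a + q * L + u) ≤ θ := by
  by_contra hcon
  push Not at hcon
  have : ∀ Q', Q' ≤ Q → Q' * θ ≤ ∑ n ∈ Finset.range (Q' * L), E (a + n) := by
    intro Q'
    induction Q' with
    | zero => simp
    | succ t ih =>
      intro ht
      rw [Nat.succ_mul, Finset.sum_range_add]
      have h1 := ih (by omega)
      have h2 := hcon t (by omega)
      push_cast
      simp only [← add_assoc]
      linarith
  linarith [this Q le_rfl]

lemma path_down {h : ℕ → ℝ} {e : ℝ} {n0 L : ℕ}
    (hB : ∀ i ∈ B, 0 < i)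
    (he : ∀ n, n0 ≤ n → n < n0 + L → ∀ i ∈ B, |h (n - i) - h n| ≤ e) (he0 : 0 ≤ e) {x : ℕ}
    (hx : x ∈ AddSubmonoid.closure (B : Set ℕ)) :
    ∀ n, n0 + x ≤ n → n < n0 + L → |h (n - x) - h n| ≤ x * e := by
  induction hx using AddSubmonoid.closure_induction_left with
  | zero => intro n _ _; simp
  | add_left i hi y hy ih =>
    intro n h1 h2
    have a1 := he n (by omega) h2 i hi
    have a2 := ih (n - i) (by omega) (by omega)
    have e1 : n - (i + y) = n - i - y := by omega
    have a3 : (1:ℝ) ≤ i := by exact_mod_cast hB i hi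
    rw [e1]
    have := abs_sub_le (h (n - i - y)) (h (n - i)) (h n)
    push_cast
    nlinarith


lemma good_block (H : HData B D C p h m1 K) {k : ℕ} (hk : 2 ≤ k) {η : ℝ} (hη : 0 < η) :
    ∃ N, ∀ m', N ≤ m' → ∀ M, 0 < M → (∀ s, m' - m' / k ≤ s → h s ≤ M) →
      ∃ n1, m' - m' / k ≤ n1 ∧ n1 + (D + 1) ≤ m' ∧
        ∀ s s', n1 ≤ s → s < n1 + (D + 1) → n1 ≤ s' → s' < n1 + (D + 1) → h s ≤ h s' + η * M := by
  set L := K + (D + 1) with hL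
  set τ : ℝ := η / (2 * (D + 1) * (2 * K + 1)) with hτ
  have hτ0 : 0 < τ := by positivity
  set R : ℝ := (D + C + 1) * (2 * k * L) / τ ^ 2 with hR
  have hC0 := H.C0
  have hL0 : (0:ℝ) < L := by rw [hL]; push_cast; positivity
  have hk0 : (0:ℝ) < k := by positivity
  have hR0 : 0 < R := by positivity
  obtain ⟨N0, hN0⟩ := H.large R
  refine ⟨2 * N0 + 2 * m1 + 2 * k * (1 + D + L) + 1, ?_⟩
  intro m' hm' M hM hhM
  have hm'0 : (0:ℝ) < m' := by
    have : 0 < m' := by omega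
    exact_mod_cast this
  have hdiv : m' / k ≤ m' / 2 := Nat.div_le_div_left hk (by norm_num)
  set m := m' - m' / k with hm
  have hm1 : m1 ≤ m := by omega
  have hen := H.energy hm1 hhM (m' := m') (Nat.sub_le _ _) (by omega)
  set Q := (m' / k - D) / L with hQ
  set E : ℕ → ℝ := fun n => ∑ i ∈ B, (h (n - i) - h n) ^ 2 with hE
  have hQL : Q * L ≤ m' / k - D := Nat.div_mul_le_self _ _
  have hQreal : (m' : ℝ) / (2 * k * L) ≤ Q := by
    have hk0' : 0 < k := by omega
    have h1 : m' < k * (m' / k + 1) := Nat.lt_mul_div_succ m' hk0'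
    have h2 : m' / k - D < L * (Q + 1) := Nat.lt_mul_div_succ _ (by omega)
    have h1' : (m' : ℝ) < k * ((m' / k : ℕ) + 1) := by exact_mod_cast h1
    have h2' : ((m' / k : ℕ) : ℝ) < L * (Q + 1) + D := by
      have : m' / k < L * (Q + 1) + D := by omega
      exact_mod_cast this
    have h3 : (2 * k * (1 + D + L) : ℝ) ≤ m' := by
      have : 2 * k * (1 + D + L) ≤ m' := by omega
      exact_mod_cast this
    rw [div_le_iff₀ (by positivity)]
    nlinarith
  have htot : ∑ n ∈ Finset.range (Q * L), E (m + D + n) ≤ (m' / R) * ((D + C) * M ^ 2) := by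
    calc ∑ n ∈ Finset.range (Q * L), E (m + D + n)
        ≤ ∑ n ∈ Finset.range (m' - (m + D)), E (m + D + n) := by
          apply Finset.sum_le_sum_of_subset_of_nonneg
          · intro x; simp only [Finset.mem_range]; omega
          · intro x _ _; exact Finset.sum_nonneg (fun _ _ => sq_nonneg _)
      _ = ∑ n ∈ Finset.Ico (m + D) m', E n := by rw [Finset.sum_Ico_eq_sum_range]
      _ ≤ ∑ n ∈ Finset.Ico (m + D) m', (m' / R) * ∑ i ∈ B, p n i * (h (n - i) - h n) ^ 2 := by
          apply Finset.sum_le_sum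
          intro n hn
          rw [Finset.mem_Ico] at hn
          rw [hE, Finset.mul_sum]
          apply Finset.sum_le_sum
          intro i hi
          have h1 := hN0 n (by omega) i hi
          have h2 : p n i * n ≤ p n i * m' :=
            mul_le_mul_of_nonneg_left (by exact_mod_cast hn.2.le) (H.p0 _ _)
          have h3 : 1 ≤ m' / R * p n i := by
            rw [div_mul_eq_mul_div, le_div_iff₀ hR0]; linarith
          rw [← mul_assoc]
          exact le_mul_of_one_le_left (sq_nonneg _) h3
      _ ≤ _ := by
          rw [← Finset.mul_sum]
          exact mul_le_mul_of_nonneg_left hen (by positivity)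
  have hlt : (m' / R) * ((D + C) * M ^ 2) < Q * (τ ^ 2 * M ^ 2) := by
    have e1 : (m' / R) * ((D + C) * M ^ 2) =
        (m' / (2 * k * L)) * (τ ^ 2 * M ^ 2) * ((D + C) / (D + C + 1)) := by
      rw [hR]; field_simp
    rw [e1]
    have h4 : (D + C) / (D + C + 1) < 1 := by
      rw [div_lt_one (by positivity)]; linarith
    have h5 : 0 < (m' / (2 * k * L)) * (τ ^ 2 * M ^ 2) := by positivity
    have h6 : (m' / (2 * k * L)) * (τ ^ 2 * M ^ 2) ≤ Q * (τ ^ 2 * M ^ 2) :=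
      mul_le_mul_of_nonneg_right hQreal (by positivity)
    nlinarith
  obtain ⟨q, hq, hqs⟩ := exists_block E (m + D) L Q _ _ htot hlt
  set n0 := m + D + q * L with hn0
  have hn0L : n0 + L ≤ m' := by
    have : (q + 1) * L ≤ Q * L := Nat.mul_le_mul_right L hq
    rw [Nat.succ_mul] at this
    omega
  have he0 : 0 ≤ τ * M := by positivity
  have he : ∀ n, n0 ≤ n → n < n0 + L → ∀ i ∈ B, |h (n - i) - h n| ≤ τ * M := by
    intro n h1 h2 i hi
    apply abs_le_of_sq_le_sq _ he0
    calc (h (n - i) - h n) ^ 2 ≤ E n :=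
          Finset.single_le_sum (f := fun i => (h (n - i) - h n) ^ 2)
            (fun _ _ => sq_nonneg _) hi
      _ ≤ ∑ u ∈ Finset.range L, E (n0 + u) := by
          have := Finset.single_le_sum (f := fun u => E (n0 + u)) (s := Finset.range L)
            (fun _ _ => Finset.sum_nonneg (fun _ _ => sq_nonneg _)) (a := n - n0)
            (by rw [Finset.mem_range]; omega)
          simpa [Nat.add_sub_cancel' h1] using this
      _ ≤ τ ^ 2 * M ^ 2 := hqs
      _ = (τ * M) ^ 2 := by ring
  have hstep : ∀ n, n0 + K + 1 ≤ n → n < n0 + L → |h n - h (n - 1)| ≤ (2 * K + 1) * (τ * M) := by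
    intro n h1 h2
    have a1 := path_down H.pos he he0 H.K1 n (by omega) h2
    have a2 := path_down H.pos he he0 H.K0 (n - 1) (by omega) (by omega)
    have e1 : n - (K + 1) = n - 1 - K := by omega
    rw [e1] at a1
    push_cast at a1
    rw [abs_le] at *
    constructor <;> linarith [a1.1, a1.2, a2.1, a2.2]
  have hwin : ∀ u, u < D + 1 → |h (n0 + K + u) - h (n0 + K)| ≤ u * ((2 * K + 1) * (τ * M)) := by
    intro u
    induction u with
    | zero => intro _; simp
    | succ u ih =>
      intro hu
      have a1 := ih (by omega)
      have a2 := hstep (n0 + K + (u + 1)) (by omega) (by omega)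
      have e1 : n0 + K + (u + 1) - 1 = n0 + K + u := by omega
      rw [e1] at a2
      have := abs_sub_le (h (n0 + K + (u + 1))) (h (n0 + K + u)) (h (n0 + K))
      push_cast
      linarith
  have hwin' : ∀ s, n0 + K ≤ s → s < n0 + K + (D + 1) → |h s - h (n0 + K)| ≤ η * M / 2 := by
    intro s h1 h2
    have a1 := hwin (s - (n0 + K)) (by omega)
    rw [Nat.add_sub_cancel' h1] at a1
    have h3 : ((s - (n0 + K) : ℕ) : ℝ) ≤ D + 1 := by
      have : s - (n0 + K) ≤ D + 1 := by omega
      exact_mod_cast this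
    refine a1.trans ((mul_le_mul_of_nonneg_right h3 (by positivity)).trans (le_of_eq ?_))
    rw [hτ]; field_simp
  refine ⟨n0 + K, by omega, by omega, ?_⟩
  intro s s' h1 h2 h3 h4
  have a1 := hwin' s h1 h2
  have a2 := hwin' s' h3 h4
  rw [abs_le] at a1 a2
  linarith [a1.1, a1.2, a2.1, a2.2]

def _root_.GoodW (h : ℕ → ℝ) (D : ℕ) (q : ℝ) (m : ℕ) : Prop :=
  ∃ lo : ℝ, 0 < lo ∧ ∀ s, m ≤ s → s < m + (D + 1) → lo ≤ h s ∧ h s ≤ q * lo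

lemma _root_.GoodW.mono {h : ℕ → ℝ} {D : ℕ} {q q' : ℝ} {m : ℕ} (hg : GoodW h D q m) (hq : q ≤ q') :
    GoodW h D q' m := by
  obtain ⟨lo, h0, h1⟩ := hg
  exact ⟨lo, h0, fun s a b => ⟨(h1 s a b).1,
    (h1 s a b).2.trans (mul_le_mul_of_nonneg_right hq h0.le)⟩⟩

lemma step (H : HData B D C p h m1 K) {k : ℕ} (hk : 2 ≤ k) (hkC : 8 * C ≤ k) {η : ℝ} (hη : 0 < η) :
    ∃ N, ∀ m', N ≤ m' → ∀ q, GoodW h D q (m' - m' / k) →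
      GoodW h D ((1 + 2 * η * q) / (1 - 4 * C / k)) m' := by
  obtain ⟨N0, hN0⟩ := H.good_block hk hη
  obtain ⟨N1, hN1⟩ := exists_nat_ge (2 * C)
  refine ⟨N0 + 2 * m1 + 2 * N1 + k * (D + 1) + 1, ?_⟩
  intro m' hm' q hq
  have hC0 := H.C0
  have hk0 : (0:ℝ) < k := by positivity
  have hm'0 : (0:ℝ) < m' := by
    have : 0 < m' := by omega
    exact_mod_cast this
  have hdiv : m' / k ≤ m' / 2 := Nat.div_le_div_left hk (by norm_num)
  have hdivr : ((m' / k : ℕ) : ℝ) ≤ m' / k := Nat.cast_div_le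
  have hDr : ((D : ℝ) + 1) ≤ m' / k := by
    rw [le_div_iff₀ hk0]
    have : (D + 1) * k ≤ m' := by rw [mul_comm]; omega
    exact_mod_cast this
  obtain ⟨lo, hlo, hgood⟩ := hq
  set m := m' - m' / k with hm
  have hm1 : m1 ≤ m := by omega
  have hMpos : 0 < q * lo := hlo.trans_le
    ((hgood m le_rfl (by omega)).1.trans (hgood m le_rfl (by omega)).2)
  have hq0 : 0 < q := pos_of_mul_pos_left hMpos hlo.le
  have hub := H.upper hm1 (M := q * lo) (fun s a b => (hgood s a b).2)
  obtain ⟨n1, hn1, hn1', hclose⟩ := hN0 m' (by omega) (q * lo) hMpos hub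
  set x : ℝ := 4 * C / k with hx
  have hx0 : 0 ≤ x := by positivity
  have hx1 : x ≤ 1 / 2 := by
    rw [hx, div_le_iff₀ hk0]; linarith
  have hlow : ∀ n, m ≤ n → n ≤ m' → ∀ lo', 0 ≤ lo' →
      (∀ s, n ≤ s → s < n + (D + 1) → lo' ≤ h s) → ∀ s, n ≤ s → s < m' + (D + 1) →
      lo' * (1 - x) ≤ h s := by
    intro n a1 a2 lo' b1 b2 s c1 c2
    have hn0 : (m':ℝ) / 2 ≤ n := by
      have : m' ≤ 2 * n := by omega
      have : (m':ℝ) ≤ 2 * n := by exact_mod_cast this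
      linarith
    have hnpos : (0:ℝ) < n := by linarith
    have hCn : C / n ≤ 1 := by
      rw [div_le_one hnpos]
      have : N1 ≤ n := by omega
      have : (N1:ℝ) ≤ n := by exact_mod_cast this
      linarith
    refine H.lower' (hm1.trans a1) b1 hCn b2 s c1 ?_
    have hs : (s:ℝ) - n ≤ 2 * (m' / k) := by
      have : s ≤ n + m' / k + (D + 1) := by omega
      have : (s:ℝ) ≤ n + (m' / k : ℕ) + (D + 1) := by exact_mod_cast this
      linarith
    calc ((s:ℝ) - n) * (C / n) ≤ (2 * (m' / k)) * (C / (m' / 2)) := by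
          apply mul_le_mul hs _ (by positivity) (by positivity)
          exact div_le_div_of_nonneg_left hC0 (by positivity) hn0
      _ = x := by rw [hx]; field_simp; ring
  obtain ⟨s0, hs0, hmin⟩ := Finset.exists_min_image (Finset.Ico n1 (n1 + (D + 1))) h
    ⟨n1, by simp⟩
  rw [Finset.mem_Ico] at hs0
  have hs0lo : lo * (1 - x) ≤ h s0 :=
    hlow m le_rfl (by omega) lo hlo.le (fun s a b => (hgood s a b).1) s0 (by omega) (by omega)
  have hs0pos : 0 < h s0 := H.hpos _ (by omega)
  have hup2 := H.upper (hm1.trans hn1) (M := h s0 + η * (q * lo))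
    (fun s a b => hclose s s0 a b hs0.1 hs0.2)
  have hup3 : h s0 + η * (q * lo) ≤ h s0 * (1 + 2 * η * q) := by
    have : lo ≤ 2 * h s0 := by nlinarith
    have : η * q * lo ≤ η * q * (2 * h s0) := mul_le_mul_of_nonneg_left this (by positivity)
    nlinarith
  have h1x : 0 < 1 - x := by linarith
  refine ⟨h s0 * (1 - x), by positivity, ?_⟩
  intro s a b
  constructor
  · exact hlow n1 hn1 (by omega) (h s0) hs0pos.le
      (fun t c d => hmin t (Finset.mem_Ico.2 ⟨c, d⟩)) s (by omega) b
  · refine (hup2 s (by omega)).trans (hup3.trans (le_of_eq ?_))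
    field_simp

lemma bounded (H : HData B D C p h m1 K) : ∃ q, ∃ N, ∀ m, N ≤ m → GoodW h D q m := by
  obtain ⟨k0, hk0⟩ := exists_nat_ge (8 * C)
  have hC0 := H.C0
  set k := k0 + 2 with hk
  have hkC : 8 * C ≤ (k:ℝ) := by rw [hk]; push_cast; linarith
  have hkpos : (0:ℝ) < k := by rw [hk]; push_cast; positivity
  obtain ⟨N, hN⟩ := H.step (k := k) (by omega) hkC (η := 1/16) (by norm_num)
  set N' := N + m1 + k + 1 with hN'
  have hinit : ∀ m, m1 ≤ m → ∃ q, GoodW h D q m := by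
    intro m hm
    obtain ⟨s0, hs0, hmin⟩ := Finset.exists_min_image (Finset.Ico m (m + (D + 1))) h ⟨m, by simp⟩
    obtain ⟨s1, hs1, hmax⟩ := Finset.exists_max_image (Finset.Ico m (m + (D + 1))) h ⟨m, by simp⟩
    rw [Finset.mem_Ico] at hs0
    have hp := H.hpos s0 (by omega)
    refine ⟨h s1 / h s0, h s0, hp, fun s a b => ⟨hmin s (Finset.mem_Ico.2 ⟨a, b⟩), ?_⟩⟩
    rw [div_mul_cancel₀ _ hp.ne']
    exact hmax s (Finset.mem_Ico.2 ⟨a, b⟩)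
  choose! f hf using hinit
  set q0 : ℝ := 4 + ∑ m ∈ Finset.range (2 * N'), |f m| with hq0
  have hq04 : 4 ≤ q0 := by
    have : 0 ≤ ∑ m ∈ Finset.range (2 * N'), |f m| := Finset.sum_nonneg (fun _ _ => abs_nonneg _)
    linarith
  refine ⟨q0, N', ?_⟩
  intro m
  induction m using Nat.strong_induction_on with
  | _ m ih =>
    intro hm
    by_cases hlt : m < 2 * N'
    · refine (hf m (by omega)).mono ?_
      have := Finset.single_le_sum (f := fun m => |f m|) (s := Finset.range (2 * N'))
        (fun _ _ => abs_nonneg _) (Finset.mem_range.2 hlt)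
      have h2 := le_abs_self (f m)
      linarith
    · have hdiv : m / k ≤ m / 2 := Nat.div_le_div_left (by omega) (by norm_num)
      have hpos : 0 < m / k := Nat.div_pos (by omega) (by omega)
      have := hN m (by omega) q0 (ih _ (by omega) (by omega))
      refine this.mono ?_
      have hx1 : 4 * C / k ≤ 1 / 2 := by
        rw [div_le_iff₀ hkpos]; linarith
      rw [div_le_iff₀ (by linarith)]
      nlinarith

lemma good_eventually (H : HData B D C p h m1 K) {ε : ℝ} (hε : 0 < ε) :
    ∃ N, ∀ m, N ≤ m → GoodW h D (1 + ε) m := by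
  obtain ⟨q, N0, hN0⟩ := H.bounded
  have hC0 := H.C0
  obtain ⟨k0, hk0⟩ := exists_nat_ge (8 * C + 4 * C * (2 * (1 + ε) / ε))
  set k := k0 + 2 with hk
  have hX : 0 ≤ 4 * C * (2 * (1 + ε) / ε) := by positivity
  have hkC : 8 * C ≤ (k:ℝ) := by rw [hk]; push_cast; linarith
  have hkC2 : 4 * C * (2 * (1 + ε) / ε) ≤ (k:ℝ) := by rw [hk]; push_cast; linarith
  have hkpos : (0:ℝ) < k := by rw [hk]; push_cast; positivity
  set η : ℝ := ε / (4 * (|q| + 1)) with hη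
  obtain ⟨N, hN⟩ := H.step (k := k) (by omega) hkC (η := η) (by positivity)
  refine ⟨N + 2 * N0, fun m hm => ?_⟩
  have hdiv : m / k ≤ m / 2 := Nat.div_le_div_left (by omega) (by norm_num)
  refine (hN m (by omega) q (hN0 _ (by omega))).mono ?_
  have hx1 : 4 * C / k ≤ ε / (2 * (1 + ε)) := by
    rw [div_le_div_iff₀ hkpos (by positivity)]
    have := mul_le_mul_of_nonneg_right hkC2 hε.le
    have e : 4 * C * (2 * (1 + ε) / ε) * ε = 4 * C * (2 * (1 + ε)) := by field_simp
    linarith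
  have hx2 : ε / (2 * (1 + ε)) * (1 + ε) = ε / 2 := by field_simp
  have hx3 : ε / (2 * (1 + ε)) < 1 := by
    rw [div_lt_one (by positivity)]; linarith
  have hq : 2 * η * q ≤ ε / 2 := by
    have h1 : 2 * η * q ≤ 2 * η * (|q| + 1) :=
      mul_le_mul_of_nonneg_left (by linarith [le_abs_self q]) (by positivity)
    have h2 : 2 * η * (|q| + 1) = ε / 2 := by rw [hη]; field_simp; ring
    linarith
  rw [div_le_iff₀ (by linarith)]
  have := mul_le_mul_of_nonneg_right hx1 (by positivity : 0 ≤ 1 + ε)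
  nlinarith

lemma tendsto_ratio (H : HData B D C p h m1 K) (hD : 0 < D) :
    Tendsto (fun m => h m / h (m + 1)) atTop (nhds 1) := by
  rw [Metric.tendsto_atTop]
  intro ε hε
  obtain ⟨N, hN⟩ := H.good_eventually (half_pos hε)
  refine ⟨N, fun m hm => ?_⟩
  obtain ⟨lo, hlo, hg⟩ := hN m hm
  have a := hg m le_rfl (by omega)
  have b := hg (m + 1) (by omega) (by omega)
  have hp : 0 < h (m + 1) := hlo.trans_le b.1
  rw [Real.dist_eq, abs_lt]
  have e : h m / h (m + 1) - 1 = (h m - h (m + 1)) / h (m + 1) := by field_simp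
  rw [e, lt_div_iff₀ hp, div_lt_iff₀ hp]
  constructor <;> nlinarith

end HData

/-- the root function -/
lemma exists_root (B : Finset ℕ) (hpos : ∀ i ∈ B, 0 < i) (hne : B.Nonempty) (y : ℝ) (hy : 0 ≤ y) :
    ∃ r : ℝ, 0 ≤ r ∧ ∑ i ∈ B, r ^ i = y := by
  obtain ⟨i0, hi0⟩ := hne
  have hcont : ContinuousOn (fun r : ℝ => ∑ i ∈ B, r ^ i) (Set.Icc 0 (y + 1)) := by fun_prop
  have h0 : ∑ i ∈ B, (0:ℝ) ^ i = 0 :=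
    Finset.sum_eq_zero (fun i hi => zero_pow (hpos i hi).ne')
  have h1 : y ≤ ∑ i ∈ B, (y + 1) ^ i := by
    have : (y + 1) ^ i0 ≤ ∑ i ∈ B, (y + 1) ^ i :=
      Finset.single_le_sum (f := fun i => (y + 1) ^ i) (fun i _ => by positivity) hi0
    have h2 : y + 1 ≤ (y + 1) ^ i0 := le_self_pow₀ (by linarith) (hpos i0 hi0).ne'
    linarith
  have := intermediate_value_Icc (by linarith : (0:ℝ) ≤ y + 1) hcont
  obtain ⟨r, hr, hr'⟩ := this (⟨by simpa [h0] using hy, h1⟩ : y ∈ Set.Icc _ _)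
  exact ⟨r, hr.1, hr'⟩

lemma root_mono {B : Finset ℕ} (hpos : ∀ i ∈ B, 0 < i) (hne : B.Nonempty) {x y : ℝ}
    (hy : 0 ≤ y) (h : ∑ i ∈ B, x ^ i ≤ ∑ i ∈ B, y ^ i) : x ≤ y := by
  by_contra hcon
  push Not at hcon
  refine absurd h (not_le.2 ?_)
  exact Finset.sum_lt_sum_of_nonempty hne (fun i hi => pow_lt_pow_left₀ hcon hy (hpos i hi).ne')

lemma ratio_asymp (B : Finset ℕ) (hpos : ∀ i ∈ B, 0 < i) (hne : B.Nonempty) (D : ℕ)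
    (hDB : D ∈ B) (hD : ∀ i ∈ B, i ≤ D) (c : ℝ) (hc : 0 < c) (K : ℕ)
    (hK : ∀ m, K ≤ m → m ∈ AddSubmonoid.closure (B : Set ℕ)) (b : ℕ → ℝ) (hb : ∀ m, 0 ≤ b m)
    (hb0 : 0 < b 0)
    (hrec : ∀ m, 0 < m → c * m * b m = ∑ i ∈ B, if i ≤ m then b (m - i) else 0) :
    (∀ m, K ≤ m → 0 < b m) ∧
    Tendsto (fun m : ℕ => b m / b (m + 1) / (c * (m + 1 : ℕ)) ^ ((1 : ℝ) / D)) atTop (nhds 1) := by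
  have hD0 := hpos D hDB
  have hbpos : ∀ m, K ≤ m → 0 < b m := by
    intro m hm
    have hmem := hK m hm
    clear hm
    induction hmem using AddSubmonoid.closure_induction_left with
    | zero => exact hb0
    | add_left i hi y hy ih =>
      have h0 := hpos i hi
      have h1 := hrec (i + y) (by omega)
      have h2 : b y ≤ ∑ j ∈ B, if j ≤ i + y then b (i + y - j) else 0 := by
        have := Finset.single_le_sum (f := fun j => if j ≤ i + y then b (i + y - j) else 0)
          (s := B) (fun j _ => by split_ifs <;> simp [hb]) hi
        simpa using this
      have h3 : 0 < c * (i + y : ℕ) * b (i + y) := by linarith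
      have h4 : 0 < c * (i + y : ℕ) := by
        have : (0:ℝ) < (i + y : ℕ) := by exact_mod_cast (by omega : 0 < i + y)
        positivity
      exact pos_of_mul_pos_right h3 h4.le
  refine ⟨hbpos, ?_⟩
  choose r hr0 hrP using fun m : ℕ => exists_root B hpos hne (c * m) (by positivity)
  have hrmono : ∀ m m', m ≤ m' → r m ≤ r m' := by
    intro m m' h
    apply root_mono hpos hne (hr0 m')
    rw [hrP, hrP]
    have : (m:ℝ) ≤ m' := by exact_mod_cast h
    exact mul_le_mul_of_nonneg_left this hc.le
  have hrpos : ∀ m, 0 < m → 0 < r m := by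
    intro m hm
    rcases (hr0 m).lt_or_eq with h | h
    · exact h
    · have := hrP m
      rw [← h, Finset.sum_eq_zero (fun i hi => zero_pow (hpos i hi).ne')] at this
      have : (0:ℝ) < c * m := by positivity
      linarith
  have hrscale : ∀ m m' : ℕ, m ≤ m' → 0 < m' → (m / m' : ℝ) * r m' ≤ r m := by
    intro m m' h h'
    have hm' : (0:ℝ) < m' := by exact_mod_cast h'
    have hl1 : (m / m' : ℝ) ≤ 1 := by rw [div_le_one hm']; exact_mod_cast h
    have hl0 : (0:ℝ) ≤ m / m' := by positivity
    apply root_mono hpos hne (hr0 m)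
    calc ∑ i ∈ B, ((m / m' : ℝ) * r m') ^ i ≤ ∑ i ∈ B, (m / m' : ℝ) * r m' ^ i := by
          apply Finset.sum_le_sum
          intro i hi
          rw [mul_pow]
          exact mul_le_mul_of_nonneg_right (pow_le_of_le_one hl0 hl1 (hpos i hi).ne')
            (pow_nonneg (hr0 _) _)
      _ = ∑ i ∈ B, r m ^ i := by
          rw [← Finset.mul_sum, hrP, hrP]; field_simp
  have hrtop : Tendsto r atTop atTop := by
    rw [tendsto_atTop]
    intro R
    obtain ⟨N, hN⟩ := exists_nat_ge ((∑ i ∈ B, |R| ^ i) / c)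
    filter_upwards [eventually_ge_atTop N] with m hm
    refine (le_abs_self R).trans (root_mono hpos hne (hr0 m) ?_)
    rw [hrP]
    have : (N:ℝ) ≤ m := by exact_mod_cast hm
    rw [div_le_iff₀ hc] at hN
    nlinarith
  set p : ℕ → ℕ → ℝ := fun m i => (∏ t ∈ Finset.Ico (m - i) m, r (t + 1)) / (c * m) with hp
  set h : ℕ → ℝ := fun m => b m * ∏ t ∈ Finset.range m, r (t + 1) with hh
  have hple : ∀ m i, i ≤ m → p m i ≤ r m ^ i / (c * m) := by
    intro m i him
    apply div_le_div_of_nonneg_right _ (by positivity)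
    calc ∏ t ∈ Finset.Ico (m - i) m, r (t + 1) ≤ ∏ t ∈ Finset.Ico (m - i) m, r m := by
          apply Finset.prod_le_prod
          · intros; exact hr0 _
          · intro t ht
            rw [Finset.mem_Ico] at ht
            exact hrmono _ _ (by omega)
      _ = r m ^ i := by
          rw [Finset.prod_const, Nat.card_Ico]; congr 1; omega
  have hpge : ∀ m i, D ≤ m → 0 < m → i ∈ B → (1 - D ^ 2 / m : ℝ) * (r m ^ i / (c * m)) ≤ p m i := by
    intro m i hm hm0 hi
    have hiD := hD i hi
    have hmr : (0:ℝ) < m := by exact_mod_cast hm0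
    have hDm : (D:ℝ) / m ≤ 1 := by rw [div_le_one hmr]; exact_mod_cast hm
    have hDm0 : 0 ≤ (D:ℝ) / m := by positivity
    rw [← mul_div_assoc]
    apply div_le_div_of_nonneg_right _ (by positivity)
    have h1 : (1 - D ^ 2 / m : ℝ) ≤ (1 - D / m) ^ D := by
      have := one_add_mul_le_pow (a := -((D:ℝ) / m)) (by linarith) D
      calc (1 - D ^ 2 / m : ℝ) = 1 + D * -((D:ℝ) / m) := by ring
        _ ≤ _ := this
        _ = _ := by ring
    have h2 : (1 - D / m : ℝ) ^ D ≤ (1 - D / m) ^ i :=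
      pow_le_pow_of_le_one (by linarith) (by linarith) hiD
    calc (1 - D ^ 2 / m : ℝ) * r m ^ i ≤ (1 - D / m) ^ i * r m ^ i :=
          mul_le_mul_of_nonneg_right (h1.trans h2) (pow_nonneg (hr0 _) _)
      _ = ∏ t ∈ Finset.Ico (m - i) m, ((1 - D / m) * r m) := by
          rw [Finset.prod_const, Nat.card_Ico, ← mul_pow]; congr 1; omega
      _ ≤ _ := by
          apply Finset.prod_le_prod
          · intros; exact mul_nonneg (by linarith) (hr0 _)
          · intro t ht
            rw [Finset.mem_Ico] at ht
            refine le_trans ?_ ((hrscale (m - D) m (by omega) hm0).trans (hrmono _ _ (by omega)))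
            rw [Nat.cast_sub hm, sub_div, div_self hmr.ne']
  have hrow : ∀ m : ℕ, 0 < m → ∑ i ∈ B, r m ^ i / (c * m) = 1 := by
    intro m hm
    rw [← Finset.sum_div, hrP, div_self]
    positivity
  have H : HData B D (2 * D ^ 2) p h (K + 2 * D ^ 2 + D + 1) K := by
    refine ⟨hpos, hD, by positivity, ?_, by omega, ?_, ?_, ?_, ?_, ?_, ?_, hK K le_rfl, hK (K+1) (by omega)⟩
    · intro m i
      exact div_nonneg (Finset.prod_nonneg (fun _ _ => hr0 _)) (by positivity)
    · intro m hm
      exact mul_pos (hbpos m (by omega)) (Finset.prod_pos (fun t _ => hrpos _ (by omega)))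
    · intro m hm
      have hm0 : (0:ℝ) < m := by exact_mod_cast (by omega : 0 < m)
      have h1 := hrec m (by omega)
      have h2 : b m = (∑ i ∈ B, if i ≤ m then b (m - i) else 0) / (c * m) := by
        rw [← h1]; field_simp
      simp only [hh, hp]
      rw [h2, Finset.sum_div, Finset.sum_mul]
      apply Finset.sum_congr rfl
      intro i hi
      have hiD := hD i hi
      rw [if_pos (by omega), ← Finset.prod_range_mul_prod_Ico _ (by omega : m - i ≤ m)]
      ring
    · intro m hm
      rw [← hrow m (by omega)]
      exact Finset.sum_le_sum (fun i hi => hple m i (by have := hD i hi; omega))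
    · intro m hm
      have hm0 : (0:ℝ) < m := by exact_mod_cast (by omega : 0 < m)
      calc (1 - 2 * D ^ 2 / m : ℝ) ≤ 1 - D ^ 2 / m := by
            have : (0:ℝ) ≤ D ^ 2 / m := by positivity
            rw [mul_div_assoc]; linarith
        _ = ∑ i ∈ B, (1 - D ^ 2 / m : ℝ) * (r m ^ i / (c * m)) := by
            rw [← Finset.mul_sum, hrow m (by omega), mul_one]
        _ ≤ _ := Finset.sum_le_sum (fun i hi => hpge m i (by omega) (by omega) hi)
    · intro m hm
      have hm0 : (0:ℝ) < m := by exact_mod_cast (by omega : 0 < m)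
      have hmD : 2 * (D:ℝ) ^ 2 ≤ m := by exact_mod_cast (by omega : 2 * D ^ 2 ≤ m)
      have hmD1 : (D:ℝ) ≤ m := by exact_mod_cast (by omega : D ≤ m)
      set x : ℝ := D / m with hx
      have hx0 : 0 ≤ x := by positivity
      have hx1 : x ≤ 1 := by rw [hx, div_le_one hm0]; exact hmD1
      have hDx : (D:ℝ) * x ≤ 1 / 2 := by
        rw [hx, ← mul_div_assoc, div_le_iff₀ hm0]; nlinarith
      have hpw : (1 + x) ^ D ≤ 1 + 2 * D ^ 2 / m := by
        have h1 := one_add_mul_le_pow (a := -x) (by linarith) D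
        have h2 : (1 + x) ^ D * (1 + -x) ^ D ≤ 1 := by
          rw [← mul_pow]
          apply pow_le_one₀
          · nlinarith
          · nlinarith
        have h3 : (1 + x) ^ D * (1 - D * x) ≤ 1 := by
          refine le_trans (mul_le_mul_of_nonneg_left ?_ (by positivity)) h2
          linarith
        have h4 : (1 + x) ^ D ≤ 1 / (1 - D * x) := by
          rw [le_div_iff₀ (by linarith)]; exact h3
        have h5 : 1 / (1 - D * x) ≤ 1 + 2 * (D * x) := by
          rw [div_le_iff₀ (by linarith)]
          nlinarith [mul_nonneg (Nat.cast_nonneg (α := ℝ) D) hx0]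
        have h6 : 2 * (D * x) = 2 * D ^ 2 / m := by rw [hx]; ring
        linarith
      refine le_trans ?_ hpw
      calc ∑ i ∈ B, p (m + i) i ≤ ∑ i ∈ B, (1 + x) ^ D * (r m ^ i / (c * m)) := by
            apply Finset.sum_le_sum
            intro i hi
            have hiD := hD i hi
            refine (hple (m + i) i (by omega)).trans ?_
            have hsc := hrscale m (m + i) (by omega) (by omega)
            have h1 : r (m + i) ≤ (1 + x) * r m := by
              have hmi : (0:ℝ) < (m + i : ℕ) := by exact_mod_cast (by omega : 0 < m + i)
              rw [div_mul_eq_mul_div, div_le_iff₀ hmi] at hsc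
              have h2 : r (m + i) ≤ r m * (m + i : ℕ) / m := by
                rw [le_div_iff₀ hm0]; linarith
              refine h2.trans ?_
              have h3 : r m * (m + i : ℕ) / m = (1 + i / m) * r m := by
                push_cast; field_simp
              rw [h3]
              apply mul_le_mul_of_nonneg_right _ (hr0 _)
              have : (i:ℝ) / m ≤ D / m :=
                div_le_div_of_nonneg_right (by exact_mod_cast hiD) hm0.le
              linarith
            calc r (m + i) ^ i / (c * (m + i : ℕ)) ≤ ((1 + x) * r m) ^ i / (c * m) := by
                  apply div_le_div₀
                  · have := hr0 m; positivity
                  · exact pow_le_pow_left₀ (hr0 _) h1 i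
                  · positivity
                  · apply mul_le_mul_of_nonneg_left _ hc.le
                    exact_mod_cast (by omega : m ≤ m + i)
              _ = (1 + x) ^ i * (r m ^ i / (c * m)) := by rw [mul_pow]; ring
              _ ≤ _ := by
                  apply mul_le_mul_of_nonneg_right
                  · exact pow_le_pow_right₀ (by linarith) hiD
                  · have := hr0 m; positivity
        _ = (1 + x) ^ D := by rw [← Finset.mul_sum, hrow m (by omega), mul_one]
    · intro R
      have hev : ∀ᶠ m in atTop, 2 * c * (|R| + 1) + 1 ≤ r m := hrtop.eventually_ge_atTop _
      obtain ⟨N, hN⟩ := eventually_atTop.1 hev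
      refine ⟨N + 2 * D ^ 2 + D + 1, fun m hm i hi => ?_⟩
      have hm0 : (0:ℝ) < m := by exact_mod_cast (by omega : 0 < m)
      have h1 := hN m (by omega)
      have h2 := hpge m i (by omega) (by omega) hi
      have hr1 : 1 ≤ r m := by
        have : 0 ≤ 2 * c * (|R| + 1) := by positivity
        linarith
      have h3 : r m ≤ r m ^ i := le_self_pow₀ hr1 (hpos i hi).ne'
      have h4 : (D:ℝ) ^ 2 / m ≤ 1 / 2 := by
        rw [div_le_iff₀ hm0]
        have : 2 * (D:ℝ) ^ 2 ≤ m := by exact_mod_cast (by omega : 2 * D ^ 2 ≤ m)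
        linarith
      calc R ≤ (1 / 2) * (r m / c) := by
            rw [← mul_div_assoc, le_div_iff₀ hc]
            nlinarith [le_abs_self R]
        _ ≤ (1 - D ^ 2 / m) * (r m ^ i / c) := by
            apply mul_le_mul
            · linarith
            · exact div_le_div_of_nonneg_right h3 hc.le
            · positivity
            · linarith
        _ = (1 - D ^ 2 / m) * (r m ^ i / (c * m)) * m := by field_simp
        _ ≤ p m i * m := mul_le_mul_of_nonneg_right h2 hm0.le
  have hlim := H.tendsto_ratio hD0
  have hPr : Tendsto (fun x : ℝ => (∑ i ∈ B, x ^ i) / x ^ D) atTop (nhds 1) := by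
    have : Tendsto (fun x : ℝ => ∑ i ∈ B, x ^ i / x ^ D) atTop
        (nhds (∑ i ∈ B, if i = D then 1 else 0)) := by
      apply tendsto_finsetSum
      intro i hi
      split_ifs with hiD
      · subst hiD
        apply tendsto_const_nhds.congr'
        filter_upwards [eventually_gt_atTop 0] with x hx
        rw [div_self]; positivity
      · have := hD i hi
        exact tendsto_pow_div_pow_atTop_zero (by omega)
    simp only [Finset.sum_ite_eq', hDB, if_true] at this
    simpa only [Finset.sum_div] using this
  have hrr : Tendsto (fun m : ℕ => r m / (c * m) ^ ((1:ℝ) / D)) atTop (nhds 1) := by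
    have h1 := hPr.comp hrtop
    have h2 := (h1.rpow_const (p := -((1:ℝ) / D)) (Or.inl one_ne_zero))
    rw [Real.one_rpow] at h2
    refine h2.congr' ?_
    filter_upwards [eventually_gt_atTop 0] with m hm
    have hm0 : (0:ℝ) < m := by exact_mod_cast hm
    simp only [Function.comp]
    rw [hrP, Real.rpow_neg (by have := hr0 m; positivity), Real.div_rpow (by positivity) (by have := hr0 m; positivity),
      inv_div]
    congr 1
    rw [← Real.rpow_natCast, ← Real.rpow_mul (hr0 m)]
    have : (D:ℝ) * (1 / D) = 1 := by field_simp
    rw [this, Real.rpow_one]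
  have hfin := hlim.mul (hrr.comp (tendsto_add_atTop_nat 1))
  rw [mul_one] at hfin
  refine hfin.congr' ?_
  filter_upwards [eventually_ge_atTop K] with m hm
  have h1 := hbpos m hm
  have h2 := hbpos (m + 1) (by omega)
  have h3 : 0 < ∏ t ∈ Finset.range m, r (t + 1) := Finset.prod_pos (fun t _ => hrpos _ (by omega))
  have h4 := hrpos (m + 1) (by omega)
  simp only [hh, Function.comp]
  rw [Finset.prod_range_succ]
  field_simp

lemma per_semiconj {α β : Type*} (σ : α → α) (ρ : β → β) (e : β → α) (he : Function.Injective e)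
    (h : ∀ t, σ (e t) = e (ρ t)) (t : β) :
    Function.minimalPeriod σ (e t) = Function.minimalPeriod ρ t := by
  rw [Function.minimalPeriod_eq_minimalPeriod_iff]
  intro n
  have hs : Function.Semiconj e ρ σ := fun t => (h t).symm
  unfold Function.IsPeriodicPt Function.IsFixedPt
  rw [← (hs.iterate_right n).eq t]
  exact he.eq_iff

lemma per_rot (l : ℕ) [NeZero l] (t : ZMod l) :
    Function.minimalPeriod (fun x : ZMod l => x + 1) t = l := by
  have h0 := per_semiconj (fun x : ZMod l => x + 1) (fun x : ZMod l => 1 + x) (fun x => x + t)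
    (add_left_injective t) (fun s => by ring) 0
  simp only [zero_add] at h0
  rw [h0]
  have : addOrderOf (1 : ZMod l) = l := ZMod.addOrderOf_one l
  exact this

open Classical in
noncomputable def perY {α : Type*} [Fintype α] (l : ℕ) (σ : Equiv.Perm α) : ℕ :=
  (Finset.univ.filter (fun x => Function.minimalPeriod σ x = l)).card

lemma perY_eq_card {α : Type*} [Fintype α] (l : ℕ) (σ : Equiv.Perm α) :
    perY l σ = Nat.card {x // Function.minimalPeriod σ x = l} := by
  classical
  rw [perY, Nat.card_eq_fintype_card, Fintype.card_subtype]

/-- starting points of `l`-cycles correspond to equivariant embeddings of the rotation -/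
noncomputable def rotEmbEquiv {α : Type*} (l : ℕ) [NeZero l] (σ : Equiv.Perm α) :
    {e : ZMod l ↪ α // ∀ t, σ (e t) = e (t + 1)} ≃ {x // Function.minimalPeriod σ x = l} :=
  Equiv.ofBijective (fun e => ⟨e.1 0, by
      rw [per_semiconj σ (fun x : ZMod l => x + 1) e.1 e.1.injective e.2, per_rot]⟩) (by
    constructor
    · intro e f hef
      have h0 : e.1 0 = f.1 0 := congrArg Subtype.val hef
      have : ∀ k : ℕ, e.1 (k : ZMod l) = f.1 (k : ZMod l) := by
        intro k
        induction k with
        | zero => simpa using h0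
        | succ k ih => push_cast; rw [← e.2, ← f.2, ih]
      apply Subtype.ext
      ext t
      have := this t.val
      rwa [ZMod.natCast_zmod_val] at this
    · rintro ⟨x, hx⟩
      have hinj : Function.Injective (fun t : ZMod l => (σ : α → α)^[t.val] x) := by
        intro s t hst
        have h1 := Function.iterate_injOn_Iio_minimalPeriod (f := (σ : α → α)) (x := x)
        apply ZMod.val_injective l
        apply h1 _ _ hst
        · rw [hx]; exact ZMod.val_lt s
        · rw [hx]; exact ZMod.val_lt t
      refine ⟨⟨⟨_, hinj⟩, ?_⟩, ?_⟩
      · intro t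
        simp only [Function.Embedding.coeFn_mk]
        rw [← Function.iterate_succ_apply' (σ : α → α), ← Function.iterate_mod_minimalPeriod_eq (n := t.val.succ), hx]
        congr 2
        conv_rhs => rw [← ZMod.natCast_zmod_val t]
        rw [← Nat.cast_succ, ZMod.val_natCast]
      · simp)

lemma exists_sum_equiv {n l : ℕ} [NeZero l] (e : ZMod l ↪ Fin n) :
    ∃ φ : ZMod l ⊕ Fin (n - l) ≃ Fin n, ∀ t, φ (Sum.inl t) = e t := by
  classical
  have hcard : Fintype.card ((Set.range e)ᶜ : Set (Fin n)) = n - l := by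
    rw [Fintype.card_compl_set, Set.card_range_of_injective e.injective, ZMod.card, Fintype.card_fin]
  refine ⟨((Equiv.ofInjective e e.injective).sumCongr (Fintype.equivFinOfCardEq hcard).symm).trans
    (Equiv.Set.sumCompl (Set.range e)), ?_⟩
  intro t
  simp

open Classical in
/-- weight of a permutation -/
noncomputable def wtF {α : Type*} [Fintype α] (A : Set ℕ) (l : ℕ) (G : ℕ → ℝ) (σ : Equiv.Perm α) : ℝ :=
  if ∀ x, Function.minimalPeriod σ x ∈ A then G (perY l σ) else 0

open Classical in
noncomputable def mom (A : Set ℕ) (l : ℕ) (G : ℕ → ℝ) (n : ℕ) : ℝ :=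
  ∑ σ : Equiv.Perm (Fin n), wtF A l G σ

lemma wtF_glue {n l : ℕ} [NeZero l] (A : Set ℕ) (hl : l ∈ A) (G : ℕ → ℝ)
    (φ : ZMod l ⊕ Fin (n - l) ≃ Fin n) (τ : Equiv.Perm (Fin (n - l))) :
    wtF A l G (φ.permCongr (Equiv.sumCongr (Equiv.addRight (1 : ZMod l)) τ)) =
      wtF A l (fun y => G (y + l)) τ := by
  classical
  set σ := φ.permCongr (Equiv.sumCongr (Equiv.addRight (1 : ZMod l)) τ) with hσ
  have p1 : ∀ t, Function.minimalPeriod σ (φ (Sum.inl t)) = l := by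
    intro t
    rw [per_semiconj σ (fun x : ZMod l => x + 1) (fun t => φ (Sum.inl t))
      (φ.injective.comp Sum.inl_injective) (fun t => by simp [hσ]), per_rot]
  have p2 : ∀ t, Function.minimalPeriod σ (φ (Sum.inr t)) = Function.minimalPeriod τ t := by
    intro t
    exact per_semiconj σ τ (fun t => φ (Sum.inr t))
      (φ.injective.comp Sum.inr_injective) (fun t => by simp [hσ]) t
  have hall : (∀ x, Function.minimalPeriod σ x ∈ A) ↔ ∀ x, Function.minimalPeriod τ x ∈ A := by
    rw [← φ.forall_congr_right]
    simp only [Sum.forall, p1, p2, hl, implies_true, true_and]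
  have hY : perY l σ = perY l τ + l := by
    unfold perY
    rw [← Fintype.card_subtype, ← Fintype.card_subtype]
    have e1 : {x // Function.minimalPeriod σ x = l} ≃
        {x : ZMod l ⊕ Fin (n - l) // Function.minimalPeriod σ (φ x) = l} :=
      (φ.subtypeEquiv (fun a => Iff.rfl)).symm
    rw [Fintype.card_congr e1, Fintype.card_congr (Equiv.subtypeSum)]
    simp only [Fintype.card_sum, p1, p2]
    rw [add_comm]
    congr 1
    rw [Fintype.card_subtype]
    simp
  unfold wtF
  rw [hY]
  simp only [hall]

lemma mom_rec (A : Set ℕ) {n l : ℕ} (hl0 : 0 < l) (hl : l ∈ A) (G : ℕ → ℝ) :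
    mom A l (fun y => y * G y) n = n.descFactorial l * mom A l (fun y => G (y + l)) (n - l) := by
  classical
  have : NeZero l := ⟨hl0.ne'⟩
  have step1 : ∀ σ : Equiv.Perm (Fin n), wtF A l (fun y => y * G y) σ =
      ∑ e : ZMod l ↪ Fin n, if ∀ t, σ (e t) = e (t + 1) then wtF A l G σ else 0 := by
    intro σ
    rw [← Finset.sum_filter, Finset.sum_const, nsmul_eq_mul, ← Fintype.card_subtype,
      ← Nat.card_eq_fintype_card, Nat.card_congr (rotEmbEquiv l σ), ← perY_eq_card]
    unfold wtF
    split_ifs <;> simp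
  unfold mom
  rw [Finset.sum_congr rfl (fun σ _ => step1 σ), Finset.sum_comm]
  have step2 : ∀ e : ZMod l ↪ Fin n,
      (∑ σ : Equiv.Perm (Fin n), if ∀ t, σ (e t) = e (t + 1) then wtF A l G σ else 0) =
      ∑ τ : Equiv.Perm (Fin (n - l)), wtF A l (fun y => G (y + l)) τ := by
    intro e
    obtain ⟨φ, hφ⟩ := exists_sum_equiv e
    rw [← Finset.sum_filter]
    symm
    apply Finset.sum_bij (fun τ _ => φ.permCongr (Equiv.sumCongr (Equiv.addRight (1 : ZMod l)) τ))
    · intro τ _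
      simp only [Finset.mem_filter, Finset.mem_univ, true_and]
      intro t
      rw [← hφ, ← hφ]
      simp
    · intro τ _ τ' _ h
      have h1 := φ.permCongr.injective h
      apply Equiv.ext
      intro t
      have h2 := congrArg (fun f => f (Sum.inr t)) h1
      simpa using h2
    · intro σ hσ
      simp only [Finset.mem_filter, Finset.mem_univ, true_and] at hσ
      set σ' := φ.symm.permCongr σ with hσ'
      have hinl : ∀ t, σ' (Sum.inl t) = Sum.inl (t + 1) := by
        intro t
        simp only [hσ', Equiv.permCongr_apply, Equiv.symm_symm, hφ, hσ]
        rw [← hφ]; simp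
      have hmem : σ' ∈ (Equiv.Perm.sumCongrHom (ZMod l) (Fin (n - l))).range := by
        apply Equiv.Perm.mem_sumCongrHom_range_of_perm_mapsTo_inl
        rintro _ ⟨t, rfl⟩
        exact ⟨t + 1, (hinl t).symm⟩
      obtain ⟨⟨ρ, τ⟩, hτ⟩ := hmem
      refine ⟨τ, Finset.mem_univ _, ?_⟩
      have hρ : ρ = Equiv.addRight (1 : ZMod l) := by
        ext t
        have := hinl t
        rw [← hτ] at this
        simpa using this
      have h3 : Equiv.sumCongr (Equiv.addRight (1 : ZMod l)) τ = σ' := by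
        rw [← hτ, ← hρ]; rfl
      rw [h3, hσ']
      ext x
      simp
    · intro τ _
      exact (wtF_glue A hl G φ τ).symm
  rw [Finset.sum_congr rfl (fun e _ => step2 e), Finset.sum_const, nsmul_eq_mul, Finset.card_univ,
    Fintype.card_embedding_eq, ZMod.card, Fintype.card_fin]

lemma permCount_eq_mom (A : Set ℕ) (l n : ℕ) : (permCount A n : ℝ) = mom A l (fun _ => 1) n := by
  classical
  unfold permCount mom wtF
  simp only []
  rw [Nat.card_eq_fintype_card, Fintype.card_subtype, Finset.sum_boole]

/-- number of permutations with prescribed points in `l`-cycles -/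
lemma card_mul_descFactorial (A : Set ℕ) (l : ℕ) {j n : ℕ} (hjn : j ≤ n) :
    (n.descFactorial j : ℝ) * (Nat.card {s : Equiv.Perm (Fin n) //
          (∀ x, Function.minimalPeriod ⇑s x ∈ A) ∧
          ∀ m : Fin n, (m : ℕ) < j → Function.minimalPeriod ⇑s m = l} : ℝ) =
    mom A l (fun y => (y.descFactorial j : ℝ)) n := by
  classical
  have hconj : ∀ (g s : Equiv.Perm (Fin n)) (x : Fin n),
      Function.minimalPeriod (g.permCongr s) (g x) = Function.minimalPeriod s x := by
    intro g s x
    exact per_semiconj _ _ g g.injective (fun t => by simp) x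
  have hcard : ∀ f : Fin j ↪ Fin n,
      Nat.card {s : Equiv.Perm (Fin n) // (∀ x, Function.minimalPeriod ⇑s x ∈ A) ∧
          ∀ t, Function.minimalPeriod ⇑s (f t) = l} =
      Nat.card {s : Equiv.Perm (Fin n) // (∀ x, Function.minimalPeriod ⇑s x ∈ A) ∧
          ∀ m : Fin n, (m : ℕ) < j → Function.minimalPeriod ⇑s m = l} := by
    intro f
    obtain ⟨g, hg⟩ : ∃ g : Equiv.Perm (Fin n), ∀ t, g (Fin.castLE hjn t) = f t := by
      let e1 := (Equiv.ofInjective _ (Fin.castLE_injective hjn)).symm.trans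
        (Equiv.ofInjective f f.injective)
      refine ⟨Equiv.extendSubtype (p := (· ∈ Set.range (Fin.castLE hjn)))
        (q := (· ∈ Set.range f)) e1, ?_⟩
      intro t
      rw [Equiv.extendSubtype_apply_of_mem _ _ ⟨t, rfl⟩]
      have : (Equiv.ofInjective _ (Fin.castLE_injective hjn)).symm ⟨Fin.castLE hjn t, ⟨t, rfl⟩⟩ = t := by
        rw [Equiv.symm_apply_eq]; rfl
      simp only [e1, Equiv.trans_apply]
      rw [this]; rfl
    symm
    apply Nat.card_congr
    refine (g.permCongr).subtypeEquiv ?_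
    intro s
    apply and_congr
    · rw [← g.forall_congr_right (q := fun x => Function.minimalPeriod (g.permCongr s) x ∈ A)]
      simp only [hconj]
    · constructor
      · intro h t
        rw [← hg, hconj]
        exact h _ (by simp)
      · intro h m hm
        have := h ⟨m, hm⟩
        rw [← hg, hconj] at this
        simpa using this
  have hY : ∀ s : Equiv.Perm (Fin n), ((perY l s).descFactorial j) =
      Fintype.card {f : Fin j ↪ Fin n // ∀ t, Function.minimalPeriod ⇑s (f t) = l} := by
    intro s
    have e : {f : Fin j ↪ Fin n // ∀ t, Function.minimalPeriod ⇑s (f t) = l} ≃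
        (Fin j ↪ {x // Function.minimalPeriod ⇑s x = l}) :=
      { toFun := fun f => ⟨fun t => ⟨f.1 t, f.2 t⟩, fun a b h => f.1.injective (congrArg Subtype.val h)⟩
        invFun := fun f => ⟨f.trans (Function.Embedding.subtype _), fun t => (f t).2⟩
        left_inv := fun f => by ext; rfl
        right_inv := fun f => by ext; rfl }
    rw [Fintype.card_congr e, Fintype.card_embedding_eq, Fintype.card_fin, perY_eq_card,
      Nat.card_eq_fintype_card]
  have h1 : mom A l (fun y => (y.descFactorial j : ℝ)) n =
      ∑ s : Equiv.Perm (Fin n), ∑ f : Fin j ↪ Fin n,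
        if (∀ x, Function.minimalPeriod ⇑s x ∈ A) ∧ ∀ t, Function.minimalPeriod ⇑s (f t) = l
          then (1:ℝ) else 0 := by
    unfold mom wtF
    apply Finset.sum_congr rfl
    intro s _
    split_ifs with hs
    · simp only [hs, implies_true, true_and]
      rw [Finset.sum_boole, hY, Fintype.card_subtype]
    · simp [hs]
  rw [h1, Finset.sum_comm]
  have h2 : ∀ f : Fin j ↪ Fin n, (∑ s : Equiv.Perm (Fin n),
      if (∀ x, Function.minimalPeriod ⇑s x ∈ A) ∧ ∀ t, Function.minimalPeriod ⇑s (f t) = l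
          then (1:ℝ) else 0) = (Nat.card {s : Equiv.Perm (Fin n) //
          (∀ x, Function.minimalPeriod ⇑s x ∈ A) ∧
          ∀ m : Fin n, (m : ℕ) < j → Function.minimalPeriod ⇑s m = l} : ℝ) := by
    intro f
    rw [← hcard f, Finset.sum_boole, Nat.card_eq_fintype_card, Fintype.card_subtype]
  rw [Finset.sum_congr rfl (fun f _ => h2 f), Finset.sum_const, nsmul_eq_mul, Finset.card_univ,
    Fintype.card_embedding_eq, Fintype.card_fin, Fintype.card_fin]

/-- normalized counts -/
noncomputable def aCnt (A : Finset ℕ) (n : ℕ) : ℝ := (permCount (A : Set ℕ) n : ℝ) / (n.factorial : ℝ)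

lemma fact_div_desc {n i : ℕ} (h : i ≤ n) (x : ℝ) :
    (n.descFactorial i : ℝ) * x / (n.factorial : ℝ) = x / ((n - i).factorial : ℝ) := by
  have h1 : ((n - i).factorial : ℝ) * (n.descFactorial i : ℝ) = (n.factorial : ℝ) := by
    exact_mod_cast Nat.factorial_mul_descFactorial h
  have h2 : ((n - i).factorial : ℝ) ≠ 0 := by positivity
  have h3 : (n.factorial : ℝ) ≠ 0 := by positivity
  rw [div_eq_div_iff h3 h2, ← h1]; ring

lemma aCnt_rec (A : Finset ℕ) (hApos : ∀ a ∈ A, 0 < a) (n : ℕ) :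
    (n : ℝ) * aCnt A n = ∑ i ∈ A, if i ≤ n then aCnt A (n - i) else 0 := by
  classical
  have h1 : (n : ℝ) * (permCount (A : Set ℕ) n : ℝ) =
      ∑ i ∈ A, mom (A : Set ℕ) i (fun y => y * 1) n := by
    rw [permCount_eq_mom _ 0]
    unfold mom
    rw [Finset.sum_comm, Finset.mul_sum]
    apply Finset.sum_congr rfl
    intro σ _
    unfold wtF
    split_ifs with h
    · simp only [mul_one]
      have := Finset.card_eq_sum_card_fiberwise (s := (Finset.univ : Finset (Fin n))) (t := A)
        (f := fun x => Function.minimalPeriod σ x) (fun x _ => h x)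
      rw [Finset.card_univ, Fintype.card_fin] at this
      unfold perY
      exact_mod_cast this
    · simp
  have h2 : (n : ℝ) * aCnt A n = ∑ i ∈ A, mom (A : Set ℕ) i (fun y => y * 1) n / (n.factorial : ℝ) := by
    rw [← Finset.sum_div, ← h1, aCnt, mul_div_assoc]
  rw [h2]
  apply Finset.sum_congr rfl
  intro i hi
  rw [mom_rec (A : Set ℕ) (hApos i hi) hi (fun _ => 1), ← permCount_eq_mom]
  split_ifs with h
  · rw [fact_div_desc h]; rfl
  · rw [Nat.descFactorial_of_lt (by omega)]; simp

lemma aCnt_nonneg (A : Finset ℕ) (n : ℕ) : 0 ≤ aCnt A n := by unfold aCnt; positivity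

lemma aCnt_zero (A : Finset ℕ) : 0 < aCnt A 0 := by
  have : permCount (A : Set ℕ) 0 = 1 := by
    unfold permCount
    rw [Nat.card_eq_one_iff_unique]
    exact ⟨⟨fun a b => Subtype.ext (Subsingleton.elim _ _)⟩, ⟨⟨1, fun x => x.elim0⟩⟩⟩
  simp [aCnt, this]

lemma aCnt_ne_zero_iff (A : Finset ℕ) (n : ℕ) : aCnt A n ≠ 0 ↔ permCount (A : Set ℕ) n ≠ 0 := by
  unfold aCnt
  rw [div_ne_zero_iff]
  have : (n.factorial : ℝ) ≠ 0 := by positivity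
  simp [Nat.factorial_ne_zero]

lemma dvd_of_aCnt_ne_zero (A : Finset ℕ) (hApos : ∀ a ∈ A, 0 < a) (g : ℕ) (hg : ∀ a ∈ A, g ∣ a) :
    ∀ n, aCnt A n ≠ 0 → g ∣ n := by
  intro n
  induction n using Nat.strong_induction_on with
  | _ n ih =>
    intro h
    by_cases hn : n = 0
    · simp [hn]
    have h1 : (n : ℝ) * aCnt A n ≠ 0 := mul_ne_zero (by exact_mod_cast hn) h
    rw [aCnt_rec A hApos] at h1
    obtain ⟨i, hi, hne⟩ := Finset.exists_ne_zero_of_sum_ne_zero h1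
    split_ifs at hne with hle
    · have := ih (n - i) (by have := hApos i hi; omega) hne
      have h2 := dvd_add this (hg i hi)
      rwa [Nat.sub_add_cancel hle] at h2
    · exact absurd rfl hne

lemma shift_ratio (c : ℝ) (hc : 0 < c) (s : ℕ) (e : ℝ) :
    Tendsto (fun m : ℕ => (c * (m : ℝ)) ^ e / (c * (m + s : ℕ)) ^ e) atTop (nhds 1) := by
  have h0 : Tendsto (fun m : ℕ => (m : ℝ) / (m + s)) atTop (nhds 1) := tendsto_natCast_div_add_atTop (s : ℝ)
  have h1 := h0.rpow_const (p := e) (Or.inl one_ne_zero)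
  rw [Real.one_rpow] at h1
  refine h1.congr' ?_
  filter_upwards [eventually_gt_atTop 0] with m hm
  have hm0 : (0:ℝ) < m := by exact_mod_cast hm
  rw [← Real.div_rpow (by positivity) (by positivity)]
  congr 1
  push_cast
  field_simp

lemma iter_ratio (b : ℕ → ℝ) (c : ℝ) (hc : 0 < c) (K : ℕ) (hb : ∀ m, K ≤ m → 0 < b m) (e : ℝ)
    (h : Tendsto (fun m : ℕ => b m / b (m + 1) / (c * (m + 1 : ℕ)) ^ e) atTop (nhds 1)) (k : ℕ) :
    Tendsto (fun m : ℕ => b m / b (m + k) / (c * (m + k : ℕ)) ^ (e * k)) atTop (nhds 1) := by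
  induction k with
  | zero =>
    apply tendsto_const_nhds.congr'
    filter_upwards [eventually_ge_atTop K] with m hm
    have := hb m hm
    simp [this.ne']
  | succ k ih =>
    have h1 := h.comp (tendsto_add_atTop_nat k)
    have h2 := (shift_ratio c hc 1 (e * k)).comp (tendsto_add_atTop_nat k)
    have h3 := (ih.mul h1).mul h2
    simp only [mul_one] at h3
    refine h3.congr' ?_
    filter_upwards [eventually_ge_atTop (K + 1)] with m hm
    simp only [Function.comp]
    have a1 := hb (m + k) (by omega)
    have a2 := hb (m + k + 1) (by omega)
    have a3 : (0:ℝ) < c * (m + k : ℕ) := mul_pos hc (by exact_mod_cast (by omega : 0 < m + k))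
    have a4 : (0:ℝ) < c * (m + k + 1 : ℕ) := mul_pos hc (by exact_mod_cast (by omega : 0 < m + k + 1))
    have a5 := Real.rpow_pos_of_pos a3 (e * k)
    have a6 := Real.rpow_pos_of_pos a4 (e * k)
    have a7 := Real.rpow_pos_of_pos a4 e
    have e1 : e * ((k + 1 : ℕ) : ℝ) = e * k + e := by push_cast; ring
    rw [← add_assoc m k 1, e1, Real.rpow_add a4]
    field_simp

lemma aCnt_ratio (A : Finset ℕ) (hApos : ∀ a ∈ A, 0 < a) (d : ℕ) (hdA : d ∈ A)
    (hdmax : ∀ a ∈ A, a ≤ d) (l : ℕ) (hl : l ∈ A) :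
    Tendsto (fun n : ℕ => aCnt A (n - l) / aCnt A n / (n : ℝ) ^ ((l : ℝ) / d))
      (atTop ⊓ Filter.principal {n | permCount (A : Set ℕ) n ≠ 0}) (nhds 1) := by
  classical
  set g := Nat.setGcd (A : Set ℕ) with hg
  have hgd : ∀ a ∈ A, g ∣ a := fun a ha => Nat.setGcd_dvd_of_mem ha
  have hg0 : 0 < g := Nat.pos_of_dvd_of_pos (hgd d hdA) (hApos d hdA)
  obtain ⟨K, hK⟩ := Nat.exists_mem_closure_of_ge (A : Set ℕ)
  set B := A.image (· / g) with hB
  have hinj : Set.InjOn (· / g) (A : Set ℕ) := by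
    intro a ha b hb hab
    have h1 := Nat.div_mul_cancel (hgd a ha)
    have h2 := Nat.div_mul_cancel (hgd b hb)
    simp only at hab
    rw [← h1, ← h2, hab]
  have hKB : ∀ m, K ≤ m → m ∈ AddSubmonoid.closure (B : Set ℕ) := by
    have key : ∀ x ∈ AddSubmonoid.closure (A : Set ℕ), g ∣ x ∧ x / g ∈ AddSubmonoid.closure (B : Set ℕ) := by
      intro x hx
      induction hx using AddSubmonoid.closure_induction with
      | mem x hx => exact ⟨hgd x hx, AddSubmonoid.subset_closure (by
          rw [hB]; exact Finset.mem_coe.2 (Finset.mem_image_of_mem _ hx))⟩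
      | zero => simp
      | add x y _ _ hx hy =>
        refine ⟨dvd_add hx.1 hy.1, ?_⟩
        rw [Nat.add_div_of_dvd_right hx.1]
        exact add_mem hx.2 hy.2
    intro m hm
    have := (key (g * m) (hK (g * m) (by nlinarith) ⟨m, rfl⟩)).2
    rwa [Nat.mul_div_cancel_left m hg0] at this
  have hBpos : ∀ i ∈ B, 0 < i := by
    intro i hi
    rw [hB, Finset.mem_image] at hi
    obtain ⟨a, ha, rfl⟩ := hi
    exact Nat.div_pos (Nat.le_of_dvd (hApos a ha) (hgd a ha)) hg0
  set b : ℕ → ℝ := fun m => aCnt A (g * m) with hb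
  have hrec : ∀ m, 0 < m → (g:ℝ) * m * b m = ∑ i ∈ B, if i ≤ m then b (m - i) else 0 := by
    intro m hm
    have h1 := aCnt_rec A hApos (g * m)
    rw [hB, Finset.sum_image hinj]
    push_cast at h1
    rw [hb]
    simp only
    rw [h1]
    apply Finset.sum_congr rfl
    intro a ha
    obtain ⟨a', rfl⟩ := hgd a ha
    rw [Nat.mul_div_cancel_left _ hg0, ← Nat.mul_sub]
    have : g * a' ≤ g * m ↔ a' ≤ m := Nat.mul_le_mul_left_iff hg0
    simp only [this]
  obtain ⟨d', hd'⟩ := hgd d hdA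
  obtain ⟨k, hk⟩ := hgd l hl
  have hd'0 : 0 < d' := Nat.pos_of_ne_zero (by rintro rfl; have := hApos d hdA; omega)
  have hra := ratio_asymp B hBpos ⟨d / g, Finset.mem_image_of_mem _ hdA⟩ d'
    (by rw [hB, Finset.mem_image]; exact ⟨d, hdA, by rw [hd', Nat.mul_div_cancel_left _ hg0]⟩)
    (by
      intro i hi
      rw [hB, Finset.mem_image] at hi
      obtain ⟨a, ha, rfl⟩ := hi
      have := Nat.div_le_div_right (c := g) (hdmax a ha)
      rwa [hd', Nat.mul_div_cancel_left _ hg0] at this)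
    g (by exact_mod_cast hg0) K hKB b (fun m => aCnt_nonneg _ _) (by simpa [hb] using aCnt_zero A) hrec
  have hit := iter_ratio b g (by exact_mod_cast hg0) K hra.1 _ hra.2 k
  have htop : Tendsto (fun n : ℕ => n / g - k) atTop atTop :=
    (tendsto_sub_atTop_nat k).comp (Nat.tendsto_div_const_atTop hg0.ne')
  have hfin := (hit.comp htop).mono_left (inf_le_left : atTop ⊓ Filter.principal {n | permCount (A : Set ℕ) n ≠ 0} ≤ atTop)
  refine hfin.congr' ?_
  rw [EventuallyEq, eventually_inf_principal]
  filter_upwards [eventually_ge_atTop l] with n hn hne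
  obtain ⟨m, rfl⟩ := dvd_of_aCnt_ne_zero A hApos g hgd n ((aCnt_ne_zero_iff A n).2 hne)
  have hkm : k ≤ m := by rw [hk] at hn; exact Nat.le_of_mul_le_mul_left hn hg0
  simp only [Function.comp, hb]
  rw [Nat.mul_div_cancel_left _ hg0, Nat.sub_add_cancel hkm, Nat.mul_sub, ← hk]
  have hgr : (g:ℝ) ≠ 0 := by exact_mod_cast hg0.ne'
  have hdr : (d':ℝ) ≠ 0 := by exact_mod_cast hd'0.ne'
  have e1 : (1:ℝ) / d' * k = (l:ℝ) / d := by
    rw [hd', hk]; push_cast; field_simp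
  rw [e1]
  push_cast
  rfl

lemma mom_asymp (A : Finset ℕ) (hApos : ∀ a ∈ A, 0 < a) (d : ℕ) (hdA : d ∈ A)
    (hdmax : ∀ a ∈ A, a ≤ d) (l : ℕ) (hl : l ∈ A) (k : ℕ) :
    ∀ L : List ℝ, L.length = k →
    Tendsto (fun n : ℕ => mom (A : Set ℕ) l (fun y => (L.map (fun t => (y : ℝ) - t)).prod) n /
        (permCount (A : Set ℕ) n : ℝ) / (n : ℝ) ^ ((l : ℝ) / d * k))
      (atTop ⊓ Filter.principal {n | permCount (A : Set ℕ) n ≠ 0}) (nhds 1) := by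
  have hl0 := hApos l hl
  have hd0 := hApos d hdA
  have hrat := aCnt_ratio A hApos d hdA hdmax l hl
  set 𝓕 := atTop ⊓ Filter.principal {n | permCount (A : Set ℕ) n ≠ 0} with hF
  have hFle : 𝓕 ≤ atTop := inf_le_left
  have hFne : ∀ᶠ n in 𝓕, permCount (A : Set ℕ) n ≠ 0 := by
    rw [hF, eventually_inf_principal]; exact Eventually.of_forall (fun _ h => h)
  have hFge : ∀ N, ∀ᶠ n in 𝓕, N ≤ n := fun N => hFle (eventually_ge_atTop N)
  have hne2 : ∀ᶠ n in 𝓕, permCount (A : Set ℕ) (n - l) ≠ 0 := by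
    filter_upwards [hrat.eventually_ne one_ne_zero] with n hn h0
    apply hn
    simp [aCnt, h0]
  have hshift : Tendsto (fun n => n - l) 𝓕 𝓕 := by
    rw [hF, tendsto_inf, tendsto_principal]
    exact ⟨(tendsto_sub_atTop_nat l).mono_left hFle, hne2⟩
  have hld : (0:ℝ) < (l:ℝ) / d := by
    have : (0:ℝ) < l := by exact_mod_cast hl0
    have : (0:ℝ) < d := by exact_mod_cast hd0
    positivity
  have hpow0 : Tendsto (fun n : ℕ => ((n : ℝ) ^ ((l : ℝ) / d))⁻¹) 𝓕 (nhds 0) :=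
    (((tendsto_rpow_atTop hld).comp tendsto_natCast_atTop_atTop).inv_tendsto_atTop).mono_left hFle
  induction k with
  | zero =>
    intro L hL
    rw [List.length_eq_zero_iff] at hL
    subst hL
    apply tendsto_const_nhds.congr'
    filter_upwards [hFne] with n hn
    simp only [List.map_nil, List.prod_nil]
    rw [← permCount_eq_mom]
    have : (permCount (A : Set ℕ) n : ℝ) ≠ 0 := by exact_mod_cast hn
    simp [this]
  | succ k ih =>
    intro L hL
    match L, hL with
    | t :: L, hL =>
      have hL' : L.length = k := by simpa using hL
      have i1 := ih L hL'
      have i2 := (ih (L.map (fun s => s - l)) (by simpa using hL')).comp hshift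
      have i3 : Tendsto (fun n : ℕ => ((n - l : ℕ) : ℝ) ^ ((l : ℝ) / d * k) / (n:ℝ) ^ ((l : ℝ) / d * k)) 𝓕 (nhds 1) := by
        have := ((shift_ratio 1 one_pos l ((l : ℝ) / d * k)).comp (tendsto_sub_atTop_nat l)).mono_left hFle
        refine this.congr' ?_
        filter_upwards [hFge l] with n hn
        simp only [Function.comp, Nat.sub_add_cancel hn, one_mul]
      have hall := ((i2.mul hrat).mul i3).sub ((i1.mul hpow0).const_mul t)
      simp only [mul_one, mul_zero, sub_zero] at hall
      refine hall.congr' ?_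
      filter_upwards [hFge (l + 1), hFne, hne2] with n hn hn1 hn2
      simp only [Function.comp]
      have hn0 : (0:ℝ) < n := by exact_mod_cast (by omega : 0 < n)
      have hnl0 : (0:ℝ) < (n - l : ℕ) := by exact_mod_cast (by omega : 0 < n - l)
      have m1 : mom (A : Set ℕ) l (fun y => ((t :: L).map (fun t => (y : ℝ) - t)).prod) n =
          mom (A : Set ℕ) l (fun y => y * (L.map (fun t => (y : ℝ) - t)).prod) n -
          t * mom (A : Set ℕ) l (fun y => (L.map (fun t => (y : ℝ) - t)).prod) n := by
        unfold mom
        rw [Finset.mul_sum, ← Finset.sum_sub_distrib]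
        apply Finset.sum_congr rfl
        intro σ _
        unfold wtF
        split_ifs
        · simp only [List.map_cons, List.prod_cons]; ring
        · simp
      have m2 := mom_rec (A : Set ℕ) (n := n) hl0 hl (fun y => (L.map (fun t => (y : ℝ) - t)).prod)
      have m3 : (fun y : ℕ => (L.map (fun t => ((y + l : ℕ) : ℝ) - t)).prod) =
          fun y : ℕ => ((L.map (fun s => s - (l:ℝ))).map (fun t => (y : ℝ) - t)).prod := by
        funext y
        rw [List.map_map]
        congr 2
        funext s
        simp only [Function.comp]
        push_cast; ring
      rw [m3] at m2
      have m4 := fact_div_desc (n := n) (i := l) (by omega)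
        (mom (A : Set ℕ) l (fun y : ℕ => ((L.map (fun s => s - (l:ℝ))).map (fun t => (y : ℝ) - t)).prod) (n - l))
      rw [← m2] at m4
      rw [m1]
      set X := mom (A : Set ℕ) l (fun y : ℕ => ((L.map (fun s => s - (l:ℝ))).map (fun t => (y : ℝ) - t)).prod) (n - l)
      set Y := mom (A : Set ℕ) l (fun y => y * (L.map (fun t => (y : ℝ) - t)).prod) n
      set Z := mom (A : Set ℕ) l (fun y => (L.map (fun t => (y : ℝ) - t)).prod) n
      have hp1 : (permCount (A : Set ℕ) n : ℝ) ≠ 0 := by exact_mod_cast hn1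
      have hp2 : (permCount (A : Set ℕ) (n - l) : ℝ) ≠ 0 := by exact_mod_cast hn2
      have f1 : (n.factorial : ℝ) ≠ 0 := by positivity
      have f2 : ((n - l).factorial : ℝ) ≠ 0 := by positivity
      have e1 : (l : ℝ) / d * ((k + 1 : ℕ) : ℝ) = (l : ℝ) / d * k + (l : ℝ) / d := by push_cast; ring
      rw [e1, Real.rpow_add hn0]
      have g1 := (Real.rpow_pos_of_pos hn0 ((l : ℝ) / d * k)).ne'
      have g2 := (Real.rpow_pos_of_pos hn0 ((l : ℝ) / d)).ne'
      have g3 := (Real.rpow_pos_of_pos hnl0 ((l : ℝ) / d * k)).ne'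
      have hY : Y = X / ((n - l).factorial : ℝ) * (n.factorial : ℝ) := by
        rw [← m4]; field_simp
      rw [hY]
      unfold aCnt
      generalize (n : ℝ) ^ ((l : ℝ) / d * k) = u1 at *
      generalize (n : ℝ) ^ ((l : ℝ) / d) = u2 at *
      generalize ((n - l : ℕ) : ℝ) ^ ((l : ℝ) / d * k) = u3 at *
      field_simp

lemma cast_desc_eq (j y : ℕ) : (y.descFactorial j : ℝ) =
    (((List.range j).map (fun t : ℕ => (t : ℝ))).map (fun t => (y : ℝ) - t)).prod := by
  rw [← descPochhammer_eval_eq_descFactorial ℝ y j, descPochhammer_eval_eq_prod_range]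
  induction j with
  | zero => simp
  | succ j ih => rw [Finset.prod_range_succ, ih, List.range_succ]; simp

theorem stmt_18 (A : Finset ℕ) (hApos : ∀ a ∈ A, 0 < a) (hA : A.Nonempty)
    (d : ℕ) (hd : d = A.max' hA) (l : ℕ) (hl : l ∈ A) (j : ℕ) (hj : 0 < j) :
    Tendsto (fun n : ℕ =>
      ((Nat.card {s : Equiv.Perm (Fin n) //
          (∀ x, Function.minimalPeriod ⇑s x ∈ (A : Set ℕ)) ∧
          ∀ m : Fin n, (m : ℕ) < j → Function.minimalPeriod ⇑s m = l} : ℝ) /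
        (permCount ↑A n : ℝ)) / (n : ℝ) ^ (((l : ℝ) / d - 1) * j))
      (atTop ⊓ Filter.principal {n | permCount ↑A n ≠ 0}) (nhds 1) := by
  have hdA : d ∈ A := by rw [hd]; exact A.max'_mem hA
  have hdmax : ∀ a ∈ A, a ≤ d := fun a ha => by rw [hd]; exact A.le_max' a ha
  have h1 := mom_asymp A hApos d hdA hdmax l hl j ((List.range j).map (fun t : ℕ => (t : ℝ))) (by simp)
  have h2 : Tendsto (fun n : ℕ => (n:ℝ) ^ j / (n.descFactorial j : ℝ)) atTop (nhds 1) := by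
    have h3 := (isEquivalent_descFactorial j).symm
    refine (Asymptotics.isEquivalent_iff_tendsto_one ?_).1 h3
    filter_upwards [eventually_ge_atTop j] with n hn
    have : n.descFactorial j ≠ 0 := by
      rw [Ne, Nat.descFactorial_eq_zero_iff_lt]; omega
    exact_mod_cast this
  have h4 := h1.mul (h2.mono_left (inf_le_left :
    atTop ⊓ Filter.principal {n | permCount (A : Set ℕ) n ≠ 0} ≤ atTop))
  rw [mul_one] at h4
  refine h4.congr' ?_
  have hge : ∀ᶠ n in atTop ⊓ Filter.principal {n | permCount (A : Set ℕ) n ≠ 0}, j ≤ n :=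
    (inf_le_left : _ ≤ atTop) (eventually_ge_atTop j)
  filter_upwards [hge] with n hn
  have hn0 : (0:ℝ) < n := by exact_mod_cast (by omega : 0 < n)
  simp only [← cast_desc_eq]
  rw [← card_mul_descFactorial (A : Set ℕ) l hn]
  have hdf : (n.descFactorial j : ℝ) ≠ 0 := by
    have : n.descFactorial j ≠ 0 := by
      rw [Ne, Nat.descFactorial_eq_zero_iff_lt]; omega
    exact_mod_cast this
  have e1 : ((l : ℝ) / d - 1) * j = (l : ℝ) / d * j - j := by ring
  rw [e1, Real.rpow_sub hn0, Real.rpow_natCast]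
  have g1 := (Real.rpow_pos_of_pos hn0 ((l : ℝ) / d * j)).ne'
  generalize (n : ℝ) ^ ((l : ℝ) / d * j) = u1 at *
  field_simp
end

section
/- Let A be a finite set of positive integers with maximum d, and for n with S_n^{(A)} ≠ ∅ let σ_n be uniform on S_n^{(A)}. Then for every l ∈ A and every integer m ≥ 1, the expectation E[N_l(σ_n)^m] is asymptotically equivalent to n^{ml/d}/l^m as n → ∞ along n with S_n^{(A)} ≠ ∅. -/
open Filter
open scoped Classical

open Equiv.Perm in
lemma mp_eq {n : ℕ} (σ : Equiv.Perm (Fin n)) (x : Fin n) (hx : σ x ≠ x) :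
    Function.minimalPeriod ⇑σ x = (σ.cycleOf x).support.card := by
  have hc : (σ.cycleOf x).IsCycle := isCycle_cycleOf σ hx
  have key : ∀ j, Function.minimalPeriod ⇑σ x ∣ j ↔ (σ.cycleOf x).support.card ∣ j := by
    intro j
    rw [← Function.isPeriodicPt_iff_minimalPeriod_dvd, ← hc.orderOf, orderOf_dvd_iff_pow_eq_one,
      hc.pow_eq_one_iff' (x := x) (by simpa using hx), cycleOf_pow_apply_self,
      Function.IsPeriodicPt, Function.IsFixedPt, ← Equiv.Perm.coe_pow]
  exact Nat.dvd_antisymm ((key _).2 dvd_rfl) ((key _).1 dvd_rfl)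

noncomputable def ptype {n : ℕ} (σ : Equiv.Perm (Fin n)) : Multiset ℕ := σ.partition.parts

lemma mp_pos {n : ℕ} (σ : Equiv.Perm (Fin n)) (x : Fin n) :
    0 < Function.minimalPeriod ⇑σ x := by
  by_cases hx : σ x = x
  · have : Function.IsPeriodicPt σ 1 x := hx
    exact this.minimalPeriod_pos one_pos
  · rw [mp_eq σ x hx, Finset.card_pos]
    exact ⟨x, by simpa using hx⟩

open Equiv.Perm in
lemma count_ptype {n : ℕ} (σ : Equiv.Perm (Fin n)) (k : ℕ) (hk : 0 < k) :
    (Finset.univ.filter (fun x : Fin n => Function.minimalPeriod ⇑σ x = k)).card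
      = k * (ptype σ).count k := by
  rw [ptype, parts_partition, Multiset.count_add, Multiset.count_replicate]
  by_cases h1 : k = 1
  · subst h1
    have : σ.cycleType.count 1 = 0 := by
      rw [Multiset.count_eq_zero]
      intro h
      exact absurd (two_le_of_mem_cycleType h) (by norm_num)
    rw [this]
    simp only [if_true, zero_add, one_mul]
    rw [← Finset.card_compl]
    congr 1
    ext x
    simp [Function.minimalPeriod_eq_one_iff_isFixedPt, Function.IsFixedPt]
  · rw [if_neg (fun h => h1 h.symm), add_zero, cycleType_def, Multiset.count_map,
      ← Finset.filter_val]
    have : (Finset.univ.filter (fun x : Fin n => Function.minimalPeriod ⇑σ x = k)) =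
       (σ.cycleFactorsFinset.filter (fun c => k = (Finset.card ∘ support) c)).biUnion
          (fun c => c.support) := by
      ext x
      simp only [Finset.mem_filter, Finset.mem_univ, true_and, Finset.mem_biUnion,
        Function.comp_apply]
      constructor
      · intro h
        have hx : σ x ≠ x := by
          intro hx
          apply h1
          rw [← h, Function.minimalPeriod_eq_one_iff_isFixedPt]
          exact hx
        refine ⟨σ.cycleOf x, ⟨cycleOf_mem_cycleFactorsFinset_iff.2 (by simpa using hx), ?_⟩, ?_⟩
        · rw [← h, mp_eq σ x hx]
        · simpa using hx
      · rintro ⟨c, ⟨hc, hk⟩, hx⟩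
        have hcx := cycle_is_cycleOf hx hc
        have hx' : σ x ≠ x := by
          have := mem_cycleFactorsFinset_support_le hc hx
          simpa using this
        rw [mp_eq σ x hx', ← hcx, hk]
    rw [this, Finset.card_biUnion, Finset.sum_const_nat (m := k), mul_comm]
    · rfl
    · intro c hc
      simp at hc
      exact hc.2.symm
    · intro c hc e he hne
      rw [Finset.mem_coe, Finset.mem_filter] at hc he
      exact (cycleFactorsFinset_pairwise_disjoint σ hc.1 he.1 hne).disjoint_support

lemma cycleCount_eq {n : ℕ} (σ : Equiv.Perm (Fin n)) (k : ℕ) (hk : 0 < k) :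
    cycleCount σ k = (ptype σ).count k := by
  rw [cycleCount, Nat.card_eq_fintype_card, Fintype.card_subtype, count_ptype σ k hk,
    Nat.mul_div_cancel_left _ hk]

lemma ptype_pos {n : ℕ} (σ : Equiv.Perm (Fin n)) {i : ℕ} (hi : i ∈ ptype σ) : 0 < i :=
  σ.partition.parts_pos hi

lemma ptype_sum {n : ℕ} (σ : Equiv.Perm (Fin n)) : (ptype σ).sum = n := by
  rw [ptype, σ.partition.parts_sum, Fintype.card_fin]

lemma good_iff {n : ℕ} (σ : Equiv.Perm (Fin n)) (A : Finset ℕ) :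
    (∀ x, Function.minimalPeriod ⇑σ x ∈ (A : Set ℕ)) ↔ ∀ i ∈ ptype σ, i ∈ A := by
  constructor
  · intro h i hi
    have h0 := ptype_pos σ hi
    have := count_ptype σ i h0
    have h2 : 0 < i * (ptype σ).count i := Nat.mul_pos h0 (Multiset.count_pos.2 hi)
    rw [← this, Finset.card_pos] at h2
    obtain ⟨x, hx⟩ := h2
    simp only [Finset.mem_filter, Finset.mem_univ, true_and] at hx
    rw [← hx]
    exact h x
  · intro h x
    apply h
    have := count_ptype σ _ (mp_pos σ x)
    rw [← Multiset.count_pos]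
    by_contra h0
    have h0 : (ptype σ).count (Function.minimalPeriod ⇑σ x) = 0 := by omega
    rw [h0, mul_zero, Finset.card_eq_zero] at this
    have hx : x ∈ (Finset.univ.filter (fun y : Fin n => Function.minimalPeriod ⇑σ y =
      Function.minimalPeriod ⇑σ x)) := by simp
    rw [this] at hx
    simp at hx

/-- The denominator attached to a cycle type. -/
noncomputable def wt (A : Finset ℕ) (s : Multiset ℕ) : ℕ :=
  s.prod * ∏ i ∈ A, (s.count i).factorial

lemma wt_eq (A : Finset ℕ) (s : Multiset ℕ) (hs : ∀ i ∈ s, i ∈ A) :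
    wt A s = s.prod * ∏ i ∈ s.toFinset, (s.count i).factorial := by
  rw [wt]
  congr 1
  symm
  apply Finset.prod_subset
  · intro i hi
    exact hs i (by simpa using hi)
  · intro i _ hi
    have : s.count i = 0 := by
      rw [Multiset.count_eq_zero]
      simpa using hi
    simp [this]

lemma ptype_eq_iff {n : ℕ} (σ : Equiv.Perm (Fin n)) (s : Multiset ℕ) (hs : s.sum = n)
    (hp : ∀ i ∈ s, 0 < i) : ptype σ = s ↔ σ.cycleType = s.filter (fun i => 2 ≤ i) := by
  have hsplit : ∀ t : Multiset ℕ, (∀ i ∈ t, 0 < i) →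
      t = t.filter (fun i => 2 ≤ i) +
        Multiset.replicate (t.sum - (t.filter (fun i => 2 ≤ i)).sum) 1 := by
    intro t ht
    have h1 : t.filter (fun i => ¬ 2 ≤ i) = Multiset.replicate (t.count 1) 1 := by
      rw [← Multiset.filter_eq']
      apply Multiset.filter_congr
      intro i hi
      have := ht i hi
      omega
    have h2 := Multiset.filter_add_not (fun i => 2 ≤ i) t
    rw [h1] at h2
    have h3 := congrArg Multiset.sum h2
    rw [Multiset.sum_add, Multiset.sum_replicate, smul_eq_mul, mul_one] at h3
    have h4 : t.sum - (t.filter (fun i => 2 ≤ i)).sum = t.count 1 := by omega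
    rw [h4]
    exact h2.symm
  constructor
  · rintro rfl
    exact (Equiv.Perm.filter_parts_partition_eq_cycleType).symm
  · intro h
    have h' : (ptype σ).filter (fun i => 2 ≤ i) = s.filter (fun i => 2 ≤ i) := by
      rw [← h]
      exact Equiv.Perm.filter_parts_partition_eq_cycleType
    rw [hsplit (ptype σ) (fun i hi => ptype_pos σ hi), hsplit s hp, h', ptype_sum, hs]

lemma card_ptype (n : ℕ) (A : Finset ℕ) (s : Multiset ℕ) (hs : s.sum = n)
    (hp : ∀ i ∈ s, 0 < i) (hA : ∀ i ∈ s, i ∈ A) :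
    (Finset.univ.filter (fun σ : Equiv.Perm (Fin n) => ptype σ = s)).card * wt A s
      = n.factorial := by
  have h := Equiv.Perm.card_of_cycleType_mul_eq (Fin n) (s.filter (fun i => 2 ≤ i))
  have h1 : s.filter (fun i => ¬ 2 ≤ i) = Multiset.replicate (s.count 1) 1 := by
    rw [← Multiset.filter_eq']
    apply Multiset.filter_congr
    intro i hi
    have := hp i hi
    omega
  have h2 := Multiset.filter_add_not (fun i => 2 ≤ i) s
  rw [h1] at h2
  have h3 := congrArg Multiset.sum h2
  rw [Multiset.sum_add, Multiset.sum_replicate, smul_eq_mul, mul_one, hs] at h3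
  have h4 := congrArg Multiset.prod h2
  rw [Multiset.prod_add, Multiset.prod_replicate, one_pow, mul_one] at h4
  rw [if_pos ⟨by rw [Fintype.card_fin]; omega, fun a ha => (Multiset.mem_filter.1 ha).2⟩,
    Fintype.card_fin, h4] at h
  have h5 : n - (s.filter (fun i => 2 ≤ i)).sum = s.count 1 := by omega
  rw [h5] at h
  rw [← h]
  congr 1
  · congr 1
    ext σ
    simp only [Finset.mem_filter, Finset.mem_univ, true_and]
    exact ptype_eq_iff σ s hs hp
  · rw [wt_eq A s hA]
    have h6 : ∏ i ∈ (s.filter (fun i => 2 ≤ i)).toFinset,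
        ((s.filter (fun i => 2 ≤ i)).count i).factorial
        = ∏ i ∈ (s.filter (fun i => 2 ≤ i)).toFinset, (s.count i).factorial := by
      apply Finset.prod_congr rfl
      intro i hi
      rw [Multiset.count_filter_of_pos]
      simp at hi
      exact hi.2
    rw [h6]
    have h7 : ∏ i ∈ s.toFinset, (s.count i).factorial =
       ∏ i ∈ insert 1 (s.filter (fun i => 2 ≤ i)).toFinset, (s.count i).factorial := by
      apply Finset.prod_subset
      · intro i hi
        have hi : i ∈ s := by simpa using hi
        have := hp i hi
        simp only [Finset.mem_insert, Multiset.mem_toFinset, Multiset.mem_filter]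
        by_cases h : i = 1
        · left; exact h
        · right; exact ⟨hi, by omega⟩
      · intro i _ hi
        have : s.count i = 0 := by
          rw [Multiset.count_eq_zero]
          simpa using hi
        simp [this]
    rw [h7, Finset.prod_insert (by simp)]
    ring

/-- Permutations with cycle lengths in A. -/
noncomputable def G (A : Finset ℕ) (n : ℕ) : Finset (Equiv.Perm (Fin n)) :=
  Finset.univ.filter (fun s : Equiv.Perm (Fin n) =>
            ∀ x, Function.minimalPeriod ⇑s x ∈ (A : Set ℕ))

noncomputable def T (A : Finset ℕ) (n : ℕ) : Finset (Multiset ℕ) := (G A n).image ptype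

lemma mem_T (A : Finset ℕ) (hApos : ∀ a ∈ A, 0 < a) (n : ℕ) (s : Multiset ℕ) :
    s ∈ T A n ↔ s.sum = n ∧ ∀ i ∈ s, i ∈ A := by
  simp only [T, G, Finset.mem_image, Finset.mem_filter, Finset.mem_univ, true_and, good_iff]
  constructor
  · rintro ⟨σ, h, rfl⟩
    exact ⟨ptype_sum σ, h⟩
  · rintro ⟨h1, h2⟩
    have h := card_ptype n A s h1 (fun i hi => hApos i (h2 i hi)) h2
    have h3 : 0 < (Finset.univ.filter (fun σ : Equiv.Perm (Fin n) => ptype σ = s)).card := by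
      rcases Nat.eq_zero_or_pos
        (Finset.univ.filter (fun σ : Equiv.Perm (Fin n) => ptype σ = s)).card with h0 | h0
      · rw [h0, zero_mul] at h
        exact absurd h.symm (Nat.factorial_ne_zero n)
      · exact h0
    rw [Finset.card_pos] at h3
    obtain ⟨σ, hσ⟩ := h3
    simp only [Finset.mem_filter, Finset.mem_univ, true_and] at hσ
    exact ⟨σ, by rw [hσ]; exact h2, hσ⟩

lemma sum_G (A : Finset ℕ) (hApos : ∀ a ∈ A, 0 < a) (n : ℕ) (f : Multiset ℕ → ℝ) :
    ∑ σ ∈ G A n, f (ptype σ) = ∑ s ∈ T A n, (n.factorial : ℝ) * (f s / wt A s) := by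
  rw [← Finset.sum_fiberwise_of_maps_to (s := G A n) (t := T A n) (g := ptype)
    (fun σ hσ => Finset.mem_image_of_mem _ hσ)]
  apply Finset.sum_congr rfl
  intro s hs
  obtain ⟨h1, h2⟩ := (mem_T A hApos n s).1 hs
  have h := card_ptype n A s h1 (fun i hi => hApos i (h2 i hi)) h2
  have h3 : (G A n).filter (fun σ => ptype σ = s) =
      Finset.univ.filter (fun σ : Equiv.Perm (Fin n) => ptype σ = s) := by
    ext σ
    simp only [G, Finset.mem_filter, Finset.mem_univ, true_and, good_iff]
    constructor
    · exact fun h => h.2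
    · intro h
      exact ⟨by rw [h]; exact h2, h⟩
  rw [h3, Finset.sum_congr rfl (g := fun _ => f s)
    (fun σ hσ => by rw [(Finset.mem_filter.1 hσ).2]), Finset.sum_const, nsmul_eq_mul, ← h]
  have h4 : (wt A s : ℝ) ≠ 0 := by
    intro h0
    have : wt A s = 0 := by exact_mod_cast h0
    rw [this, mul_zero] at h
    exact absurd h.symm (Nat.factorial_ne_zero n)
  push_cast
  field_simp

lemma wt_shift (A : Finset ℕ) (l : ℕ) (hl : l ∈ A) (p : ℕ) (s : Multiset ℕ) :
    wt A (s + Multiset.replicate p l) =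
      wt A s * (l ^ p * ((s + Multiset.replicate p l).count l).descFactorial p) := by
  rw [wt, wt, Multiset.prod_add, Multiset.prod_replicate, ← Finset.mul_prod_erase A _ hl,
    ← Finset.mul_prod_erase A _ hl]
  have h1 : ∏ i ∈ A.erase l, ((s + Multiset.replicate p l).count i).factorial =
      ∏ i ∈ A.erase l, (s.count i).factorial := by
    apply Finset.prod_congr rfl
    intro i hi
    have : l ≠ i := fun h => (Finset.ne_of_mem_erase hi) h.symm
    rw [Multiset.count_add, Multiset.count_replicate, if_neg this, add_zero]
  rw [h1, Multiset.count_add, Multiset.count_replicate_self]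
  have h2 := Nat.factorial_mul_descFactorial (n := s.count l + p) (k := p) (by omega)
  rw [Nat.add_sub_cancel] at h2
  rw [← h2]
  ring

lemma wt_pos (A : Finset ℕ) (s : Multiset ℕ) (hs : ∀ i ∈ s, 0 < i) : 0 < wt A s := by
  rw [wt]
  apply Nat.mul_pos
  · exact Multiset.prod_pos hs
  · exact Finset.prod_pos (fun i _ => Nat.factorial_pos _)

lemma term_eq (A : Finset ℕ) (hApos : ∀ a ∈ A, 0 < a) (l : ℕ) (hl : l ∈ A) (p : ℕ)
    (s : Multiset ℕ) (hs : ∀ i ∈ s, i ∈ A) :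
    (((l ^ p * (s.count l).descFactorial p : ℕ) : ℝ)) / wt A s =
      if Multiset.replicate p l ≤ s then 1 / (wt A (s - Multiset.replicate p l) : ℝ) else 0 := by
  split_ifs with h
  · have h1 := wt_shift A l hl p (s - Multiset.replicate p l)
    rw [tsub_add_cancel_of_le h] at h1
    have h2 := wt_pos A s (fun i hi => hApos i (hs i hi))
    have h3 := wt_pos A (s - Multiset.replicate p l)
      (fun i hi => hApos i (hs i (Multiset.mem_of_le tsub_le_self hi)))
    rw [div_eq_div_iff (by exact_mod_cast h2.ne') (by exact_mod_cast h3.ne'), h1]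
    push_cast
    ring
  · rw [← Multiset.le_count_iff_replicate_le] at h
    have : (s.count l).descFactorial p = 0 := by
      rw [Nat.descFactorial_eq_zero_iff_lt]; omega
    simp [this]

lemma swap_mem (A : Finset ℕ) (hApos : ∀ a ∈ A, 0 < a) (l d : ℕ)
    (hd : d ∈ A) (p q : ℕ) (hpq : p * l = q * d) (n : ℕ) (s : Multiset ℕ)
    (h : s ∈ (T A n).filter (fun s => Multiset.replicate p l ≤ s)) :
    s - Multiset.replicate p l + Multiset.replicate q d ∈
      (T A n).filter (fun s => Multiset.replicate q d ≤ s) := by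
  simp only [Finset.mem_filter, mem_T A hApos] at h ⊢
  obtain ⟨⟨h1, h2⟩, h3⟩ := h
  refine ⟨⟨?_, ?_⟩, ?_⟩
  · rw [Multiset.sum_add, Multiset.sum_replicate, smul_eq_mul, ← hpq]
    rw [← h1]
    conv_rhs => rw [← tsub_add_cancel_of_le h3, Multiset.sum_add, Multiset.sum_replicate,
      smul_eq_mul]
  · intro i hi
    rcases Multiset.mem_add.1 hi with hi | hi
    · exact h2 i (Multiset.mem_of_le tsub_le_self hi)
    · rw [Multiset.eq_of_mem_replicate hi]; exact hd
  · exact le_add_self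

/-- Key identity. -/
lemma key_identity (A : Finset ℕ) (hApos : ∀ a ∈ A, 0 < a) (l d : ℕ) (hl : l ∈ A)
    (hd : d ∈ A) (p q : ℕ) (hpq : p * l = q * d) (n : ℕ) :
    ∑ σ ∈ G A n, ((l ^ p * (cycleCount σ l).descFactorial p : ℕ) : ℝ) =
    ∑ σ ∈ G A n, ((d ^ q * (cycleCount σ d).descFactorial q : ℕ) : ℝ) := by
  have e : ∀ k p, k ∈ A → ∑ σ ∈ G A n, ((k ^ p * (cycleCount σ k).descFactorial p : ℕ) : ℝ) =
      (n.factorial : ℝ) * ∑ s ∈ (T A n).filter (fun s => Multiset.replicate p k ≤ s),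
        1 / (wt A (s - Multiset.replicate p k) : ℝ) := by
    intro k p hk
    have := sum_G A hApos n (fun s => ((k ^ p * (s.count k).descFactorial p : ℕ) : ℝ))
    simp only [← cycleCount_eq _ k (hApos k hk)] at this
    rw [this, ← Finset.mul_sum, Finset.sum_filter]
    congr 1
    apply Finset.sum_congr rfl
    intro s hs
    exact term_eq A hApos k hk p s ((mem_T A hApos n s).1 hs).2
  rw [e l p hl, e d q hd]
  congr 1
  refine Finset.sum_bij' (fun s _ => s - Multiset.replicate p l + Multiset.replicate q d)
    (fun s _ => s - Multiset.replicate q d + Multiset.replicate p l)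
    (fun s hs => swap_mem A hApos l d hd p q hpq n s hs)
    (fun s hs => swap_mem A hApos d l hl q p hpq.symm n s hs) ?_ ?_ ?_
  · intro s hs
    rw [add_tsub_cancel_right, tsub_add_cancel_of_le (Finset.mem_filter.1 hs).2]
  · intro s hs
    rw [add_tsub_cancel_right, tsub_add_cancel_of_le (Finset.mem_filter.1 hs).2]
  · intro s hs
    rw [add_tsub_cancel_right]

lemma sum_cycleCount (A : Finset ℕ) (hApos : ∀ a ∈ A, 0 < a) (n : ℕ)
    (σ : Equiv.Perm (Fin n)) (hσ : σ ∈ G A n) : ∑ a ∈ A, a * cycleCount σ a = n := by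
  have h2 : ∀ i ∈ ptype σ, i ∈ A := by
    simpa only [G, Finset.mem_filter, Finset.mem_univ, true_and, good_iff] using hσ
  conv_rhs => rw [← ptype_sum σ, Finset.sum_multiset_count_of_subset (ptype σ) A
    (fun i hi => h2 i (by simpa using hi))]
  apply Finset.sum_congr rfl
  intro a ha
  rw [cycleCount_eq σ a (hApos a ha), smul_eq_mul, mul_comm]

lemma card_G (A : Finset ℕ) (n : ℕ) : permCount ↑A n = (G A n).card := by
  rw [permCount, Nat.card_eq_fintype_card, Fintype.card_subtype]
  rfl

/-- Expectation over the uniform distribution on `G A n`. -/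
noncomputable def Ex (A : Finset ℕ) (n : ℕ) (f : Equiv.Perm (Fin n) → ℝ) : ℝ :=
  (∑ σ ∈ G A n, f σ) / ((G A n).card : ℝ)

lemma Ex_mono (A : Finset ℕ) (n : ℕ) (f g : Equiv.Perm (Fin n) → ℝ)
    (h : ∀ σ ∈ G A n, f σ ≤ g σ) : Ex A n f ≤ Ex A n g := by
  unfold Ex
  gcongr with σ hσ
  exact h σ hσ

lemma Ex_add (A : Finset ℕ) (n : ℕ) (f g : Equiv.Perm (Fin n) → ℝ) :
    Ex A n (fun σ => f σ + g σ) = Ex A n f + Ex A n g := by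
  unfold Ex
  rw [Finset.sum_add_distrib, add_div]

lemma Ex_smul (A : Finset ℕ) (n : ℕ) (c : ℝ) (f : Equiv.Perm (Fin n) → ℝ) :
    Ex A n (fun σ => c * f σ) = c * Ex A n f := by
  unfold Ex
  rw [← Finset.mul_sum, mul_div_assoc]

lemma Ex_div (A : Finset ℕ) (n : ℕ) (c : ℝ) (f : Equiv.Perm (Fin n) → ℝ) :
    Ex A n (fun σ => f σ / c) = Ex A n f / c := by
  unfold Ex
  rw [← Finset.sum_div, div_right_comm]

lemma Ex_const (A : Finset ℕ) (n : ℕ) (h : (G A n).card ≠ 0) (c : ℝ) :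
    Ex A n (fun _ => c) = c := by
  unfold Ex
  rw [Finset.sum_const, nsmul_eq_mul]
  have : ((G A n).card : ℝ) ≠ 0 := by exact_mod_cast h
  field_simp

lemma Ex_sum (A : Finset ℕ) (n : ℕ) (B : Finset ℕ) (f : ℕ → Equiv.Perm (Fin n) → ℝ) :
    Ex A n (fun σ => ∑ b ∈ B, f b σ) = ∑ b ∈ B, Ex A n (f b) := by
  unfold Ex
  rw [Finset.sum_comm, Finset.sum_div]

lemma Ex_congr (A : Finset ℕ) (n : ℕ) (f g : Equiv.Perm (Fin n) → ℝ)
    (h : ∀ σ ∈ G A n, f σ = g σ) : Ex A n f = Ex A n g := by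
  unfold Ex
  rw [Finset.sum_congr rfl h]

/-- The filter of the statement. -/
noncomputable def LL (A : Finset ℕ) : Filter ℕ :=
  atTop ⊓ Filter.principal {n | permCount ↑A n ≠ 0}

lemma LL_le (A : Finset ℕ) : LL A ≤ atTop := inf_le_left

lemma LL_ev (A : Finset ℕ) : ∀ᶠ n in LL A, (G A n).card ≠ 0 := by
  have : {n | permCount ↑A n ≠ 0} ∈ LL A := mem_inf_of_right (mem_principal_self _)
  filter_upwards [this] with n hn
  rw [← card_G]
  exact hn

lemma pow_le_desc (K : ℕ) (hK : 1 ≤ K) (N k : ℕ) :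
    (N : ℝ) ^ k ≤ (1 + 1 / (K : ℝ)) ^ k * (N.descFactorial k : ℝ)
      + ((k : ℝ) * ((K : ℝ) + 1)) ^ k := by
  have hK' : (1 : ℝ) ≤ K := by exact_mod_cast hK
  by_cases h : N < k * (K + 1)
  · have h1 : (N : ℝ) ≤ (k : ℝ) * ((K : ℝ) + 1) := by exact_mod_cast h.le
    have h2 : (N : ℝ) ^ k ≤ ((k : ℝ) * ((K : ℝ) + 1)) ^ k := by gcongr
    have h3 : 0 ≤ (1 + 1 / (K : ℝ)) ^ k * (N.descFactorial k : ℝ) := by positivity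
    linarith
  · push Not at h
    have h1 : (k : ℝ) * ((K : ℝ) + 1) ≤ N := by exact_mod_cast h
    have hk : k ≤ N := le_trans (Nat.le_mul_of_pos_right k (by omega)) h
    have h2 : ((N + 1 - k : ℕ) : ℝ) ^ k ≤ (N.descFactorial k : ℝ) := by
      exact_mod_cast Nat.pow_sub_le_descFactorial N k
    have h3 : ((N + 1 - k : ℕ) : ℝ) = (N : ℝ) + 1 - k := by
      rw [Nat.cast_sub (by omega)]; push_cast; ring
    have h4 : (N : ℝ) ≤ (1 + 1 / (K : ℝ)) * ((N + 1 - k : ℕ) : ℝ) := by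
      rw [h3]
      have : (1 + 1 / (K : ℝ)) * ((N : ℝ) + 1 - k) - N =
        ((N - (k : ℝ) * ((K : ℝ) + 1)) + K + 1) / K := by
        field_simp
        ring
      have h5 : 0 ≤ ((N - (k : ℝ) * ((K : ℝ) + 1)) + K + 1) / K := by
        apply div_nonneg <;> linarith
      linarith
    have h5 : (N : ℝ) ^ k ≤ (1 + 1 / (K : ℝ)) ^ k * (N.descFactorial k : ℝ) := by
      calc (N : ℝ) ^ k ≤ ((1 + 1 / (K : ℝ)) * ((N + 1 - k : ℕ) : ℝ)) ^ k := by gcongr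
        _ = (1 + 1 / (K : ℝ)) ^ k * ((N + 1 - k : ℕ) : ℝ) ^ k := by rw [mul_pow]
        _ ≤ _ := by gcongr
    have h6 : 0 ≤ ((k : ℝ) * ((K : ℝ) + 1)) ^ k := by positivity
    linarith

lemma mul_count_le (A : Finset ℕ) (hApos : ∀ a ∈ A, 0 < a) (n : ℕ)
    (σ : Equiv.Perm (Fin n)) (hσ : σ ∈ G A n) (a : ℕ) (ha : a ∈ A) :
    a * cycleCount σ a ≤ n := by
  refine le_trans ?_ (sum_cycleCount A hApos n σ hσ).le
  exact Finset.single_le_sum (f := fun a => a * cycleCount σ a) (fun _ _ => Nat.zero_le _) ha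

lemma desc_le (A : Finset ℕ) (hApos : ∀ a ∈ A, 0 < a) (n : ℕ)
    (σ : Equiv.Perm (Fin n)) (hσ : σ ∈ G A n) (a : ℕ) (ha : a ∈ A) (q : ℕ) :
    ((a ^ q * (cycleCount σ a).descFactorial q : ℕ) : ℝ) ≤ (n : ℝ) ^ q := by
  have h : a ^ q * (cycleCount σ a).descFactorial q ≤ n ^ q := by
    calc a ^ q * (cycleCount σ a).descFactorial q ≤ a ^ q * (cycleCount σ a) ^ q := by
          gcongr; exact Nat.descFactorial_le_pow _ _
      _ = (a * cycleCount σ a) ^ q := by rw [mul_pow]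
      _ ≤ n ^ q := by gcongr; exact mul_count_le A hApos n σ hσ a ha
  exact_mod_cast h

lemma Ex_key (A : Finset ℕ) (hApos : ∀ a ∈ A, 0 < a) (l d : ℕ) (hl : l ∈ A)
    (hd : d ∈ A) (p q : ℕ) (hpq : p * l = q * d) (n : ℕ) :
    Ex A n (fun σ => ((l ^ p * (cycleCount σ l).descFactorial p : ℕ) : ℝ)) =
    Ex A n (fun σ => ((d ^ q * (cycleCount σ d).descFactorial q : ℕ) : ℝ)) := by
  unfold Ex
  rw [key_identity A hApos l d hl hd p q hpq n]

lemma small (A : Finset ℕ) (hApos : ∀ a ∈ A, 0 < a) (l d : ℕ) (hl : l ∈ A)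
    (hd : d ∈ A) (hld : l < d) :
    Tendsto (fun n : ℕ => Ex A n (fun σ => (l : ℝ) * cycleCount σ l / n)) (LL A) (nhds 0) := by
  set C : ℝ := 2 ^ d + ((d : ℝ) * 2) ^ d with hC
  have hlpos := hApos l hl
  have hbound : ∀ᶠ n : ℕ in LL A,
      (Ex A n (fun σ => (cycleCount σ l : ℝ) ^ d)) ≤ C * (n : ℝ) ^ l := by
    filter_upwards [LL_ev A, LL_le A (eventually_ge_atTop 1)] with n hn hn1
    have hn1' : (1 : ℝ) ≤ n := by exact_mod_cast hn1
    calc Ex A n (fun σ => (cycleCount σ l : ℝ) ^ d)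
        ≤ Ex A n (fun σ => 2 ^ d * ((l ^ d * (cycleCount σ l).descFactorial d : ℕ) : ℝ)
            + ((d : ℝ) * 2) ^ d) := by
          apply Ex_mono
          intro σ _
          have h := pow_le_desc 1 le_rfl (cycleCount σ l) d
          norm_num at h
          norm_num
          have h2 : (1 : ℝ) ≤ (l : ℝ) ^ d := one_le_pow₀ (by exact_mod_cast hlpos)
          have h3 : (0 : ℝ) ≤ ((cycleCount σ l).descFactorial d : ℝ) := by positivity
          have h4 : (2 : ℝ) ^ d * ((cycleCount σ l).descFactorial d : ℝ) ≤
             2 ^ d * ((l : ℝ) ^ d * ((cycleCount σ l).descFactorial d : ℝ)) := by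
            gcongr
            nlinarith
          linarith
      _ = 2 ^ d * Ex A n (fun σ => ((d ^ l * (cycleCount σ d).descFactorial l : ℕ) : ℝ))
            + ((d : ℝ) * 2) ^ d := by
          rw [Ex_add, Ex_smul, Ex_const A n hn, Ex_key A hApos l d hl hd d l (mul_comm _ _) n]
      _ ≤ 2 ^ d * (n : ℝ) ^ l + ((d : ℝ) * 2) ^ d * (n : ℝ) ^ l := by
          have h1 : Ex A n (fun σ => ((d ^ l * (cycleCount σ d).descFactorial l : ℕ) : ℝ))
              ≤ (n : ℝ) ^ l := by
            rw [← Ex_const A n hn ((n : ℝ) ^ l)]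
            exact Ex_mono _ _ _ _ (fun σ hσ => desc_le A hApos n σ hσ d hd l)
          have h2 : (1 : ℝ) ≤ (n : ℝ) ^ l := one_le_pow₀ hn1'
          have h3 : (0 : ℝ) ≤ ((d : ℝ) * 2) ^ d := by positivity
          gcongr
          nlinarith
      _ = C * (n : ℝ) ^ l := by rw [hC]; ring
  have hpw : ∀ ε : ℝ, 0 < ε → ∀ x : ℝ, 0 ≤ x → x ≤ ε + x ^ d / ε ^ (d - 1) := by
    intro ε hε x hx
    by_cases h : x ≤ ε
    · have : 0 ≤ x ^ d / ε ^ (d - 1) := by positivity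
      linarith
    · push Not at h
      have : x ≤ x ^ d / ε ^ (d - 1) := by
        rw [le_div_iff₀ (by positivity)]
        calc x * ε ^ (d - 1) ≤ x * x ^ (d - 1) := by gcongr
          _ = x ^ d := by rw [← pow_succ']; congr 1; omega
      linarith
  rw [Metric.tendsto_nhds]
  intro ε hε
  set δ : ℝ := ε / (2 * l) with hδ
  have hlr : (0 : ℝ) < l := by exact_mod_cast hlpos
  have hδ0 : 0 < δ := by positivity
  have hlim : Tendsto (fun n : ℕ => (l : ℝ) * C / δ ^ (d - 1) / (n : ℝ)) (LL A) (nhds 0) :=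
    (tendsto_const_div_atTop_nhds_zero_nat _).mono_left (LL_le A)
  filter_upwards [hbound, LL_ev A, LL_le A (eventually_ge_atTop 1),
    hlim.eventually (gt_mem_nhds (half_pos hε))] with n hb hn hn1 hlt
  have hn1' : (1 : ℝ) ≤ n := by exact_mod_cast hn1
  have h0 : 0 ≤ Ex A n (fun σ => (l : ℝ) * cycleCount σ l / n) := by
    rw [← Ex_const A n hn 0]
    apply Ex_mono
    intro σ _
    positivity
  rw [Real.dist_eq, sub_zero, abs_of_nonneg h0]
  calc Ex A n (fun σ => (l : ℝ) * cycleCount σ l / n)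
      ≤ Ex A n (fun σ => l * δ + l / δ ^ (d - 1) / (n : ℝ) ^ d * (cycleCount σ l : ℝ) ^ d) := by
        apply Ex_mono
        intro σ _
        have h := hpw δ hδ0 ((cycleCount σ l : ℝ) / n) (by positivity)
        calc (l : ℝ) * cycleCount σ l / n = l * ((cycleCount σ l : ℝ) / n) := by ring
          _ ≤ l * (δ + ((cycleCount σ l : ℝ) / n) ^ d / δ ^ (d - 1)) := by gcongr
          _ = _ := by rw [div_pow]; field_simp
    _ = l * δ + l / δ ^ (d - 1) / (n : ℝ) ^ d * Ex A n (fun σ => (cycleCount σ l : ℝ) ^ d) := by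
        rw [Ex_add, Ex_const A n hn, Ex_smul]
    _ ≤ l * δ + l / δ ^ (d - 1) / (n : ℝ) ^ d * (C * (n : ℝ) ^ l) := by gcongr
    _ ≤ l * δ + l / δ ^ (d - 1) / (n : ℝ) ^ d * (C * (n : ℝ) ^ (d - 1)) := by
        have : 0 ≤ C := by positivity
        gcongr
        omega
    _ = l * δ + (l : ℝ) * C / δ ^ (d - 1) / (n : ℝ) := by
        congr 1
        have : (n : ℝ) ^ d = (n : ℝ) ^ (d - 1) * n := by
          rw [← pow_succ]; congr 1; omega
        rw [this]
        field_simp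
    _ < ε / 2 + ε / 2 := by
        have : (l : ℝ) * δ = ε / 2 := by rw [hδ]; field_simp
        rw [this]
        linarith
    _ = ε := by ring

lemma big (A : Finset ℕ) (hApos : ∀ a ∈ A, 0 < a) (d : ℕ)
    (hd : d ∈ A) (hmax : ∀ a ∈ A, a ≤ d) :
    Tendsto (fun n : ℕ => Ex A n (fun σ => (d : ℝ) * cycleCount σ d / n)) (LL A) (nhds 1) := by
  have h1 : Tendsto (fun n : ℕ => 1 - ∑ a ∈ A.erase d,
      Ex A n (fun σ => (a : ℝ) * cycleCount σ a / n)) (LL A)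
      (nhds (1 - ∑ a ∈ A.erase d, 0)) := by
    apply Tendsto.const_sub
    apply tendsto_finsetSum
    intro a ha
    have h2 := Finset.mem_of_mem_erase ha
    exact small A hApos a d h2 hd (lt_of_le_of_ne (hmax a h2) (Finset.ne_of_mem_erase ha))
  rw [Finset.sum_const_zero, sub_zero] at h1
  refine h1.congr' ?_
  filter_upwards [LL_ev A, LL_le A (eventually_ge_atTop 1)] with n hn hn1
  have hn1' : (1 : ℝ) ≤ n := by exact_mod_cast hn1
  rw [sub_eq_iff_eq_add, ← Ex_sum, ← Ex_add]
  symm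
  rw [← Ex_const A n hn 1]
  apply Ex_congr
  intro σ hσ
  rw [Finset.add_sum_erase A (fun a => (a : ℝ) * (cycleCount σ a : ℝ) / (n : ℝ)) hd,
    ← Finset.sum_div, div_eq_one_iff_eq (by positivity)]
  exact_mod_cast sum_cycleCount A hApos n σ hσ

lemma big_desc (A : Finset ℕ) (hApos : ∀ a ∈ A, 0 < a) (d : ℕ)
    (hd : d ∈ A) (hmax : ∀ a ∈ A, a ≤ d) (q : ℕ) (hq : 1 ≤ q) :
    Tendsto (fun n : ℕ => Ex A n (fun σ =>
      ((d ^ q * (cycleCount σ d).descFactorial q : ℕ) : ℝ)) / (n : ℝ) ^ q) (LL A) (nhds 1) := by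
  have h1 : Tendsto (fun n : ℕ => (1 - q * (1 + q * d / (n : ℝ))) + q *
      Ex A n (fun σ => (d : ℝ) * cycleCount σ d / n)) (LL A)
      (nhds ((1 - q * (1 + 0)) + q * 1)) := by
    apply Tendsto.add
    · apply Tendsto.const_sub
      apply Tendsto.const_mul
      apply Tendsto.const_add
      exact (tendsto_const_div_atTop_nhds_zero_nat _).mono_left (LL_le A)
    · exact (big A hApos d hd hmax).const_mul _
  rw [show (1 - (q : ℝ) * (1 + 0)) + q * 1 = 1 by ring] at h1
  refine tendsto_of_tendsto_of_tendsto_of_le_of_le' h1 tendsto_const_nhds ?_ ?_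
  · filter_upwards [LL_ev A, LL_le A (eventually_ge_atTop 1),
      LL_le A (eventually_ge_atTop (q * d))] with n hn hn1 hn2
    have hn1' : (1 : ℝ) ≤ n := by exact_mod_cast hn1
    have hn2' : (q : ℝ) * d ≤ n := by exact_mod_cast hn2
    rw [← Ex_smul, ← Ex_const A n hn (1 - q * (1 + q * d / (n : ℝ))), ← Ex_add, ← Ex_div]
    apply Ex_mono
    intro σ hσ
    have hqr : (1 : ℝ) ≤ q := by exact_mod_cast hq
    set Z : ℝ := (d : ℝ) * cycleCount σ d / n with hZ
    have hZ0 : 0 ≤ Z := by positivity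
    have hZn : Z * n = (d : ℝ) * cycleCount σ d := by rw [hZ]; field_simp
    set w : ℝ := q * d / (n : ℝ) with hw
    have hw0 : 0 ≤ w := by positivity
    have hw1 : w ≤ 1 := by rw [hw, div_le_one (by positivity)]; exact hn2'
    have hwn : w * n = q * d := by rw [hw]; field_simp
    have e : 1 - (q : ℝ) * (1 + w) + q * Z = 1 + q * (Z - w - 1) := by ring
    rw [e]
    by_cases hc : q ≤ cycleCount σ d
    · have hb := one_add_mul_le_pow (a := Z - w - 1) (by linarith) q
      refine hb.trans ?_
      rw [le_div_iff₀ (by positivity), ← mul_pow]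
      have e2 : (1 + (Z - w - 1)) * (n : ℝ) = d * ((cycleCount σ d - q : ℕ) : ℝ) := by
        rw [Nat.cast_sub hc]
        calc (1 + (Z - w - 1)) * (n : ℝ) = Z * n - w * n := by ring
          _ = _ := by rw [hZn, hwn]; ring
      rw [e2, mul_pow]
      push_cast
      gcongr
      have h3 := Nat.pow_sub_le_descFactorial (cycleCount σ d) q
      have h4 : (cycleCount σ d - q) ^ q ≤ (cycleCount σ d + 1 - q) ^ q :=
        Nat.pow_le_pow_left (by omega) q
      exact_mod_cast h4.trans h3
    · push Not at hc
      have h3 : Z ≤ w := by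
        rw [hZ, hw]
        have : (cycleCount σ d : ℝ) ≤ q := by exact_mod_cast hc.le
        rw [mul_comm (q : ℝ)]
        gcongr
      have h4 : 1 + (q : ℝ) * (Z - w - 1) ≤ 0 := by nlinarith
      exact h4.trans (by positivity)
  · filter_upwards [LL_ev A, LL_le A (eventually_ge_atTop 1)] with n hn hn1
    have hn1' : (1 : ℝ) ≤ n := by exact_mod_cast hn1
    rw [div_le_one (by positivity), ← Ex_const A n hn ((n : ℝ) ^ q)]
    exact Ex_mono _ _ _ _ (fun σ hσ => desc_le A hApos n σ hσ d hd q)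

lemma mom_s19 (A : Finset ℕ) (hApos : ∀ a ∈ A, 0 < a) (l d : ℕ) (hl : l ∈ A)
    (hd : d ∈ A) (hmax : ∀ a ∈ A, a ≤ d) (j : ℕ) (hj : 1 ≤ j) :
    Tendsto (fun n : ℕ => Ex A n (fun σ =>
      ((l : ℝ) * cycleCount σ l) ^ (j * d)) / (n : ℝ) ^ (j * l)) (LL A) (nhds 1) := by
  have hjl : 1 ≤ j * l := Nat.mul_pos hj (hApos l hl)
  have hD := big_desc A hApos d hd hmax (j * l) hjl
  have hk : ∀ n, Ex A n (fun σ =>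
      ((d ^ (j * l) * (cycleCount σ d).descFactorial (j * l) : ℕ) : ℝ)) =
      Ex A n (fun σ => ((l ^ (j * d) * (cycleCount σ l).descFactorial (j * d) : ℕ) : ℝ)) :=
    fun n => (Ex_key A hApos l d hl hd (j * d) (j * l) (by ring) n).symm
  simp only [hk] at hD
  set k := j * d with hkdef
  have hup : ∀ K : ℕ, 1 ≤ K → ∀ᶠ n : ℕ in LL A, Ex A n (fun σ =>
      ((l : ℝ) * cycleCount σ l) ^ k) / (n : ℝ) ^ (j * l) ≤
      (1 + 1 / (K : ℝ)) ^ k * (Ex A n (fun σ =>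
        ((l ^ k * (cycleCount σ l).descFactorial k : ℕ) : ℝ)) / (n : ℝ) ^ (j * l))
      + (l : ℝ) ^ k * ((k : ℝ) * ((K : ℝ) + 1)) ^ k / (n : ℝ) ^ (j * l) := by
    intro K hK
    filter_upwards [LL_ev A] with n hn
    rw [← mul_div_assoc, ← add_div]
    gcongr
    rw [← Ex_smul, ← Ex_const A n hn ((l : ℝ) ^ k * ((k : ℝ) * ((K : ℝ) + 1)) ^ k), ← Ex_add]
    apply Ex_mono
    intro σ _
    rw [mul_pow]
    have h := pow_le_desc K hK (cycleCount σ l) k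
    calc (l : ℝ) ^ k * (cycleCount σ l : ℝ) ^ k ≤ (l : ℝ) ^ k * _ :=
          mul_le_mul_of_nonneg_left h (by positivity)
      _ = _ := by push_cast; ring
  have hlimK : ∀ K : ℕ, Tendsto (fun n : ℕ => (1 + 1 / (K : ℝ)) ^ k * (Ex A n (fun σ =>
        ((l ^ k * (cycleCount σ l).descFactorial k : ℕ) : ℝ)) / (n : ℝ) ^ (j * l))
      + (l : ℝ) ^ k * ((k : ℝ) * ((K : ℝ) + 1)) ^ k / (n : ℝ) ^ (j * l)) (LL A)
      (nhds ((1 + 1 / (K : ℝ)) ^ k * 1 + 0)) := by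
    intro K
    refine (hD.const_mul _).add ?_
    have h2 : Tendsto (fun n : ℕ => (n : ℝ) ^ (j * l)) (LL A) atTop :=
      ((tendsto_pow_atTop (by omega)).comp tendsto_natCast_atTop_atTop).mono_left (LL_le A)
    exact h2.const_div_atTop _
  have hKlim : Tendsto (fun K : ℕ => (1 + 1 / (K : ℝ)) ^ k * 1 + 0) atTop (nhds 1) := by
    have : Tendsto (fun K : ℕ => (1 + 1 / (K : ℝ)) ^ k * 1 + 0) atTop
        (nhds ((1 + 0) ^ k * 1 + 0)) :=
      (((tendsto_one_div_atTop_nhds_zero_nat.const_add 1).pow k).mul_const 1).add_const 0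
    simpa using this
  rw [tendsto_order]
  constructor
  · intro b hb
    filter_upwards [hD.eventually (lt_mem_nhds hb)] with n hn
    refine hn.trans_le ?_
    gcongr
    apply Ex_mono
    intro σ _
    rw [mul_pow]
    push_cast
    gcongr
    exact_mod_cast Nat.descFactorial_le_pow _ _
  · intro b hb
    obtain ⟨K, hK, hK1⟩ := ((hKlim.eventually (gt_mem_nhds hb)).and
      (eventually_ge_atTop 1)).exists
    filter_upwards [hup K hK1, (hlimK K).eventually (gt_mem_nhds hK)] with n h1 h2
    exact h1.trans_lt h2

lemma sq_Ex (A : Finset ℕ) (n : ℕ) (hn : (G A n).card ≠ 0) (f : Equiv.Perm (Fin n) → ℝ) :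
    (Ex A n f - 1) ^ 2 ≤ Ex A n (fun σ => (f σ - 1) ^ 2) := by
  set e := Ex A n f with he
  have h : Ex A n (fun σ => -(e ^ 2 - 1) + 2 * (e - 1) * f σ) ≤ Ex A n (fun σ => (f σ - 1) ^ 2) := by
    apply Ex_mono
    intro σ _
    nlinarith [sq_nonneg (f σ - e)]
  rw [Ex_add, Ex_const A n hn, Ex_smul, ← he] at h
  nlinarith

lemma abs_pow_sub (y : ℝ) (hy : 0 ≤ y) (d : ℕ) (hd : 1 ≤ d) :
    (y - 1) ^ 2 ≤ (y ^ d - 1) ^ 2 := by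
  rw [sq_le_sq]
  rcases le_total 1 y with h | h
  · have h1 : y ≤ y ^ d := le_self_pow₀ h (by omega)
    rw [abs_of_nonneg (by linarith), abs_of_nonneg (by linarith)]
    linarith
  · have h1 : y ^ d ≤ y := pow_le_of_le_one hy h (by omega)
    rw [abs_of_nonpos (by linarith), abs_of_nonpos (by linarith)]
    linarith

theorem stmt_19 (A : Finset ℕ) (hApos : ∀ a ∈ A, 0 < a) (hA : A.Nonempty)
    (d : ℕ) (hd : d = A.max' hA) (l : ℕ) (hl : l ∈ A) (m : ℕ) (hm : 1 ≤ m) :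
    Tendsto (fun n : ℕ =>
      ((∑ s ∈ Finset.univ.filter (fun s : Equiv.Perm (Fin n) =>
            ∀ x, Function.minimalPeriod ⇑s x ∈ (A : Set ℕ)),
          (cycleCount s l : ℝ) ^ m) /
        (permCount ↑A n : ℝ)) /
        ((n : ℝ) ^ (((m : ℝ) * l) / d) / (l : ℝ) ^ m))
      (atTop ⊓ Filter.principal {n | permCount ↑A n ≠ 0}) (nhds 1) := by
  have hdA : d ∈ A := hd ▸ A.max'_mem hA
  have hmax : ∀ a ∈ A, a ≤ d := fun a ha => hd ▸ A.le_max' a ha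
  have hdpos := hApos d hdA
  have hlpos := hApos l hl
  have hdr : (0 : ℝ) < d := by exact_mod_cast hdpos
  have hlr : (0 : ℝ) < l := by exact_mod_cast hlpos
  -- the normalised variable
  let t : ℕ → ℝ := fun n => (n : ℝ) ^ ((l : ℝ) / d)
  have ht : ∀ n, t n ^ d = (n : ℝ) ^ l := by
    intro n
    change ((n : ℝ) ^ ((l : ℝ) / d)) ^ d = _
    rw [← Real.rpow_natCast, ← Real.rpow_mul (Nat.cast_nonneg n), div_mul_cancel₀ _ hdr.ne',
      Real.rpow_natCast]
  let E : ℕ → ℕ → ℝ := fun k n => Ex A n (fun σ => ((l : ℝ) * cycleCount σ l / t n) ^ k)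
  have hE : ∀ j, 1 ≤ j → Tendsto (E (j * d)) (LL A) (nhds 1) := by
    intro j hj
    refine (mom_s19 A hApos l d hl hdA hmax j hj).congr ?_
    intro n
    simp only [E]
    rw [← Ex_div]
    apply Ex_congr
    intro σ _
    rw [div_pow, mul_comm j d, pow_mul (t n), ht, ← pow_mul, mul_comm j l]
  have h1 := hE m hm
  have h2 := hE (2 * m) (by omega)
  have h3 : Tendsto (fun n => E (2 * m * d) n + (-2 * E (m * d) n + 1)) (LL A)
      (nhds (1 + (-2 * 1 + 1))) := h2.add ((h1.const_mul (-2)).add_const 1)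
  rw [show (1 : ℝ) + (-2 * 1 + 1) = 0 by norm_num] at h3
  have h4 : Tendsto (fun n => (E m n - 1) ^ 2) (LL A) (nhds 0) := by
    refine tendsto_of_tendsto_of_tendsto_of_le_of_le' tendsto_const_nhds h3
      (Eventually.of_forall fun n => sq_nonneg _) ?_
    filter_upwards [LL_ev A] with n hn
    refine (sq_Ex A n hn _).trans ?_
    rw [← Ex_const A n hn 1, ← Ex_smul, ← Ex_add, ← Ex_add]
    apply Ex_mono
    intro σ _
    have ht0 : 0 ≤ t n := Real.rpow_nonneg (Nat.cast_nonneg n) _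
    have hy : 0 ≤ (l : ℝ) * cycleCount σ l / t n := by positivity
    set y := (l : ℝ) * cycleCount σ l / t n
    have h5 := abs_pow_sub (y ^ m) (by positivity) d hdpos
    refine le_trans ?_ (h5.trans (le_of_eq ?_))
    · rw [Ex_const A n hn 1]
    · rw [pow_mul y m d, mul_assoc, pow_mul' y 2 (m * d), pow_mul y m d]
      ring
  have h5 : Tendsto (E m) (LL A) (nhds 1) := by
    have h6 : Tendsto (fun n => |E m n - 1|) (LL A) (nhds 0) := by
      have := h4.sqrt
      simpa [Real.sqrt_sq_eq_abs] using this
    have h7 := (tendsto_zero_iff_abs_tendsto_zero _).2 h6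
    simpa using h7.add_const 1
  refine Tendsto.congr ?_ h5
  intro n
  change E m n = (∑ s ∈ G A n, (cycleCount s l : ℝ) ^ m) / (permCount ↑A n : ℝ) / _
  rw [card_G]
  change Ex A n _ = Ex A n _ / _
  rw [← Ex_div]
  apply Ex_congr
  intro σ _
  have h8 : (n : ℝ) ^ (((m : ℝ) * l) / d) = t n ^ m := by
    change _ = ((n : ℝ) ^ ((l : ℝ) / d)) ^ m
    rw [← Real.rpow_natCast, ← Real.rpow_mul (Nat.cast_nonneg n)]
    congr 1
    ring
  rw [h8, div_pow, mul_pow, div_div_eq_mul_div]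
  ring
end
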